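/- arXiv:1710.06131 — 4 statements merged into one kernel-verified Lean document; each statement's English description precedes it below -/
import Mathlib

section
/- Let n > 2 be a prime and let q be a prime power that is a primitive root modulo n (i.e. q generates the multiplicative group of integers modulo n). Then there exists a primitive 1-normal element of F_{q^n} over F_q. -/
open Polynomial

noncomputable section

/-- For `f = Σ aᵢ xⁱ ∈ F_q[x]` and `α` in an extension, `f ∘ α = Σ aᵢ α^(qⁱ)`. -/
def frobComp {F K : Type*} [Field F] [Field K] [Algebra F K] (q : ℕ) (f : F[X]) (α : K) : K :=
  ∑ i ∈ Finset.range (f.natDegree + 1), algebraMap F K (f.coeff i) * α ^ q ^ i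

/-- `g` is the minimal polynomial of `α` with respect to the Frobenius `σ_q`:
monic, annihilates `α` under `∘`, and has least degree with these properties. -/
def IsFrobMinimal {F K : Type*} [Field F] [Field K] [Algebra F K] (q : ℕ) (g : F[X]) (α : K) :
    Prop :=
  g.Monic ∧ frobComp q g α = 0 ∧
    ∀ h : F[X], h.Monic → frobComp q h α = 0 → g.natDegree ≤ h.natDegree

/-- `α ∈ F_{qⁿ}` is `k`-normal over `F_q` if the `F_q`-span of `{α, α^q, …, α^(q^(n-1))}`
has dimension `n - k`. -/
def IskNormal (q n k : ℕ) (F : Type*) {K : Type*} [Field F] [Field K] [Algebra F K] (α : K) :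
    Prop :=
  Module.finrank F (Submodule.span F (Set.range fun i : Fin n => α ^ q ^ (i : ℕ))) = n - k

/-- `α` is primitive: it generates the multiplicative group of the field. -/
def IsPrimitiveElt {K : Type*} [Field K] (α : K) : Prop :=
  ∀ b : K, b ≠ 0 → ∃ m : ℕ, α ^ m = b

/-- `α` is `m`-free: `gcd(m, (xⁿ - 1)/m_{σ_q,α}) = 1`. -/
def IsPolyFree {F K : Type*} [Field F] [Field K] [Algebra F K] (q n : ℕ) (m : F[X]) (α : K) :
    Prop :=
  ∀ g : F[X], IsFrobMinimal q g α → IsCoprime m ((X ^ n - 1) /ₘ g)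

/-- `W(t)`: number of squarefree divisors of a positive integer `t`. -/
def Wint (t : ℕ) : ℕ := Set.ncard {d : ℕ | d ∣ t ∧ Squarefree d}

/-- `W(g)`: number of monic divisors of the polynomial `g`. -/
def Wpoly {F : Type*} [Field F] (g : F[X]) : ℕ := Set.ncard {h : F[X] | h.Monic ∧ h ∣ g}

/-- `Φ_q(f)`: number of units in `F_q[x]/⟨f⟩`. -/
def PhiPoly {F : Type*} [Field F] (f : F[X]) : ℕ := Nat.card (F[X] ⧸ Ideal.span {f})ˣ



lemma aux_prime_cong (q n : ℕ) (hn : n.Prime) (hn2 : 2 < n)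
    (hprim : orderOf (q : ZMod n) = n - 1) (l : ℕ) (hl : l.Prime)
    (hd : l ∣ ∑ i ∈ Finset.range n, q ^ i) : n ∣ l - 1 ∧ l ≠ 2 := by
  have := Fact.mk hl
  have := Fact.mk hn
  have h0 : ∑ i ∈ Finset.range n, (q : ZMod l) ^ i = 0 := by
    have := (ZMod.natCast_eq_zero_iff _ _).2 hd
    push_cast at this; exact this
  have h1 : (q : ZMod l) ^ n = 1 := by
    have := geom_sum_mul (q : ZMod l) n
    rw [h0, zero_mul] at this
    exact (sub_eq_zero.1 this.symm)
  have h2 : (q : ZMod l) ≠ 1 := by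
    intro h
    rw [h] at h0
    simp at h0
    have h3 := (ZMod.natCast_eq_zero_iff _ _).1 h0
    have h4 : l = n := (Nat.prime_dvd_prime_iff_eq hl hn).1 h3
    subst h4
    rw [h, orderOf_one] at hprim
    omega
  have h3 : orderOf (q : ZMod l) = n := orderOf_eq_prime h1 h2
  have hq0 : (q : ZMod l) ≠ 0 := by
    intro h
    rw [h, zero_pow hn.ne_zero] at h1
    exact zero_ne_one h1
  have h5 : n ∣ l - 1 := by
    rw [← h3]; exact orderOf_dvd_of_pow_eq_one (ZMod.pow_card_sub_one_eq_one hq0)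
  refine ⟨h5, ?_⟩
  rintro rfl
  have := Nat.le_of_dvd (by norm_num) h5
  omega

lemma aux_S (S : Finset ℕ) (hS : ∀ l ∈ S, l.Prime ∧ l % 6 = 1) :
    (S.card = 2 → 91 ≤ ∏ l ∈ S, l) ∧ (S.card = 3 → 1729 ≤ ∏ l ∈ S, l) ∧
    (S.card = 4 → 53599 ≤ ∏ l ∈ S, l) ∧ (5 ≤ S.card → 16 ^ S.card ≤ ∏ l ∈ S, l) := by
  set A := S.filter (fun l => l ∈ ({7, 13, 19, 31} : Finset ℕ)) with hA
  set B := S.filter (fun l => l ∉ ({7, 13, 19, 31} : Finset ℕ)) with hB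
  have hc : A.card + B.card = S.card := Finset.card_filter_add_card_filter_not _
  have hp : (∏ l ∈ A, l) * ∏ l ∈ B, l = ∏ l ∈ S, l := Finset.prod_filter_mul_prod_filter_not _ _ _
  have hB37 : 37 ^ B.card ≤ ∏ l ∈ B, l := by
    apply Finset.pow_card_le_prod
    intro l hl
    rw [hB, Finset.mem_filter] at hl
    obtain ⟨h1, h2⟩ := hl
    obtain ⟨h3, h4⟩ := hS l h1
    by_contra h
    push Not at h
    interval_cases l <;> first | omega | (exfalso; revert h3; norm_num; done) | (revert h2; decide)
  have hAm : A ∈ ({7, 13, 19, 31} : Finset ℕ).powerset := by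
    rw [Finset.mem_powerset]
    intro l hl
    exact (Finset.mem_filter.1 hl).2
  have key : ∀ A ∈ ({7, 13, 19, 31} : Finset ℕ).powerset,
     (∀ j < 5, (A.card + j = 2 → 91 ≤ (∏ l ∈ A, l) * 37 ^ j) ∧
      (A.card + j = 3 → 1729 ≤ (∏ l ∈ A, l) * 37 ^ j) ∧
      (A.card + j = 4 → 53599 ≤ (∏ l ∈ A, l) * 37 ^ j) ∧
      (5 ≤ A.card + j → 16 ^ (A.card + j) ≤ (∏ l ∈ A, l) * 37 ^ j)) ∧
      16 ^ (A.card + 5) ≤ (∏ l ∈ A, l) * 37 ^ 5 := by decide +kernel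
  obtain ⟨k1, k2⟩ := key A hAm
  have hle : (∏ l ∈ A, l) * 37 ^ B.card ≤ ∏ l ∈ S, l := by
    rw [← hp]; exact Nat.mul_le_mul_left _ hB37
  rw [← hc]
  by_cases hj : B.card < 5
  · obtain ⟨a, b, c, d⟩ := k1 _ hj
    exact ⟨fun h => (a h).trans hle, fun h => (b h).trans hle, fun h => (c h).trans hle,
      fun h => (d h).trans hle⟩
  · refine ⟨by omega, by omega, by omega, fun _ => le_trans ?_ hle⟩
    obtain ⟨m, hm⟩ := Nat.exists_eq_add_of_le (not_lt.1 hj)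
    rw [hm, pow_add 37, ← add_assoc, pow_add 16, ← mul_assoc]
    exact Nat.mul_le_mul k2 (Nat.pow_le_pow_left (by norm_num) _)

lemma aux_arith (q n : ℕ) (hq : 2 ≤ q) (hn : n.Prime) (hn2 : 2 < n)
    (hprim : orderOf (q : ZMod n) = n - 1) (Q : ℕ) (hQ : Q = ∑ i ∈ Finset.range n, q ^ i) :
    (2 ^ Q.primeFactors.card - 1) ^ 2 * q ^ n < (Q - 1) ^ 2 := by
  have hpc : ∀ l ∈ Q.primeFactors, n ∣ l - 1 ∧ l ≠ 2 := fun l hl =>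
    aux_prime_cong q n hn hn2 hprim l (Nat.prime_of_mem_primeFactors hl)
      (hQ ▸ Nat.dvd_of_mem_primeFactors hl)
  have hgeom : Q * (q - 1) + 1 = q ^ n := by
    obtain ⟨r, rfl⟩ : ∃ r, q = r + 1 := ⟨q - 1, by omega⟩
    rw [hQ, Nat.add_sub_cancel]
    exact geom_sum_mul_add r n
  have hQ0 : Q ≠ 0 := by
    rintro rfl
    have : 1 < q ^ n := Nat.one_lt_pow hn.ne_zero hq
    omega
  have hprod : ∏ l ∈ Q.primeFactors, l ≤ Q := Nat.le_of_dvd (Nat.pos_of_ne_zero hQ0) (Nat.prod_primeFactors_dvd Q)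
  by_cases h3 : n = 3
  · subst h3
    have hQ' : Q = q ^ 2 + q + 1 := by
      rw [hQ]; simp [Finset.sum_range_succ]; ring
    have hq3 : q % 3 = 2 := by
      have h := ZMod.natCast_mod q 3
      have : q % 3 < 3 := Nat.mod_lt _ (by norm_num)
      interval_cases hh : q % 3
      · rw [← h] at hprim
        exfalso; 
        have : orderOf ((0:ℕ) : ZMod 3) = 0 := by
          rw [orderOf_eq_zero_iff']; intro n hn; simp [hn.ne']
        omega
      · rw [← h] at hprim
        simp at hprim
      · rfl
    have hS : ∀ l ∈ Q.primeFactors, l.Prime ∧ l % 6 = 1 := by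
      intro l hl
      have hlp := Nat.prime_of_mem_primeFactors hl
      refine ⟨hlp, ?_⟩
      obtain ⟨h1, h2⟩ := hpc l hl
      have := hlp.eq_two_or_odd
      have := hlp.two_le
      omega
    obtain ⟨k2, k3, k4, k5⟩ := aux_S _ hS
    have main : (2 ^ Q.primeFactors.card - 1) ^ 2 * q < (q + 1) ^ 2 := by
      rcases Nat.lt_or_ge Q.primeFactors.card 5 with h | h
      · interval_cases hc : Q.primeFactors.card
        · simp
        · norm_num; nlinarith
        · have := (k2 rfl).trans hprod
          have : 9 ≤ q := by by_contra hh; push Not at hh; nlinarith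
          norm_num; nlinarith
        · have := (k3 rfl).trans hprod
          have h42 : 42 ≤ q := by by_contra hh; push Not at hh; nlinarith
          have h44 : q ≠ 44 := by
            rintro rfl
            have : Q = 7 * 283 := by rw [hQ']; norm_num
            rw [this, Nat.primeFactors_mul (by norm_num) (by norm_num), Nat.Prime.primeFactors (by norm_num), Nat.Prime.primeFactors (by norm_num)] at hc
            revert hc; decide
          have : 47 ≤ q := by omega
          norm_num; nlinarith
        · have := (k4 rfl).trans hprod
          have : 231 ≤ q := by by_contra hh; push Not at hh; nlinarith
          norm_num; nlinarith
      · have := (k5 h).trans hprod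
        set w := Q.primeFactors.card
        have h16 : 16 ^ w = (4 ^ w) ^ 2 := by rw [← pow_mul, mul_comm w 2, pow_mul]; norm_num
        have h4 : 4 ^ w = (2 ^ w) ^ 2 := by rw [← pow_mul, mul_comm w 2, pow_mul]; norm_num
        have hq4 : 4 ^ w ≤ q := by
          rw [h16] at this
          by_contra hh
          push Not at hh
          nlinarith
        calc (2 ^ w - 1) ^ 2 * q ≤ (2 ^ w) ^ 2 * q := by gcongr; exact Nat.sub_le _ _
          _ = 4 ^ w * q := by rw [h4]
          _ ≤ q * q := by gcongr
          _ < (q + 1) ^ 2 := by nlinarith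
    have : (Q - 1) = q * (q + 1) := by rw [hQ']; simp; ring
    rw [this]
    calc _ = ((2 ^ Q.primeFactors.card - 1) ^ 2 * q) * q ^ 2 := by ring
      _ < (q + 1) ^ 2 * q ^ 2 := by gcongr
      _ = _ := by ring
  · have hn5 : 5 ≤ n := by
      by_contra h
      have : n = 4 := by omega
      subst this; revert hn; norm_num
    set w := Q.primeFactors.card with hw
    have h8 : 8 ^ w ≤ Q := by
      refine le_trans ?_ hprod
      apply Finset.pow_card_le_prod
      intro l hl
      have hlp := Nat.prime_of_mem_primeFactors hl
      obtain ⟨h1, h2⟩ := hpc l hl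
      have h3 := hlp.eq_two_or_odd
      have := hlp.two_le
      obtain ⟨c, hc⟩ := h1
      have : 2 ≤ c := by
        by_contra hh
        have : c = 0 ∨ c = 1 := by omega
        rcases this with rfl | rfl
        · omega
        · have := hn.eq_two_or_odd
          omega
      have : 5 * 2 ≤ n * c := Nat.mul_le_mul hn5 this
      omega
    have hq4 : q ^ 4 ≤ Q := by
      rw [hQ]
      exact Finset.single_le_sum (f := fun i => q ^ i) (fun _ _ => Nat.zero_le _) (Finset.mem_range.2 (show 4 < n by omega))
    obtain ⟨W, hW⟩ : ∃ W, W = 2 ^ w := ⟨_, rfl⟩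
    rw [← hW]
    have hW3 : W ^ 3 ≤ Q := by
      rw [hW, ← pow_mul, mul_comm, pow_mul]; exact h8
    have hW1 : 1 ≤ W := hW ▸ Nat.one_le_two_pow
    have hQ16 : 16 ≤ Q := le_trans (by simpa using Nat.pow_le_pow_left hq 4) hq4
    have hlt : W ^ 2 * q < Q := by
      by_contra hh
      push Not at hh
      have e1 : Q ^ 12 ≤ (W ^ 2 * q) ^ 12 := Nat.pow_le_pow_left hh 12
      have e2 : (W ^ 2 * q) ^ 12 = (W ^ 3) ^ 8 * (q ^ 4) ^ 3 := by ring
      have e3 : (W ^ 3) ^ 8 * (q ^ 4) ^ 3 ≤ Q ^ 8 * Q ^ 3 := by gcongr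
      have e4 : Q ^ 8 * Q ^ 3 < Q ^ 12 := by
        rw [← pow_add]; exact Nat.pow_lt_pow_right (by omega) (by norm_num)
      omega
    rcases Nat.eq_or_lt_of_le hW1 with h1 | h1
    · have h5 : 0 < Q - 1 := Nat.sub_pos_of_lt (lt_of_lt_of_le (by norm_num) hQ16)
      rw [← h1, Nat.sub_self, zero_pow two_ne_zero, zero_mul]
      exact pow_pos h5 2
    · have e5 : (W - 1) ^ 2 * q + 2 ≤ Q := by
        clear hW hW3 h8
        obtain ⟨V, rfl⟩ : ∃ V, W = V + 1 := ⟨W - 1, by omega⟩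
        simp only [Nat.add_sub_cancel]
        have : 1 ≤ V := by omega
        nlinarith
      have e6 : q ^ n ≤ q * Q := by
        rw [← hgeom]
        obtain ⟨r, rfl⟩ : ∃ r, q = r + 1 := ⟨q - 1, by omega⟩
        simp only [Nat.add_sub_cancel]
        nlinarith
      obtain ⟨R, rfl⟩ : ∃ R, Q = R + 2 := ⟨Q - 2, by omega⟩
      calc (W - 1) ^ 2 * q ^ n ≤ (W - 1) ^ 2 * (q * (R + 2)) := by gcongr
        _ = ((W - 1) ^ 2 * q) * (R + 2) := by ring
        _ ≤ R * (R + 2) := by gcongr; omega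
        _ < (R + 2 - 1) ^ 2 := by
          have : R + 2 - 1 = R + 1 := by omega
          rw [this]; nlinarith

noncomputable def sieveN {K : Type} [Field K] (H : Finset K) (c : ℕ → MulChar K ℂ)
    (T : Finset ℕ) (ψ : MulChar K ℂ) : ℂ :=
  ∑ x ∈ H, ψ x * ∏ l ∈ T, (1 - ((l : ℂ) - 1)⁻¹ * ∑ j ∈ Finset.Ico 1 l, (c l ^ j) x)

lemma sieveN_insert {K : Type} [Field K] (H : Finset K) (c : ℕ → MulChar K ℂ)
    (T : Finset ℕ) (l : ℕ) (hl : l ∉ T) (ψ : MulChar K ℂ) :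
    sieveN H c (insert l T) ψ = sieveN H c T ψ -
      ((l : ℂ) - 1)⁻¹ * ∑ j ∈ Finset.Ico 1 l, sieveN H c T (c l ^ j * ψ) := by
  unfold sieveN
  rw [Finset.sum_comm, Finset.mul_sum, ← Finset.sum_sub_distrib]
  refine Finset.sum_congr rfl fun x _ => ?_
  rw [Finset.prod_insert hl]
  simp only [MulChar.mul_apply]
  simp_rw [mul_assoc]
  rw [← Finset.sum_mul]
  ring

lemma avg_bound (l : ℕ) (hl : 2 ≤ l) (f : ℕ → ℂ) (B : ℝ) (h : ∀ j ∈ Finset.Ico 1 l, ‖f j‖ ≤ B) :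
    ‖((l : ℂ) - 1)⁻¹ * ∑ j ∈ Finset.Ico 1 l, f j‖ ≤ B := by
  have e : ((l : ℂ) - 1) = ((l - 1 : ℕ) : ℂ) := by push_cast [Nat.cast_sub (by omega : 1 ≤ l)]; rfl
  have hpos : (0 : ℝ) < ((l - 1 : ℕ) : ℝ) := by exact_mod_cast (by omega : 0 < l - 1)
  rw [e, norm_mul, norm_inv, Complex.norm_natCast, inv_mul_le_iff₀ hpos]
  calc _ ≤ ∑ j ∈ Finset.Ico 1 l, ‖f j‖ := norm_sum_le _ _
    _ ≤ ∑ j ∈ Finset.Ico 1 l, B := Finset.sum_le_sum h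
    _ = _ := by simp

lemma char_step {G : Type*} [CommGroup G] (c ψ : G) (l : ℕ) (hl : l.Prime) (hc : orderOf c = l)
    (hψ : ¬ l ∣ orderOf ψ) (j : ℕ) (hj : j ∈ Finset.Ico 1 l) :
    c ^ j * ψ ≠ 1 ∧ ∀ p : ℕ, p.Prime → p ≠ l → ¬ p ∣ orderOf ψ → ¬ p ∣ orderOf (c ^ j * ψ) := by
  rw [Finset.mem_Ico] at hj
  constructor
  · intro h
    have h1 : ψ = (c ^ j)⁻¹ := eq_inv_of_mul_eq_one_right h
    apply hψ
    rw [h1, orderOf_inv]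
    have h2 : orderOf (c ^ j) = l := by
      rw [Nat.Coprime.orderOf_pow, hc]
      rw [hc]
      exact (Nat.coprime_of_lt_prime (by omega) hj.2 hl)
    rw [h2]
  · intro p hp hpl hpψ h
    have h1 : orderOf (c ^ j * ψ) ∣ l * orderOf ψ := by
      apply orderOf_dvd_of_pow_eq_one
      have e1 : (c ^ j) ^ (l * orderOf ψ) = 1 := by
        rw [← pow_mul, ← orderOf_dvd_iff_pow_eq_one, hc]
        exact ⟨j * orderOf ψ, by ring⟩
      have e2 : ψ ^ (l * orderOf ψ) = 1 := by
        rw [← orderOf_dvd_iff_pow_eq_one]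
        exact Dvd.intro_left _ rfl
      rw [mul_pow, e1, e2, one_mul]
    rcases (hp.dvd_mul).1 (h.trans h1) with h2 | h2
    · exact hpl ((Nat.prime_dvd_prime_iff_eq hp hl).1 h2)
    · exact hpψ h2

lemma sieve_bound {K : Type} [Field K] (H : Finset K) (c : ℕ → MulChar K ℂ) (Q : ℕ) (B : ℝ)
    (hB : ∀ ψ : MulChar K ℂ, ψ ≠ 1 → ψ ^ Q = 1 → ‖∑ x ∈ H, ψ x‖ ≤ B) (T : Finset ℕ)
    (hT : ∀ l ∈ T, l.Prime ∧ l ∣ Q ∧ orderOf (c l) = l) :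
    (∀ ψ : MulChar K ℂ, ψ ≠ 1 → ψ ^ Q = 1 → (∀ l ∈ T, ¬ l ∣ orderOf ψ) →
      ‖sieveN H c T ψ‖ ≤ 2 ^ T.card * B) ∧
    ‖sieveN H c T 1 - ∑ x ∈ H, (1 : MulChar K ℂ) x‖ ≤ (2 ^ T.card - 1) * B := by
  induction T using Finset.induction_on with
  | empty =>
    constructor
    · intro ψ h1 h2 _
      simpa [sieveN] using hB ψ h1 h2
    · simp [sieveN]
  | insert l T hl ih =>
    obtain ⟨ih1, ih2⟩ := ih fun p hp => hT p (Finset.mem_insert_of_mem hp)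
    obtain ⟨hlp, hlQ, hlc⟩ := hT l (Finset.mem_insert_self _ _)
    have step : ∀ ψ : MulChar K ℂ, ψ ^ Q = 1 → (∀ p ∈ insert l T, ¬ p ∣ orderOf ψ) →
        ‖((l : ℂ) - 1)⁻¹ * ∑ j ∈ Finset.Ico 1 l, sieveN H c T (c l ^ j * ψ)‖ ≤ 2 ^ T.card * B := by
      intro ψ h2 h3
      apply avg_bound l hlp.two_le
      intro j hj
      obtain ⟨s1, s2⟩ := char_step (c l) ψ l hlp hlc (h3 l (Finset.mem_insert_self _ _)) j hj
      refine ih1 _ s1 ?_ ?_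
      · have e1 : c l ^ Q = 1 := by rw [← orderOf_dvd_iff_pow_eq_one, hlc]; exact hlQ
        rw [mul_pow, h2, mul_one, ← pow_mul, mul_comm, pow_mul, e1, one_pow]
      · intro p hp
        refine s2 p (hT p (Finset.mem_insert_of_mem hp)).1 ?_ (h3 p (Finset.mem_insert_of_mem hp))
        rintro rfl; exact hl hp
    rw [Finset.card_insert_of_notMem hl, pow_succ]
    constructor
    · intro ψ h1 h2 h3
      rw [sieveN_insert _ _ _ _ hl]
      have := ih1 ψ h1 h2 fun p hp => h3 p (Finset.mem_insert_of_mem hp)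
      have := step ψ h2 h3
      refine (norm_sub_le _ _).trans ?_
      linarith
    · rw [sieveN_insert _ _ _ _ hl, sub_right_comm]
      refine (norm_sub_le _ _).trans ?_
      have := step 1 (one_pow _) (by
        intro p hp h
        rw [orderOf_one] at h
        exact (hT p hp).1.one_lt.ne' (Nat.dvd_one.1 h))
      linarith

lemma gauss_norm {K : Type} [Field K] [Fintype K] (χ : MulChar K ℂ) (hχ : χ ≠ 1)
    (ψ : AddChar K ℂ) (hψ : ψ.IsPrimitive) : ‖gaussSum χ ψ‖ = Real.sqrt (Fintype.card K) := by
  have h := gaussSum_mul_gaussSum_eq_card hχ hψ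
  rw [← star_gaussSum_eq] at h
  have h2 : (‖gaussSum χ ψ‖ ^ 2 : ℝ) = Fintype.card K := by
    have : ((‖gaussSum χ ψ‖ ^ 2 : ℝ) : ℂ) = (Fintype.card K : ℂ) := by
      rw [← h]; push_cast; exact (Complex.mul_conj' _).symm
    exact_mod_cast this
  rw [← h2, Real.sqrt_sq (norm_nonneg _)]

lemma exists_prim (F : Type) [Field F] [Fintype F] : ∃ ψ : AddChar F ℂ, ψ.IsPrimitive := by
  obtain ⟨ψ, hψ⟩ := AddChar.exists_apply_ne_zero.2 (one_ne_zero : (1 : F) ≠ 0)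
  exact ⟨ψ, AddChar.IsPrimitive.of_ne_one (by rintro rfl; simp at hψ)⟩

open Classical in
lemma hyper_sum (F K : Type) [Field F] [Fintype F] [Field K] [Fintype K] [Algebra F K]
    (χ : MulChar K ℂ) (hχ : χ ≠ 1) (hF : ∀ c : F, c ≠ 0 → χ (algebraMap F K c) = 1) :
    (Fintype.card F : ℝ) * ‖∑ x ∈ Finset.univ.filter (fun x : K => Algebra.trace F K x = 0), χ x‖ =
      (Fintype.card F - 1) * Real.sqrt (Fintype.card K) := by
  obtain ⟨ψ, hψ⟩ := exists_prim F
  let Ψ : AddChar K ℂ := ψ.compAddMonoidHom (Algebra.trace F K).toAddMonoidHom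
  have hΨ : Ψ.IsPrimitive := by
    apply AddChar.IsPrimitive.of_ne_one
    intro h
    obtain ⟨a, ha⟩ : ∃ a, ψ a ≠ 1 := by
      by_contra hh; push Not at hh
      have := hψ (one_ne_zero)
      apply this
      ext a
      simp [hh]
    obtain ⟨x, hx⟩ := Algebra.trace_surjective F K a
    apply ha
    rw [← hx]
    exact DFunLike.congr_fun h x
  have key : (Fintype.card F : ℂ) * ∑ x ∈ Finset.univ.filter (fun x : K => Algebra.trace F K x = 0), χ x
      = (Fintype.card F - 1) * gaussSum χ Ψ := by
    have e1 : ∀ x : K, ∑ c : F, ψ (c * Algebra.trace F K x) =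
        if Algebra.trace F K x = 0 then (Fintype.card F : ℂ) else 0 := by
      intro x
      have := AddChar.sum_mulShift (Algebra.trace F K x) hψ
      simpa using this
    have e2 : ∑ c : F, gaussSum χ (Ψ.mulShift (algebraMap F K c)) =
        (Fintype.card F : ℂ) * ∑ x ∈ Finset.univ.filter (fun x : K => Algebra.trace F K x = 0), χ x := by
      simp only [gaussSum]
      rw [Finset.sum_comm, Finset.mul_sum, Finset.sum_filter]
      refine Finset.sum_congr rfl fun x _ => ?_
      rw [← Finset.mul_sum]
      have : ∀ c : F, (Ψ.mulShift (algebraMap F K c)) x = ψ (c * Algebra.trace F K x) := by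
        intro c
        rw [AddChar.mulShift_apply, ← Algebra.smul_def]
        simp [Ψ]
      simp_rw [this, e1]
      split_ifs <;> ring
    rw [← e2, ← Finset.add_sum_erase _ _ (Finset.mem_univ (0 : F))]
    have e3 : gaussSum χ (Ψ.mulShift (algebraMap F K 0)) = 0 := by
      simp [gaussSum_one_right hχ]
    rw [e3, zero_add]
    rw [Finset.sum_congr rfl (g := fun _ => gaussSum χ Ψ)]
    · rw [Finset.sum_const, Finset.card_erase_of_mem (Finset.mem_univ _), Finset.card_univ, nsmul_eq_mul,
        Nat.cast_sub Fintype.card_pos]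
      simp
    · intro c hc
      have hc0 := Finset.ne_of_mem_erase hc
      have hu : algebraMap F K c ≠ 0 := by simpa using hc0
      have := gaussSum_mulShift χ Ψ (Units.mk0 _ hu)
      simpa [hF c hc0] using this
  have := congrArg norm key
  rw [norm_mul, norm_mul, gauss_norm χ hχ Ψ hΨ, Complex.norm_natCast] at this
  rw [this]
  congr 1
  have : ((Fintype.card F : ℂ) - 1) = ((Fintype.card F - 1 : ℕ) : ℂ) := by
    rw [Nat.cast_sub Fintype.card_pos]; simp
  rw [this, Complex.norm_natCast, Nat.cast_sub Fintype.card_pos]; simp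

lemma aux_irred (q n : ℕ) (hq : IsPrimePow q) (hn : n.Prime) (hn2 : 2 < n)
    (hprim : orderOf (q : ZMod n) = n - 1)
    (F : Type) [Field F] [Fintype F] (hcF : Fintype.card F = q) :
    Irreducible (cyclotomic n F) := by
  have := Fact.mk hn
  obtain ⟨p, f, hp, hf, hpf⟩ := hq
  have hp' : p.Prime := hp.nat_prime
  have := Fact.mk hp'
  have hcop : p.Coprime n := by
    rw [Nat.coprime_primes hp' hn]
    rintro rfl
    rw [← hpf] at hprim
    have : ((p ^ f : ℕ) : ZMod p) = 0 := by
      push_cast; rw [ZMod.natCast_self, zero_pow hf.ne']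
    rw [this] at hprim
    have : orderOf (0 : ZMod p) = 0 := by
      rw [orderOf_eq_zero_iff']; intro n hn; simp [hn.ne']
    omega
  refine irreducible_of_dvd_cyclotomic_of_natDegree (hcF.trans hpf.symm) hcop dvd_rfl ?_
  rw [natDegree_cyclotomic, Nat.totient_prime hn, ← hprim, ← orderOf_units, ZMod.coe_unitOfCoprime,
    hpf]

lemma aux_normal (q n : ℕ) (hq : IsPrimePow q) (hn : n.Prime) (hn2 : 2 < n)
    (hprim : orderOf (q : ZMod n) = n - 1)
    (F K : Type) [Field F] [Fintype F] [Field K] [Fintype K] [Algebra F K]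
    (hcF : Fintype.card F = q) (hrK : Module.finrank F K = n) (α : K) (hα : α ≠ 0)
    (htr : Algebra.trace F K α = 0) : IskNormal q n 1 F α := by
  have hirr := aux_irred q n hq hn hn2 hprim F hcF
  let σ := FiniteField.frobeniusAlgEquivOfAlgebraic F K
  let φ : Module.End F K := σ.toLinearMap
  have hσ : ∀ (i : ℕ) (x : K), (σ ^ i) x = x ^ q ^ i := by
    intro i x
    rw [AlgEquiv.coe_pow, FiniteField.coe_frobeniusAlgEquivOfAlgebraic_iterate, hcF]
  have hφ : ∀ (i : ℕ) (x : K), (φ ^ i) x = x ^ q ^ i := by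
    intro i x
    rw [← hσ, Module.End.coe_pow, AlgEquiv.coe_pow]
    rfl
  have hcyc : aeval φ (cyclotomic n F) α = 0 := by
    have := Fact.mk hn
    rw [cyclotomic_prime]
    simp only [map_sum, map_pow, aeval_X, LinearMap.sum_apply, hφ]
    have := FiniteField.algebraMap_trace_eq_sum_pow F K α
    rw [htr, hrK, map_zero, Nat.card_eq_fintype_card, hcF] at this
    exact this.symm
  have hli : LinearIndependent F (fun i : Fin (n - 1) => α ^ q ^ (i : ℕ)) := by
    rw [Fintype.linearIndependent_iff]
    intro g hg
    let P : F[X] := ∑ i : Fin (n - 1), C (g i) * X ^ (i : ℕ)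
    have hPd : P.degree < (n - 1 : ℕ) := by
      refine (degree_sum_le _ _).trans_lt ?_
      rw [Finset.sup_lt_iff (WithBot.bot_lt_coe _)]
      intro i _
      refine (degree_C_mul_X_pow_le _ _).trans_lt ?_
      exact_mod_cast i.2
    have hPα : aeval φ P α = 0 := by
      rw [← hg]
      simp [P, map_sum, LinearMap.sum_apply, hφ, Algebra.smul_def]
    have hP0 : P = 0 := by
      by_contra hP0
      have hcop : IsCoprime (cyclotomic n F) P := by
        rw [hirr.coprime_iff_not_dvd]
        intro hd
        have := degree_le_of_dvd hd hP0
        rw [degree_cyclotomic, Nat.totient_prime hn] at this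
        exact absurd hPd (not_lt.2 this)
      obtain ⟨a, b, hab⟩ := hcop
      apply hα
      have := congrArg (fun R => aeval φ R α) hab
      simpa [Module.End.mul_apply, hcyc, hPα] using this.symm
    intro i
    have := congrArg (fun R => R.coeff (i : ℕ)) hP0
    simpa [P, finsetSum_coeff, coeff_X_pow, Fin.val_inj] using this
  have : FiniteDimensional F K := Module.finite_of_finrank_pos (by rw [hrK]; exact hn.pos)
  unfold IskNormal
  apply le_antisymm
  · have hle : Submodule.span F (Set.range fun i : Fin n => α ^ q ^ (i : ℕ)) ≤
        LinearMap.ker (Algebra.trace F K) := by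
      rw [Submodule.span_le]
      rintro _ ⟨i, rfl⟩
      simp only [SetLike.mem_coe, LinearMap.mem_ker]
      rw [← hσ, Algebra.trace_eq_of_algEquiv, htr]
    refine (Submodule.finrank_mono hle).trans ?_
    have h1 := LinearMap.finrank_range_add_finrank_ker (Algebra.trace F K)
    rw [LinearMap.range_eq_top.2 (Algebra.trace_surjective F K), finrank_top, Module.finrank_self, hrK] at h1
    omega
  · have h1 := finrank_span_eq_card hli
    rw [Fintype.card_fin] at h1
    rw [← h1]
    apply Submodule.finrank_mono
    apply Submodule.span_mono
    rintro _ ⟨i, rfl⟩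
    exact ⟨⟨i, by omega⟩, rfl⟩

open Classical in
lemma card_sum (q n : ℕ) (hn : n.Prime)
    (F K : Type) [Field F] [Fintype F] [Field K] [Fintype K] [Algebra F K]
    (hcF : Fintype.card F = q) (hrK : Module.finrank F K = n) :
    ∑ x ∈ Finset.univ.filter (fun x : K => Algebra.trace F K x = 0), (1 : MulChar K ℂ) x =
      (q : ℂ) ^ (n - 1) - 1 := by
  set H := Finset.univ.filter (fun x : K => Algebra.trace F K x = 0) with hH
  have : FiniteDimensional F K := Module.finite_of_finrank_pos (by rw [hrK]; exact hn.pos)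
  have hker : Module.finrank F (LinearMap.ker (Algebra.trace F K)) = n - 1 := by
    have h1 := LinearMap.finrank_range_add_finrank_ker (Algebra.trace F K)
    rw [LinearMap.range_eq_top.2 (Algebra.trace_surjective F K), finrank_top,
      Module.finrank_self, hrK] at h1
    omega
  have hcard : H.card = q ^ (n - 1) := by
    have := Module.card_eq_pow_finrank (K := F) (V := LinearMap.ker (Algebra.trace F K))
    rw [hker, hcF] at this
    rw [← this, hH, ← Fintype.card_subtype]
    exact Fintype.card_congr (Equiv.refl _)
  have h0 : (0 : K) ∈ H := by simp [hH]
  rw [← Finset.add_sum_erase _ _ h0, MulChar.map_zero, zero_add,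
    Finset.sum_congr rfl (g := fun _ => (1 : ℂ))]
  · rw [Finset.sum_const, Finset.card_erase_of_mem h0, hcard, nsmul_eq_mul, mul_one,
      Nat.cast_sub (hcard ▸ Finset.card_pos.2 ⟨_, h0⟩)]
    simp
  · intro x hx
    exact MulChar.one_apply (Ne.isUnit (Finset.ne_of_mem_erase hx))

lemma exists_nonpow (q n : ℕ) (hn : n.Prime) (hn2 : 2 < n)
    (hprim : orderOf (q : ZMod n) = n - 1)
    (F K : Type) [Field F] [Fintype F] [Field K] [Fintype K] [Algebra F K]
    (hcF : Fintype.card F = q) (hrK : Module.finrank F K = n)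
    (Q : ℕ) (hQ : Q = ∑ i ∈ Finset.range n, q ^ i) :
    ∃ α : K, α ≠ 0 ∧ Algebra.trace F K α = 0 ∧ ∀ l : ℕ, l.Prime → l ∣ Q → ∀ y : K, y ^ l ≠ α := by
  classical
  have hq2 : 2 ≤ q := hcF ▸ Fintype.one_lt_card
  have hcK : Fintype.card K = q ^ n := by
    have : FiniteDimensional F K := Module.finite_of_finrank_pos (by rw [hrK]; exact hn.pos)
    rw [Module.card_eq_pow_finrank (K := F), hcF, hrK]
  have hnorm : ∀ x : K, algebraMap F K (Algebra.norm F x) = x ^ Q := by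
    intro x
    rw [FiniteField.algebraMap_norm_eq_pow_sum, hrK, Nat.card_eq_fintype_card, hcF, hQ]
  have hgeom : Q * (q - 1) + 1 = q ^ n := by
    clear hprim hcK hnorm hcF
    obtain ⟨r, rfl⟩ : ∃ r, q = r + 1 := ⟨q - 1, by omega⟩
    rw [hQ, Nat.add_sub_cancel]
    exact geom_sum_mul_add r n
  have hQ1 : 1 ≤ Q := by
    rcases Nat.eq_zero_or_pos Q with h | h
    · have : 1 < q ^ n := Nat.one_lt_pow hn.ne_zero hq2
      rw [h] at hgeom; omega
    · exact h
  have hex : ∀ l : ℕ, ∃ χ : MulChar K ℂ, l ∈ Q.primeFactors → orderOf χ = l := by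
    intro l
    by_cases hl : l ∈ Q.primeFactors
    · have hp := Nat.prime_of_mem_primeFactors hl
      obtain ⟨χ, h⟩ := MulChar.exists_mulChar_orderOf K (n := l)
        (by rw [hcK, ← hgeom, Nat.add_sub_cancel]
            exact (Nat.dvd_of_mem_primeFactors hl).mul_right _)
        (Complex.isPrimitiveRoot_exp l hp.ne_zero)
      exact ⟨χ, fun _ => h⟩
    · exact ⟨1, fun h => absurd h hl⟩
  choose c hc using hex
  set H := Finset.univ.filter (fun x : K => Algebra.trace F K x = 0) with hH
  set B : ℝ := ((q : ℝ) - 1) * Real.sqrt ((q : ℝ) ^ n) / q with hBdef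
  have hq0 : (0 : ℝ) < q := by exact_mod_cast (by omega : 0 < q)
  have hB : ∀ ψ : MulChar K ℂ, ψ ≠ 1 → ψ ^ Q = 1 → ‖∑ x ∈ H, ψ x‖ ≤ B := by
    intro ψ h1 h2
    have := hyper_sum F K ψ h1 (by
      intro a ha
      obtain ⟨y, rfl⟩ := FiniteField.norm_surjective F K a
      have hy : y ≠ 0 := by rintro rfl; simp [hrK, hn.ne_zero] at ha
      rw [hnorm, map_pow, ← MulChar.pow_apply' _ (by omega), h2]
      exact MulChar.one_apply (Ne.isUnit hy))
    rw [hcF, hcK] at this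
    push_cast at this
    rw [hBdef, le_div_iff₀ hq0, mul_comm, ← this]
  obtain ⟨-, hmain⟩ := sieve_bound H c Q B hB Q.primeFactors (fun l hl =>
    ⟨Nat.prime_of_mem_primeFactors hl, Nat.dvd_of_mem_primeFactors hl, hc l hl⟩)
  rw [hH, card_sum q n hn F K hcF hrK, ← hH] at hmain
  by_contra hcon
  push Not at hcon
  have hzero : sieveN H c Q.primeFactors 1 = 0 := by
    unfold sieveN
    apply Finset.sum_eq_zero
    intro x hx
    by_cases hx0 : x = 0
    · rw [hx0, MulChar.map_zero, zero_mul]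
    · obtain ⟨l, hl, hlQ, y, hy⟩ := hcon x hx0 (Finset.mem_filter.1 hx).2
      have hlm : l ∈ Q.primeFactors := Nat.mem_primeFactors.2 ⟨hl, hlQ, by omega⟩
      rw [Finset.prod_eq_zero hlm, mul_zero]
      have hy0 : y ≠ 0 := by rintro rfl; rw [zero_pow hl.ne_zero] at hy; exact hx0 hy.symm
      have e1 : ∀ j ∈ Finset.Ico 1 l, (c l ^ j) x = 1 := by
        intro j _
        have e2 : (c l ^ j) ^ l = 1 := by
          rw [← pow_mul, mul_comm, pow_mul]
          conv_lhs => rw [← hc l hlm]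
          rw [hc l hlm]
          have : c l ^ l = 1 := by
            rw [← orderOf_dvd_iff_pow_eq_one, hc l hlm]
          rw [this, one_pow]
        rw [← hy, map_pow, ← MulChar.pow_apply' _ hl.ne_zero, e2]
        exact MulChar.one_apply (Ne.isUnit hy0)
      rw [Finset.sum_congr rfl e1]
      have : ((l : ℂ) - 1) ≠ 0 := by
        rw [sub_ne_zero]; exact_mod_cast hl.one_lt.ne'
      simp only [Finset.sum_const, Nat.card_Ico, nsmul_eq_mul, mul_one, Nat.cast_sub hl.one_lt.le,
        Nat.cast_one]
      rw [inv_mul_cancel₀ this, sub_self]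
  have harith := aux_arith q n hq2 hn hn2 hprim Q hQ
  set w := Q.primeFactors.card with hw
  rw [hzero, zero_sub, norm_neg] at hmain
  have hD : ‖(q : ℂ) ^ (n - 1) - 1‖ = (q : ℝ) ^ (n - 1) - 1 := by
    have h1 : 1 ≤ q ^ (n - 1) := Nat.one_le_pow _ _ (by omega)
    have : (q : ℂ) ^ (n - 1) - 1 = ((q ^ (n - 1) - 1 : ℕ) : ℂ) := by
      push_cast [Nat.cast_sub h1]; rfl
    rw [this, Complex.norm_natCast]; push_cast [Nat.cast_sub h1]; rfl
  rw [hD] at hmain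
  have hgR : (Q : ℝ) * (q - 1) + 1 = (q : ℝ) ^ n := by
    have : ((Q * (q - 1) + 1 : ℕ) : ℝ) = ((q ^ n : ℕ) : ℝ) := by rw [hgeom]
    push_cast [Nat.cast_sub (by omega : 1 ≤ q)] at this
    exact this
  have hAR : (2 ^ w - 1 : ℝ) ^ 2 * (q : ℝ) ^ n < ((Q : ℝ) - 1) ^ 2 := by
    have : (((2 ^ w - 1) ^ 2 * q ^ n : ℕ) : ℝ) < (((Q - 1) ^ 2 : ℕ) : ℝ) := by exact_mod_cast harith
    push_cast [Nat.cast_sub (Nat.one_le_two_pow : 1 ≤ 2 ^ w), Nat.cast_sub hQ1] at this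
    exact this
  have hqn : (q : ℝ) ^ n = q * q ^ (n - 1) := by
    rw [← pow_succ', Nat.sub_add_cancel (by omega)]
  have hW0 : (0 : ℝ) ≤ 2 ^ w - 1 := by
    have : (1 : ℝ) ≤ 2 ^ w := one_le_pow₀ (by norm_num)
    linarith
  have hq1 : (0 : ℝ) < (q : ℝ) - 1 := by
    have : (2 : ℝ) ≤ q := by exact_mod_cast hq2
    linarith
  have hs : (2 ^ w - 1 : ℝ) * Real.sqrt ((q : ℝ) ^ n) < (Q : ℝ) - 1 := by
    apply lt_of_pow_lt_pow_left₀ 2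
    · have : (1 : ℝ) ≤ Q := by exact_mod_cast hQ1
      linarith
    · rw [mul_pow, Real.sq_sqrt (by positivity)]
      exact hAR
  have hfin : (q : ℝ) * ((q : ℝ) ^ (n - 1) - 1) ≤
      (q - 1) * ((2 ^ w - 1 : ℝ) * Real.sqrt ((q : ℝ) ^ n)) := by
    calc _ ≤ (q : ℝ) * ((2 ^ w - 1) * B) := by gcongr
      _ = _ := by rw [hBdef]; field_simp
  have := mul_lt_mul_of_pos_left hs hq1
  nlinarith

lemma exists_coprime_lift (a Q N : ℕ) (hN : N ≠ 0) (hQN : Q ∣ N) (ha : a.Coprime Q) :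
    ∃ k : ℕ, (a + Q * k).Coprime N := by
  have : NeZero N := ⟨hN⟩
  obtain ⟨u, hu⟩ := ZMod.unitsMap_surjective hQN (ZMod.unitOfCoprime a ha)
  have h1 : (u : ZMod N).val.Coprime N := ZMod.val_coe_unit_coprime u
  have h2 : (((u : ZMod N).val : ℕ) : ZMod Q) = (a : ZMod Q) := by
    have := congrArg Units.val hu
    rw [ZMod.unitsMap_val, ZMod.coe_unitOfCoprime] at this
    rw [← this, ZMod.natCast_val]
  have h3 : ((u : ZMod N).val + N * a) ≡ a [MOD Q] := by
    have h4 := (ZMod.natCast_eq_natCast_iff _ _ _).1 h2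
    have h5 : N * a ≡ 0 [MOD Q] := (Nat.modEq_zero_iff_dvd).2 (hQN.mul_right _)
    simpa using h4.add h5
  have h6 : a ≤ (u : ZMod N).val + N * a := by
    have := Nat.le_mul_of_pos_left a (Nat.pos_of_ne_zero hN)
    omega
  obtain ⟨k, hk⟩ := (Nat.modEq_iff_dvd' h6).1 h3.symm
  refine ⟨k, ?_⟩
  rw [← hk, Nat.add_sub_cancel' h6]
  simpa using h1

/-- If `n > 2` is prime and `q` is a primitive root modulo `n`, there is a primitive
`1`-normal element of `F_{qⁿ}` over `F_q`. -/
theorem stmt_9 (q n : ℕ) (hq : IsPrimePow q) (hn : n.Prime) (hn2 : 2 < n)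
    (hprim : orderOf (q : ZMod n) = n - 1)
    (F K : Type) [Field F] [Fintype F] [Field K] [Fintype K] [Algebra F K]
    (hcF : Fintype.card F = q) (hrK : Module.finrank F K = n) :
    ∃ α : K, IsPrimitiveElt α ∧ IskNormal q n 1 F α := by
  have hq2 : 2 ≤ q := hcF ▸ Fintype.one_lt_card
  obtain ⟨Q, hQ⟩ : ∃ Q, Q = ∑ i ∈ Finset.range n, q ^ i := ⟨_, rfl⟩
  obtain ⟨α, hα0, htr, hpow⟩ := exists_nonpow q n hn hn2 hprim F K hcF hrK Q hQ
  have hcK : Fintype.card K = q ^ n := by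
    have : FiniteDimensional F K := Module.finite_of_finrank_pos (by rw [hrK]; exact hn.pos)
    rw [Module.card_eq_pow_finrank (K := F), hcF, hrK]
  have hnorm : ∀ x : K, algebraMap F K (Algebra.norm F x) = x ^ Q := by
    intro x
    rw [FiniteField.algebraMap_norm_eq_pow_sum, hrK, Nat.card_eq_fintype_card, hcF, hQ]
  have hQN : Q ∣ q ^ n - 1 := by
    clear hpow hnorm hcF hcK hprim
    obtain ⟨r, rfl⟩ : ∃ r, q = r + 1 := ⟨q - 1, by omega⟩
    have := geom_sum_mul_add r n
    rw [← this, hQ, Nat.add_sub_cancel]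
    exact Dvd.intro _ rfl
  have hN0 : q ^ n - 1 ≠ 0 := by
    have : 1 < q ^ n := Nat.one_lt_pow hn.ne_zero hq2
    omega
  obtain ⟨g, hg⟩ := IsCyclic.exists_generator (α := Kˣ)
  have hog : orderOf g = q ^ n - 1 := by
    rw [orderOf_eq_card_of_forall_mem_zpowers hg, Nat.card_units, Nat.card_eq_fintype_card, hcK]
  have hpows : ∀ x : K, x ≠ 0 → ∃ m : ℕ, (g : K) ^ m = x := by
    intro x hx
    obtain ⟨m, hm⟩ := mem_powers_iff_mem_zpowers.2 (hg (Units.mk0 x hx))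
    exact ⟨m, by simpa using congrArg Units.val hm⟩
  obtain ⟨a, ha⟩ := hpows α hα0
  have hcop : a.Coprime Q := by
    by_contra h
    obtain ⟨l, hl, h1, h2⟩ := Nat.Prime.not_coprime_iff_dvd.1 h
    obtain ⟨m, rfl⟩ := h1
    exact hpow l hl h2 ((g : K) ^ m) (by rw [← ha, ← pow_mul, mul_comm])
  obtain ⟨k, hk⟩ := exists_coprime_lift a Q _ hN0 hQN hcop
  have hβ : (g : K) ^ (a + Q * k) = Algebra.norm F ((g : K) ^ k) • α := by
    rw [Algebra.smul_def, hnorm, ← ha]; ring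
  refine ⟨(g : K) ^ (a + Q * k), ?_, ?_⟩
  · intro b hb
    obtain ⟨m, rfl⟩ := hpows b hb
    rw [← hog] at hk
    obtain ⟨s, hs⟩ := exists_pow_eq_self_of_coprime hk
    refine ⟨s * m, ?_⟩
    rw [pow_mul]
    congr 1
    simpa using congrArg Units.val hs
  · refine aux_normal q n hq hn hn2 hprim F K hcF hrK _ (pow_ne_zero _ g.ne_zero) ?_
    rw [hβ, map_smul, htr, smul_zero]

end
end

section
/- Let q be a prime power. (1) There exists a primitive 1-normal element of F_{q^3} over F_q. (2) If q ≡ 3 (mod 4), then there exists a primitive 1-normal element of F_{q^4} over F_q. (3) If q ≡ 2 or 3 (mod 5), then there exists a primitive 1-normal element of F_{q^5} over F_q. -/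
open Polynomial

noncomputable section

open Classical in
/-- nonzero trace-zero elements -/
def TZ (F K : Type) [Field F] [Field K] [Fintype K] [Algebra F K] : Finset K :=
  Finset.univ.filter (fun x : K => x ≠ 0 ∧ Algebra.trace F K x = 0)

lemma charsum_bound (F K : Type) [Field F] [Fintype F] [Field K] [Fintype K] [Algebra F K]
    (n : ℕ) (hn : Module.finrank F K = n + 2)
    (χ : MulChar K ℂ) (hχ : χ ≠ 1) (hF : ∀ c : F, c ≠ 0 → χ (algebraMap F K c) = 1) :
    ‖∑ x ∈ TZ F K, χ x‖ ≤ ((Fintype.card F : ℝ) - 1) * √((Fintype.card F : ℝ) ^ n) := by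
  classical
  set e := AddChar.FiniteField.primitiveChar_to_Complex F with he
  have hep : e.IsPrimitive := AddChar.FiniteField.primitiveChar_to_Complex_isPrimitive F
  set ψ : AddChar K ℂ := e.compAddMonoidHom (Algebra.trace F K).toAddMonoidHom with hψ
  have hψa : ∀ x, ψ x = e (Algebra.trace F K x) := fun x => rfl
  have hψ1 : ψ ≠ 1 := by
    intro h
    have h1 : e.mulShift 1 ≠ 1 := hep one_ne_zero
    apply h1
    ext y
    obtain ⟨x, hx⟩ := Algebra.trace_surjective F K y
    have := congrArg (fun f : AddChar K ℂ => f x) h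
    simp only [hψa, hx] at this
    simpa using this
  have hψp : ψ.IsPrimitive := AddChar.IsPrimitive.of_ne_one hψ1
  have hG : ‖gaussSum χ ψ‖ ^ 2 = (Fintype.card F : ℝ) ^ (n + 2) := by
    have h1 := gaussSum_mul_gaussSum_eq_card hχ hψp
    rw [← star_gaussSum_eq] at h1
    have h2 : gaussSum χ ψ * star (gaussSum χ ψ) = ((‖gaussSum χ ψ‖ ^ 2 : ℝ) : ℂ) := by
      have := Complex.mul_conj' (gaussSum χ ψ)
      push_cast
      exact this
    rw [h2, Module.card_eq_pow_finrank (K := F) (V := K), hn] at h1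
    exact_mod_cast h1
  have hsum : (Fintype.card F : ℂ) * ∑ x ∈ TZ F K, χ x
      = ((Fintype.card F : ℂ) - 1) * gaussSum χ ψ := by
    have h1 : (Fintype.card F : ℂ) * ∑ x ∈ TZ F K, χ x
        = ∑ x : K, ∑ c : F, χ x * e (c * Algebra.trace F K x) := by
      simp_rw [← Finset.mul_sum, AddChar.sum_mulShift _ hep]
      rw [TZ, Finset.sum_filter, Finset.mul_sum]
      apply Finset.sum_congr rfl
      intro x _
      by_cases h0 : x = 0
      · simp [h0, MulChar.map_zero]
      · by_cases ht : Algebra.trace F K x = 0 <;> simp [h0, ht, mul_comm]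
    rw [h1, Finset.sum_comm]
    have h2 : ∀ c : F, ∑ x : K, χ x * e (c * Algebra.trace F K x)
        = if c = 0 then 0 else gaussSum χ ψ := by
      intro c
      split_ifs with hc
      · simp [hc, MulChar.sum_eq_zero_of_ne_one hχ]
      · have hu : algebraMap F K c ≠ 0 := by simpa using hc
        have := gaussSum_mulShift χ ψ (Units.mk0 _ hu)
        rw [Units.val_mk0, hF c hc, one_mul] at this
        rw [← this, gaussSum]
        apply Finset.sum_congr rfl
        intro x _
        rw [AddChar.mulShift_apply, hψa, ← Algebra.smul_def, map_smul, smul_eq_mul]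
    simp_rw [h2]
    have h3 : ∀ c : F, (if c = 0 then 0 else gaussSum χ ψ)
        = gaussSum χ ψ - if c = 0 then gaussSum χ ψ else 0 := by
      intro c; split_ifs <;> simp
    simp_rw [h3, Finset.sum_sub_distrib]
    simp [sub_mul]
  have hq : (1 : ℝ) ≤ Fintype.card F := by exact_mod_cast Fintype.card_pos
  set Q : ℝ := (Fintype.card F : ℝ) with hQ
  have h3 : Q * ‖∑ x ∈ TZ F K, χ x‖ = (Q - 1) * ‖gaussSum χ ψ‖ := by
    have := congrArg norm hsum
    rw [norm_mul, norm_mul] at this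
    have h4 : ‖(Fintype.card F : ℂ)‖ = Q := by simp [hQ]
    have h5 : ‖(Fintype.card F : ℂ) - 1‖ = Q - 1 := by
      have : (Fintype.card F : ℂ) - 1 = ((Q - 1 : ℝ) : ℂ) := by simp [hQ]
      rw [this, Complex.norm_real, Real.norm_of_nonneg (by linarith)]
    rw [h4, h5] at this
    exact this
  have h6 : ‖gaussSum χ ψ‖ = Q * √(Q ^ n) := by
    rw [← Real.sqrt_sq (norm_nonneg (gaussSum χ ψ)), hG, pow_add, mul_comm,
      Real.sqrt_mul (by positivity), Real.sqrt_sq (by linarith)]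
  rw [h6] at h3
  have : Q * ‖∑ x ∈ TZ F K, χ x‖ = Q * ((Q - 1) * √(Q ^ n)) := by rw [h3]; ring
  exact (mul_left_cancel₀ (by linarith) this).le

lemma TZ_card (F K : Type) [Field F] [Fintype F] [Field K] [Fintype K] [Algebra F K]
    (n : ℕ) (hn : Module.finrank F K = n + 2) :
    ((TZ F K).card : ℝ) = (Fintype.card F : ℝ) ^ (n + 1) - 1 := by
  classical
  have h1 : Module.finrank F (LinearMap.ker (Algebra.trace F K)) = n + 1 := by
    have h2 := LinearMap.finrank_range_add_finrank_ker (Algebra.trace F K)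
    rw [LinearMap.range_eq_top.mpr (Algebra.trace_surjective F K), finrank_top, hn,
      Module.finrank_self] at h2
    omega
  have h2 : Fintype.card (LinearMap.ker (Algebra.trace F K)) = Fintype.card F ^ (n + 1) := by
    rw [Module.card_eq_pow_finrank (K := F), h1]
  have h3 : (TZ F K).card + 1 = Fintype.card F ^ (n + 1) := by
    rw [← h2, Fintype.card_subtype]
    have : (Finset.univ.filter fun x : K => x ∈ LinearMap.ker (Algebra.trace F K))
        = insert 0 (TZ F K) := by
      ext x
      by_cases h0 : x = 0 <;> simp [TZ, h0]
    rw [this, Finset.card_insert_of_notMem (by simp [TZ])]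
  rw [eq_sub_iff_add_eq]
  exact_mod_cast h3

/-- indicator (for `x ≠ 0`) of `χ x ≠ 1`, where `χ` has order `l` -/
def goodInd {K : Type} [Field K] (c : ℕ → MulChar K ℂ) (l : ℕ) (x : K) : ℂ :=
  1 - (1 / (l : ℂ)) * ∑ a ∈ Finset.range l, ((c l) ^ a) x

lemma goodInd_eq {K : Type} [Field K] (c : ℕ → MulChar K ℂ) (l : ℕ) (hl : l.Prime)
    (ho : orderOf (c l) = l) (x : K) (hx : x ≠ 0) [Decidable (c l x = 1)] :
    goodInd c l x = if c l x = 1 then 0 else 1 := by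
  have hl0 : (l : ℂ) ≠ 0 := by exact_mod_cast hl.ne_zero
  have hp : ∀ a : ℕ, ((c l) ^ a) x = (c l x) ^ a := by
    intro a
    have := MulChar.pow_apply_coe (c l) a (Units.mk0 x hx)
    simpa using this
  unfold goodInd
  simp_rw [hp]
  split_ifs with h
  · simp [h, hl0]
  · have h1 : (c l x) ^ l = 1 := by
      have h9 : (c l) ^ l = 1 := by
        rw [← orderOf_dvd_iff_pow_eq_one, ho]
      rw [← hp, h9]
      exact MulChar.one_apply (isUnit_iff_ne_zero.mpr hx)
    have h2 := geom_sum_mul (c l x) l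
    rw [h1, sub_self] at h2
    have h3 := (mul_eq_zero.mp h2).resolve_right (sub_ne_zero.mpr h)
    simp [h3]

lemma goodInd_expand {K : Type} [Field K] (c : ℕ → MulChar K ℂ) (T : Finset K)
    (h0 : ∀ x ∈ T, x ≠ 0) (l : ℕ) (hl : l.Prime) (f : K → ℂ) (M : ℝ)
    (hM : ∀ a ∈ Finset.Ico 1 l, ‖∑ x ∈ T, f x * ((c l) ^ a) x‖ ≤ M) :
    ‖∑ x ∈ T, f x * goodInd c l x - ((1 - 1 / (l : ℝ) : ℝ) : ℂ) * ∑ x ∈ T, f x‖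
      ≤ (1 - 1 / (l : ℝ)) * M := by
  have hl0 : (0 : ℝ) < l := by exact_mod_cast hl.pos
  have hl1 : (1 : ℝ) ≤ l := by exact_mod_cast hl.one_le
  have key : ∑ x ∈ T, f x * goodInd c l x - ((1 - 1 / (l : ℝ) : ℝ) : ℂ) * ∑ x ∈ T, f x
      = -((1 / (l : ℝ) : ℝ) : ℂ) * ∑ a ∈ Finset.Ico 1 l, ∑ x ∈ T, f x * ((c l) ^ a) x := by
    rw [Finset.sum_comm, Finset.mul_sum, Finset.mul_sum, ← Finset.sum_sub_distrib]
    apply Finset.sum_congr rfl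
    intro x hx
    unfold goodInd
    have h1 : ((c l) ^ 0) x = 1 := by
      rw [pow_zero]
      exact MulChar.one_apply (isUnit_iff_ne_zero.mpr (h0 x hx))
    rw [Finset.range_eq_Ico, Finset.sum_eq_sum_Ico_succ_bot hl.pos, h1, ← Finset.mul_sum]
    push_cast
    ring
  rw [key, norm_mul, norm_neg, Complex.norm_real, Real.norm_of_nonneg (by positivity)]
  have h2 : ‖∑ a ∈ Finset.Ico 1 l, ∑ x ∈ T, f x * ((c l) ^ a) x‖ ≤ ((l : ℝ) - 1) * M := by
    refine (norm_sum_le_of_le _ hM).trans ?_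
    rw [Finset.sum_const, Nat.card_Ico, nsmul_eq_mul, Nat.cast_sub hl.one_le]
    simp
  calc 1 / (l : ℝ) * ‖∑ a ∈ Finset.Ico 1 l, ∑ x ∈ T, f x * ((c l) ^ a) x‖
      ≤ 1 / (l : ℝ) * (((l : ℝ) - 1) * M) := by gcongr
    _ = (1 - 1 / (l : ℝ)) * M := by field_simp

lemma order_pow_aux {G : Type*} [Group G] (x : G) (l a : ℕ) (hl : l.Prime) (ho : orderOf x = l)
    (ha : a ∈ Finset.Ico 1 l) : orderOf (x ^ a) = l := by
  rw [Finset.mem_Ico] at ha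
  rw [orderOf_pow' x (by omega), ho]
  have : Nat.Coprime l a :=
    (Nat.Prime.coprime_iff_not_dvd hl).mpr (fun h => by have := Nat.le_of_dvd ha.1 h; omega)
  rw [Nat.Coprime.gcd_eq_one this, Nat.div_one]

lemma theta_nonneg (A : Finset ℕ) (hA : ∀ l ∈ A, l.Prime) :
    0 < ∏ l ∈ A, (1 - 1 / (l : ℝ)) := by
  apply Finset.prod_pos
  intro l hl
  have : (1 : ℝ) < l := by exact_mod_cast (hA l hl).one_lt
  have h2 : 1 / (l : ℝ) < 1 := by rw [div_lt_one (by linarith)]; exact this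
  linarith

lemma sieve_psi {K : Type} [Field K] (c : ℕ → MulChar K ℂ) (T : Finset K)
    (h0 : ∀ x ∈ T, x ≠ 0) (Q : ℕ) (E : ℝ)
    (hE : ∀ χ : MulChar K ℂ, χ ≠ 1 → χ ^ Q = 1 → ‖∑ x ∈ T, χ x‖ ≤ E)
    (A : Finset ℕ) (hA : ∀ l ∈ A, l.Prime ∧ l ∣ Q ∧ orderOf (c l) = l) :
    ∀ ψ : MulChar K ℂ, ψ ≠ 1 → ψ ^ Q = 1 → (∀ l ∈ A, (orderOf ψ).Coprime l) →
    ‖∑ x ∈ T, ψ x * ∏ l ∈ A, goodInd c l x‖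
      ≤ (∏ l ∈ A, (1 - 1 / (l : ℝ))) * 2 ^ A.card * E := by
  induction A using Finset.induction_on with
  | empty => intro ψ h1 h2 _; simpa using hE ψ h1 h2
  | insert l A hlA ih =>
    intro ψ h1 h2 h3
    obtain ⟨hlp, hlQ, hlo⟩ := hA l (Finset.mem_insert_self _ _)
    have hA' : ∀ m ∈ A, m.Prime ∧ m ∣ Q ∧ orderOf (c m) = m :=
      fun m hm => hA m (Finset.mem_insert_of_mem hm)
    have ih' := ih hA'
    set M := (∏ l ∈ A, (1 - 1 / (l : ℝ))) * 2 ^ A.card * E with hM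
    have hb := goodInd_expand c T h0 l hlp (fun x => ψ x * ∏ m ∈ A, goodInd c m x) M ?_
    · have h4 := ih' ψ h1 h2 (fun m hm => h3 m (Finset.mem_insert_of_mem hm))
      rw [Finset.prod_insert hlA, Finset.card_insert_of_notMem hlA]
      have e1 : ∑ x ∈ T, ψ x * ∏ m ∈ insert l A, goodInd c m x
          = ∑ x ∈ T, (ψ x * ∏ m ∈ A, goodInd c m x) * goodInd c l x := by
        apply Finset.sum_congr rfl
        intro x _
        rw [Finset.prod_insert hlA]; ring
      rw [e1]
      have hl1 : 0 ≤ 1 - 1 / (l : ℝ) := by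
        have := theta_nonneg {l} (by simpa using hlp)
        simpa using this.le
      have h5 : ‖((1 - 1 / (l : ℝ) : ℝ) : ℂ) * ∑ x ∈ T, ψ x * ∏ m ∈ A, goodInd c m x‖
          ≤ (1 - 1 / (l : ℝ)) * M := by
        rw [norm_mul, Complex.norm_real, Real.norm_of_nonneg hl1]
        gcongr
      have h6 := norm_le_norm_sub_add
        (∑ x ∈ T, (ψ x * ∏ m ∈ A, goodInd c m x) * goodInd c l x)
        (((1 - 1 / (l : ℝ) : ℝ) : ℂ) * ∑ x ∈ T, ψ x * ∏ m ∈ A, goodInd c m x)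
      calc _ ≤ _ := h6
        _ ≤ (1 - 1 / (l : ℝ)) * M + (1 - 1 / (l : ℝ)) * M := add_le_add hb h5
        _ = _ := by rw [hM]; ring
    · intro a ha
      have ho := order_pow_aux (c l) l a hlp hlo ha
      have hcop : (orderOf ψ).Coprime (orderOf ((c l) ^ a)) := by
        rw [ho]; exact h3 l (Finset.mem_insert_self _ _)
      have hord : orderOf (ψ * (c l) ^ a) = orderOf ψ * l := by
        rw [(Commute.all ψ ((c l) ^ a)).orderOf_mul_eq_mul_orderOf_of_coprime hcop, ho]
      have h7 := ih' (ψ * (c l) ^ a) ?_ ?_ ?_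
      · refine le_trans (le_of_eq ?_) h7
        congr 1
        apply Finset.sum_congr rfl
        intro x _
        rw [MulChar.mul_apply]; ring
      · intro h
        rw [h, orderOf_one] at hord
        exact hlp.one_lt.ne' (Nat.eq_one_of_mul_eq_one_left hord.symm)
      · rw [mul_pow, h2, one_mul, ← orderOf_dvd_iff_pow_eq_one, ho]
        exact hlQ
      · intro m hm
        rw [hord]
        refine Nat.Coprime.mul_left (h3 m (Finset.mem_insert_of_mem hm)) ?_
        rw [Nat.coprime_primes hlp (hA' m hm).1]
        rintro rfl
        exact hlA hm

lemma sieve_one {K : Type} [Field K] (c : ℕ → MulChar K ℂ) (T : Finset K)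
    (h0 : ∀ x ∈ T, x ≠ 0) (Q : ℕ) (E : ℝ)
    (hE : ∀ χ : MulChar K ℂ, χ ≠ 1 → χ ^ Q = 1 → ‖∑ x ∈ T, χ x‖ ≤ E)
    (A : Finset ℕ) (hA : ∀ l ∈ A, l.Prime ∧ l ∣ Q ∧ orderOf (c l) = l)
    (l : ℕ) (hl : l.Prime ∧ l ∣ Q ∧ orderOf (c l) = l) (hlA : l ∉ A) :
    ‖∑ x ∈ T, (∏ m ∈ A, goodInd c m x) * goodInd c l x
        - ((1 - 1 / (l : ℝ) : ℝ) : ℂ) * ∑ x ∈ T, ∏ m ∈ A, goodInd c m x‖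
      ≤ (1 - 1 / (l : ℝ)) * ((∏ l ∈ A, (1 - 1 / (l : ℝ))) * 2 ^ A.card * E) := by
  apply goodInd_expand c T h0 l hl.1
  intro a ha
  have ho := order_pow_aux (c l) l a hl.1 hl.2.2 ha
  have h7 := sieve_psi c T h0 Q E hE A hA ((c l) ^ a) ?_ ?_ ?_
  · refine le_trans (le_of_eq ?_) h7
    congr 1
    apply Finset.sum_congr rfl
    intro x _
    ring
  · intro h
    rw [h, orderOf_one] at ho
    exact hl.1.one_lt.ne ho
  · rw [← orderOf_dvd_iff_pow_eq_one, ho]; exact hl.2.1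
  · intro m hm
    rw [ho, Nat.coprime_primes hl.1 (hA m hm).1]
    rintro rfl
    exact hlA hm

open Classical in
lemma sum_goodInd {K : Type} [Field K] (c : ℕ → MulChar K ℂ) (T : Finset K)
    (h0 : ∀ x ∈ T, x ≠ 0) (A : Finset ℕ) (hA : ∀ l ∈ A, l.Prime ∧ orderOf (c l) = l) :
    ∑ x ∈ T, ∏ m ∈ A, goodInd c m x
      = (((T.filter fun x => ∀ l ∈ A, c l x ≠ 1).card : ℝ) : ℂ) := by
  rw [Finset.card_filter]
  push_cast
  apply Finset.sum_congr rfl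
  intro x hx
  have : ∏ m ∈ A, goodInd c m x = ∏ m ∈ A, if c m x ≠ 1 then (1 : ℂ) else 0 := by
    apply Finset.prod_congr rfl
    intro m hm
    rw [goodInd_eq c m (hA m hm).1 (hA m hm).2 x (h0 x hx)]
    split_ifs <;> simp_all
  rw [this, Finset.prod_ite_zero]
  split_ifs <;> simp

open Classical in
lemma sieve_step {K : Type} [Field K] (c : ℕ → MulChar K ℂ) (T : Finset K)
    (h0 : ∀ x ∈ T, x ≠ 0) (Q : ℕ) (E : ℝ)
    (hE : ∀ χ : MulChar K ℂ, χ ≠ 1 → χ ^ Q = 1 → ‖∑ x ∈ T, χ x‖ ≤ E)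
    (A : Finset ℕ) (hA : ∀ l ∈ A, l.Prime ∧ l ∣ Q ∧ orderOf (c l) = l)
    (l : ℕ) (hl : l.Prime ∧ l ∣ Q ∧ orderOf (c l) = l) (hlA : l ∉ A) :
    |((T.filter fun x => ∀ m ∈ insert l A, c m x ≠ 1).card : ℝ)
      - (1 - 1 / (l : ℝ)) * ((T.filter fun x => ∀ m ∈ A, c m x ≠ 1).card : ℝ)|
      ≤ (1 - 1 / (l : ℝ)) * ((∏ l ∈ A, (1 - 1 / (l : ℝ))) * 2 ^ A.card * E) := by
  have h1 := sieve_one c T h0 Q E hE A hA l hl hlA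
  have h2 := sum_goodInd c T h0 A (fun m hm => ⟨(hA m hm).1, (hA m hm).2.2⟩)
  have h3 := sum_goodInd c T h0 (insert l A) (by
    intro m hm
    rcases Finset.mem_insert.mp hm with rfl | hm
    · exact ⟨hl.1, hl.2.2⟩
    · exact ⟨(hA m hm).1, (hA m hm).2.2⟩)
  have h4 : ∑ x ∈ T, (∏ m ∈ A, goodInd c m x) * goodInd c l x
      = ∑ x ∈ T, ∏ m ∈ insert l A, goodInd c m x := by
    apply Finset.sum_congr rfl
    intro x _
    rw [Finset.prod_insert hlA]; ring
  rw [h4, h2, h3, ← Complex.ofReal_mul, ← Complex.ofReal_sub, Complex.norm_real,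
    Real.norm_eq_abs] at h1
  exact h1

open Classical in
lemma sieve_A {K : Type} [Field K] (c : ℕ → MulChar K ℂ) (T : Finset K)
    (h0 : ∀ x ∈ T, x ≠ 0) (Q : ℕ) (E : ℝ)
    (hE : ∀ χ : MulChar K ℂ, χ ≠ 1 → χ ^ Q = 1 → ‖∑ x ∈ T, χ x‖ ≤ E)
    (A : Finset ℕ) (hA : ∀ l ∈ A, l.Prime ∧ l ∣ Q ∧ orderOf (c l) = l) :
    (∏ l ∈ A, (1 - 1 / (l : ℝ))) * ((T.card : ℝ) - (2 ^ A.card - 1) * E)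
      ≤ ((T.filter fun x => ∀ m ∈ A, c m x ≠ 1).card : ℝ) := by
  induction A using Finset.induction_on with
  | empty => simp
  | insert l A hlA ih =>
    have hl := hA l (Finset.mem_insert_self _ _)
    have hA' : ∀ m ∈ A, m.Prime ∧ m ∣ Q ∧ orderOf (c m) = m :=
      fun m hm => hA m (Finset.mem_insert_of_mem hm)
    have ih' := ih hA'
    have h1 := (abs_le.mp (sieve_step c T h0 Q E hE A hA' l hl hlA)).1
    have hl1 : 0 ≤ 1 - 1 / (l : ℝ) := by
      have := theta_nonneg {l} (by simpa using hl.1)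
      simpa using this.le
    rw [Finset.prod_insert hlA, Finset.card_insert_of_notMem hlA]
    have h2 := mul_le_mul_of_nonneg_left ih' hl1
    rw [pow_succ]
    linarith

lemma sieve_main {K : Type} [Field K] (c : ℕ → MulChar K ℂ) (T : Finset K)
    (h0 : ∀ x ∈ T, x ≠ 0) (Q : ℕ) (E : ℝ)
    (hE : ∀ χ : MulChar K ℂ, χ ≠ 1 → χ ^ Q = 1 → ‖∑ x ∈ T, χ x‖ ≤ E)
    (A B : Finset ℕ) (hAB : Disjoint A B)
    (hA : ∀ l ∈ A, l.Prime ∧ l ∣ Q ∧ orderOf (c l) = l)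
    (hB : ∀ l ∈ B, l.Prime ∧ l ∣ Q ∧ orderOf (c l) = l)
    (hS : ∑ l ∈ B, 1 / (l : ℝ) ≤ 1)
    (hmain : 2 ^ A.card * E * ((B.card : ℝ) - ∑ l ∈ B, 1 / (l : ℝ))
      < (1 - ∑ l ∈ B, 1 / (l : ℝ)) * ((T.card : ℝ) - (2 ^ A.card - 1) * E)) :
    ∃ x ∈ T, ∀ l ∈ A ∪ B, c l x ≠ 1 := by
  classical
  by_contra hcon
  push Not at hcon
  set S := ∑ l ∈ B, 1 / (l : ℝ) with hSdef
  set θ := ∏ l ∈ A, (1 - 1 / (l : ℝ)) with hθ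
  have hθpos : 0 < θ := theta_nonneg A (fun l hl => (hA l hl).1)
  have hNA := sieve_A c T h0 Q E hE A hA
  set TA := T.filter fun x => ∀ m ∈ A, c m x ≠ 1 with hTA
  have hbad : ∀ l ∈ B, ((TA.filter fun x => c l x = 1).card : ℝ)
      ≤ (1 / (l : ℝ)) * TA.card + (1 - 1 / (l : ℝ)) * (θ * 2 ^ A.card * E) := by
    intro l hl
    have hlA : l ∉ A := fun h => (Finset.disjoint_left.mp hAB h) hl
    have h1 := (abs_le.mp (sieve_step c T h0 Q E hE A hA l (hB l hl) hlA)).1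
    have h2 : (T.filter fun x => ∀ m ∈ insert l A, c m x ≠ 1)
        = TA.filter fun x => ¬ (c l x = 1) := by
      ext x
      simp only [hTA, Finset.mem_filter, Finset.forall_mem_insert]
      tauto
    rw [h2] at h1
    have h3 := Finset.card_filter_add_card_filter_not (s := TA) (fun x => c l x = 1)
    have h4 : ((TA.filter fun x => c l x = 1).card : ℝ)
      + ((TA.filter fun x => ¬ (c l x = 1)).card : ℝ) = TA.card := by exact_mod_cast h3
    linarith
  have hcov : TA ⊆ B.biUnion fun l => TA.filter fun x => c l x = 1 := by
    intro x hx
    obtain ⟨l, hl, hlx⟩ := hcon x (Finset.mem_filter.mp hx).1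
    rcases Finset.mem_union.mp hl with h | h
    · exact absurd hlx ((Finset.mem_filter.mp hx).2 l h)
    · exact Finset.mem_biUnion.mpr ⟨l, h, Finset.mem_filter.mpr ⟨hx, hlx⟩⟩
  have h5 : (TA.card : ℝ) ≤ ∑ l ∈ B, ((TA.filter fun x => c l x = 1).card : ℝ) := by
    exact_mod_cast (Finset.card_le_card hcov).trans Finset.card_biUnion_le
  have h6 : (TA.card : ℝ) ≤ S * TA.card + ((B.card : ℝ) - S) * (θ * 2 ^ A.card * E) := by
    refine h5.trans ((Finset.sum_le_sum hbad).trans (le_of_eq ?_))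
    rw [Finset.sum_add_distrib, ← Finset.sum_mul, ← Finset.sum_mul, Finset.sum_sub_distrib]
    simp [hSdef]
  have h7 := mul_le_mul_of_nonneg_left hNA (sub_nonneg.mpr hS)
  have h8 := mul_lt_mul_of_pos_left hmain hθpos
  linarith

lemma exists_primElt (K : Type) [Field K] [Fintype K] : ∃ g : K, g ≠ 0 ∧ IsPrimitiveElt g := by
  obtain ⟨g, hg⟩ := IsCyclic.exists_monoid_generator (α := Kˣ)
  refine ⟨g, g.ne_zero, fun b hb => ?_⟩
  obtain ⟨m, hm⟩ := Submonoid.mem_powers_iff _ _ |>.mp (hg (Units.mk0 b hb))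
  refine ⟨m, ?_⟩
  have := congrArg Units.val hm
  simpa using this

lemma card_sub_one (F K : Type) [Field F] [Fintype F] [Field K] [Fintype K] [Algebra F K]
    (n : ℕ) (hn : Module.finrank F K = n) :
    Fintype.card K - 1
      = (Fintype.card F - 1) * ∑ i ∈ Finset.range n, Fintype.card F ^ i := by
  rw [Module.card_eq_pow_finrank (K := F) (V := K), hn]
  have h := Nat.geomSum_eq (m := Fintype.card F) Fintype.one_lt_card n
  have h1 : 1 ≤ Fintype.card F := Fintype.card_pos
  have h2 := Commute.geom_sum₂_mul (Commute.all ((Fintype.card F : ℕ) : ℤ) 1) n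
  simp only [one_pow, mul_one] at h2
  zify [h1, Nat.one_le_pow n _ h1]
  linarith

lemma field_sieve (F K : Type) [Field F] [Fintype F] [Field K] [Fintype K] [Algebra F K]
    (n : ℕ) (hn : Module.finrank F K = n + 2) (g : K) (hg0 : g ≠ 0) (hg : IsPrimitiveElt g)
    (q Q : ℕ) (hq : Fintype.card F = q) (hQ : Q = ∑ i ∈ Finset.range (n + 2), q ^ i)
    (A B : Finset ℕ) (hAB : Disjoint A B)
    (hA : ∀ l ∈ A, l.Prime ∧ l ∣ Q) (hB : ∀ l ∈ B, l.Prime ∧ l ∣ Q)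
    (hS : ∑ l ∈ B, 1 / (l : ℝ) ≤ 1)
    (hmain : 2 ^ A.card * √((q : ℝ) ^ n) * ((B.card : ℝ) - ∑ l ∈ B, 1 / (l : ℝ))
      < (1 - ∑ l ∈ B, 1 / (l : ℝ)) *
        (∑ i ∈ Finset.range (n + 1), (q : ℝ) ^ i - (2 ^ A.card - 1) * √((q : ℝ) ^ n))) :
    ∃ k : ℕ, Algebra.trace F K (g ^ k) = 0 ∧ ∀ l ∈ A ∪ B, ¬ l ∣ k := by
  have hNQ := card_sub_one F K _ hn
  rw [hq, ← hQ] at hNQ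
  have hex : ∀ l : ℕ, ∃ χ : MulChar K ℂ, l ≠ 0 → l ∣ Q → orderOf χ = l := by
    intro l
    by_cases h : l ≠ 0 ∧ l ∣ Q
    · obtain ⟨χ, hχ⟩ := MulChar.exists_mulChar_orderOf K (n := l)
        (by rw [hNQ]; exact h.2.mul_left _) (Complex.isPrimitiveRoot_exp l h.1)
      exact ⟨χ, fun _ _ => hχ⟩
    · exact ⟨1, fun h1 h2 => absurd ⟨h1, h2⟩ h⟩
  choose c hc using hex
  have hq1 : (1 : ℝ) < q := by rw [← hq]; exact_mod_cast Fintype.one_lt_card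
  have hE : ∀ χ : MulChar K ℂ, χ ≠ 1 → χ ^ Q = 1 →
      ‖∑ x ∈ TZ F K, χ x‖ ≤ ((q : ℝ) - 1) * √((q : ℝ) ^ n) := by
    intro χ h1 h2
    have := charsum_bound F K n hn χ h1 ?_
    · rwa [hq] at this
    · intro d hd
      obtain ⟨y, hy⟩ := FiniteField.norm_surjective F K d
      have hy0 : y ≠ 0 := by rintro rfl; exact hd (by rw [← hy, Algebra.norm_zero])
      have h3 := FiniteField.algebraMap_norm_eq_pow_sum F K y
      rw [hy, hn, Nat.card_eq_fintype_card, hq, ← hQ] at h3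
      rw [h3, map_pow]
      have h4 := MulChar.pow_apply_coe χ Q (Units.mk0 y hy0)
      rw [Units.val_mk0, h2] at h4
      rw [← h4]
      exact MulChar.one_apply (isUnit_iff_ne_zero.mpr hy0)
  have hcard := TZ_card F K n hn
  rw [hq] at hcard
  have hgeom : ((q : ℝ) - 1) * ∑ i ∈ Finset.range (n + 1), (q : ℝ) ^ i = (q : ℝ) ^ (n + 1) - 1 := by
    rw [mul_comm, geom_sum_mul]
  obtain ⟨x, hxT, hx⟩ := sieve_main c (TZ F K)
    (fun x hx => by simp only [TZ, Finset.mem_filter] at hx; exact hx.2.1) Q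
    (((q : ℝ) - 1) * √((q : ℝ) ^ n)) hE A B hAB
    (fun l hl => ⟨(hA l hl).1, (hA l hl).2, hc l (hA l hl).1.ne_zero (hA l hl).2⟩)
    (fun l hl => ⟨(hB l hl).1, (hB l hl).2, hc l (hB l hl).1.ne_zero (hB l hl).2⟩) hS (by
      rw [hcard, ← hgeom]
      have := mul_lt_mul_of_pos_left hmain (sub_pos.mpr hq1)
      linarith)
  simp only [TZ, Finset.mem_filter, Finset.mem_univ, true_and] at hxT
  obtain ⟨k, hk⟩ := hg x hxT.1
  refine ⟨k, by rw [hk]; exact hxT.2, fun l hl hlk => hx l hl ?_⟩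
  obtain ⟨j, rfl⟩ := hlk
  have hl' : l.Prime ∧ l ∣ Q := (Finset.mem_union.mp hl).elim (hA l) (hB l)
  have ho := hc l hl'.1.ne_zero hl'.2
  have h9 : (c l) ^ l = 1 := by rw [← orderOf_dvd_iff_pow_eq_one, ho]
  rw [← hk, mul_comm, pow_mul, map_pow]
  have h4 := MulChar.pow_apply_coe (c l) l (Units.mk0 (g ^ j) (pow_ne_zero _ hg0))
  rw [Units.val_mk0, h9] at h4
  rw [← h4]
  exact MulChar.one_apply (isUnit_iff_ne_zero.mpr (pow_ne_zero _ hg0))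

lemma lift_primitive (F K : Type) [Field F] [Fintype F] [Field K] [Fintype K] [Algebra F K]
    (n : ℕ) (hn : Module.finrank F K = n) (g : K) (hg0 : g ≠ 0) (hg : IsPrimitiveElt g)
    (q Q : ℕ) (hq : Fintype.card F = q) (hQ : Q = ∑ i ∈ Finset.range n, q ^ i)
    (k : ℕ) (hk : k.Coprime Q) :
    ∃ c : F, c ≠ 0 ∧ IsPrimitiveElt (c • g ^ k) := by
  have hNQ := card_sub_one F K _ hn
  rw [hq, ← hQ] at hNQ
  set N := Fintype.card K - 1 with hN
  have hN0 : N ≠ 0 := by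
    have := Fintype.one_lt_card (α := K)
    omega
  haveI : NeZero N := ⟨hN0⟩
  have hdvd : Q ∣ N := ⟨_, by rw [hNQ, mul_comm]⟩
  have hgN : g ^ N = 1 := FiniteField.pow_card_sub_one_eq_one g hg0
  obtain ⟨u, hu⟩ := ZMod.unitsMap_surjective hdvd (ZMod.unitOfCoprime k hk)
  set v := (u : ZMod N).val with hv
  have hvu : (v : ZMod N) = u := ZMod.natCast_zmod_val _
  have hvk : (v : ZMod Q) = (k : ZMod Q) := by
    have h1 := congrArg Units.val hu
    rw [ZMod.unitsMap_def, Units.coe_map, ZMod.coe_unitOfCoprime] at h1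
    rw [← h1, ← hvu]
    simp
  have hvk' : ((v + N * k : ℕ) : ZMod Q) = (k : ZMod Q) := by
    obtain ⟨d, hd⟩ := hdvd
    push_cast
    rw [hvk, hd]; simp
  have hle : k ≤ v + N * k := by nlinarith [Nat.pos_of_ne_zero hN0]
  have hd : Q ∣ v + N * k - k :=
    (Nat.modEq_iff_dvd' hle).mp ((ZMod.natCast_eq_natCast_iff _ _ _).mp hvk'.symm)
  obtain ⟨j, hj⟩ := hd
  have h3 := FiniteField.algebraMap_norm_eq_pow_sum F K (g ^ j)
  rw [hn, Nat.card_eq_fintype_card, hq, ← hQ] at h3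
  have hval : Algebra.norm F (g ^ j) • g ^ k = g ^ v := by
    rw [Algebra.smul_def, h3, ← pow_mul, ← pow_add, mul_comm j Q, ← hj, Nat.sub_add_cancel hle,
      pow_add, pow_mul, hgN, one_pow, mul_one]
  refine ⟨Algebra.norm F (g ^ j), Algebra.norm_ne_zero_iff.mpr (pow_ne_zero _ hg0), ?_⟩
  rw [hval]
  intro b hb
  obtain ⟨m, hm⟩ := hg b hb
  refine ⟨((m : ZMod N) * ((u⁻¹ : (ZMod N)ˣ) : ZMod N)).val, ?_⟩
  rw [← hm, ← pow_mul]
  apply pow_eq_pow_of_modEq _ hgN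
  rw [← ZMod.natCast_eq_natCast_iff]
  push_cast
  rw [hvu, ZMod.natCast_zmod_val]
  rw [mul_comm, mul_assoc, Units.inv_mul, mul_one]

lemma prim_pow {K : Type} [Field K] [Fintype K] (x : K) (hx : IsPrimitiveElt x) (m : ℕ)
    (hm : 0 < m) (h1 : x ^ m = 1) : Fintype.card K - 1 ≤ m := by
  classical
  have hx0 : x ≠ 0 := by
    rintro rfl
    rw [zero_pow hm.ne'] at h1
    exact zero_ne_one h1
  have : (Finset.univ.erase (0 : K)) ⊆ (Finset.range m).image (fun i => x ^ i) := by
    intro b hb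
    obtain ⟨i, hi⟩ := hx b (Finset.ne_of_mem_erase hb)
    rw [Finset.mem_image]
    refine ⟨i % m, Finset.mem_range.mpr (Nat.mod_lt _ hm), ?_⟩
    rw [← hi]
    exact pow_eq_pow_of_modEq (Nat.mod_modEq i m) h1
  have h2 := (Finset.card_le_card this).trans Finset.card_image_le
  rwa [Finset.card_erase_of_mem (Finset.mem_univ _), Finset.card_univ, Finset.card_range] at h2

lemma not_eig (F K : Type) [Field F] [Fintype F] [Field K] [Fintype K] [Algebra F K]
    (n : ℕ) (hn : Module.finrank F K = n + 2) (q : ℕ) (hq : Fintype.card F = q)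
    (x : K) (hx0 : x ≠ 0) (hx : IsPrimitiveElt x) (c : F) : x ^ q ≠ c • x := by
  intro h
  have hq1 : 1 < q := by rw [← hq]; exact Fintype.one_lt_card
  have hc0 : c ≠ 0 := by
    rintro rfl
    rw [zero_smul] at h
    exact pow_ne_zero _ hx0 h
  have h1 : x ^ (q - 1) = algebraMap F K c := by
    apply mul_right_cancel₀ hx0
    rw [← pow_succ, Nat.sub_add_cancel hq1.le, h, Algebra.smul_def]
  have h2 : x ^ ((q - 1) * (q - 1)) = 1 := by
    rw [pow_mul, h1, ← map_pow, ← hq, FiniteField.pow_card_sub_one_eq_one c hc0, map_one]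
  have h3 := prim_pow x hx _ (Nat.mul_pos (by omega) (by omega)) h2
  rw [Module.card_eq_pow_finrank (K := F) (V := K), hn, hq] at h3
  have h4 : q ^ 2 ≤ q ^ (n + 2) := Nat.pow_le_pow_right (by omega) (by omega)
  obtain ⟨r, rfl⟩ : ∃ r, q = r + 2 := ⟨q - 2, by omega⟩
  have h5 : (r + 2) ^ (n + 2) ≤ (r + 1) * (r + 1) + 1 := by
    have : r + 2 - 1 = r + 1 := by omega
    rw [this] at h3
    omega
  nlinarith

lemma pair_indep (F K : Type) [Field F] [Fintype F] [Field K] [Fintype K] [Algebra F K]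
    (n : ℕ) (hn : Module.finrank F K = n + 2) (q : ℕ) (hq : Fintype.card F = q)
    (x : K) (hx0 : x ≠ 0) (hx : IsPrimitiveElt x) (a b : F) (h : a • x + b • x ^ q = 0) :
    a = 0 ∧ b = 0 := by
  by_cases hb : b = 0
  · subst hb
    simp only [zero_smul, add_zero, smul_eq_zero, hx0, or_false] at h
    exact ⟨h, rfl⟩
  · exfalso
    apply not_eig F K n hn q hq x hx0 hx (-(b⁻¹ * a))
    have : x ^ q = b⁻¹ • (b • x ^ q) := by rw [smul_smul, inv_mul_cancel₀ hb, one_smul]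
    rw [this, eq_neg_of_add_eq_zero_right h, smul_neg, neg_smul, smul_smul]

lemma kn_aux (F K : Type) [Field F] [Field K] [Algebra F K] (q m : ℕ) (x : K)
    (hli : ∀ d : Fin m → F, ∑ i, d i • x ^ q ^ (i : ℕ) = 0 → ∀ i, d i = 0)
    (d : Fin m → F) (hd : x ^ q ^ m = ∑ i, d i • x ^ q ^ (i : ℕ)) :
    IskNormal q (m + 1) 1 F x := by
  unfold IskNormal
  have h1 : LinearIndependent F (fun i : Fin m => x ^ q ^ (i : ℕ)) :=
    Fintype.linearIndependent_iff.mpr hli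
  have h2 : Submodule.span F (Set.range fun i : Fin (m + 1) => x ^ q ^ (i : ℕ))
      = Submodule.span F (Set.range fun i : Fin m => x ^ q ^ (i : ℕ)) := by
    apply le_antisymm
    · rw [Submodule.span_le]
      rintro _ ⟨i, rfl⟩
      refine Fin.lastCases ?_ (fun j => ?_) i
      · simp only [Fin.val_last, hd]
        exact Submodule.sum_mem _ fun i _ => Submodule.smul_mem _ _
          (Submodule.subset_span ⟨i, rfl⟩)
      · exact Submodule.subset_span ⟨j, rfl⟩
    · apply Submodule.span_mono
      rintro _ ⟨i, rfl⟩
      exact ⟨i.castSucc, rfl⟩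
  rw [h2, finrank_span_eq_card h1]
  simp

lemma kn_three (F K : Type) [Field F] [Fintype F] [Field K] [Fintype K] [Algebra F K]
    (hn : Module.finrank F K = 3) (q : ℕ) (hq : Fintype.card F = q)
    (x : K) (hx0 : x ≠ 0) (hx : IsPrimitiveElt x) (a b : F)
    (h : x ^ q ^ 2 = a • x + b • x ^ q) : IskNormal q 3 1 F x := by
  apply kn_aux F K q 2 x _ ![a, b]
  · simpa [Fin.sum_univ_two] using h
  · intro d hd
    rw [Fin.sum_univ_two] at hd
    have := pair_indep F K 1 hn q hq x hx0 hx (d 0) (d 1) (by simpa using hd)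
    intro i
    fin_cases i
    · exact this.1
    · exact this.2

lemma kn_four (F K : Type) [Field F] [Fintype F] [Field K] [Fintype K] [Algebra F K]
    (hn : Module.finrank F K = 4) (q : ℕ) (hq : Fintype.card F = q) (hq4 : q % 4 = 3)
    (x : K) (hx0 : x ≠ 0) (hx : IsPrimitiveElt x) (ht : Algebra.trace F K x = 0) :
    IskNormal q 4 1 F x := by
  have ht' := FiniteField.algebraMap_trace_eq_sum_pow F K x
  rw [ht, map_zero, hn, Nat.card_eq_fintype_card, hq] at ht'
  simp only [Finset.sum_range_succ, Finset.sum_range_zero, zero_add, pow_zero, pow_one] at ht'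
  apply kn_aux F K q 3 x _ (fun _ => -1)
  · simp only [Fin.sum_univ_three, neg_smul, one_smul]
    simp only [Fin.val_zero, Fin.val_one, Fin.val_two, pow_zero, pow_one]
    linear_combination -ht'
  · intro d hd
    rw [Fin.sum_univ_three] at hd
    simp only [Fin.val_zero, Fin.val_one, Fin.val_two, pow_zero, pow_one] at hd
    have hind := pair_indep F K 2 hn q hq x hx0 hx
    have hσ : ∀ (a b : F) (y z : K), (a • y + b • z) ^ q = a • y ^ q + b • z ^ q := by
      intro a b y z
      have := map_add (FiniteField.frobeniusAlgHom F K) (a • y) (b • z)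
      rw [map_smul, map_smul] at this
      simpa only [FiniteField.coe_frobeniusAlgHom, hq] using this
    by_cases hc : d 2 = 0
    · rw [hc, zero_smul, add_zero] at hd
      have := hind _ _ hd
      intro i
      fin_cases i
      · exact this.1
      · exact this.2
      · exact hc
    · exfalso
      obtain ⟨a, b, hab⟩ : ∃ a b : F, x ^ q ^ 2 = a • x ^ q + b • x := by
        refine ⟨-((d 2)⁻¹ * d 1), -((d 2)⁻¹ * d 0), ?_⟩
        have : x ^ q ^ 2 = (d 2)⁻¹ • (d 2 • x ^ q ^ 2) := by
          rw [smul_smul, inv_mul_cancel₀ hc, one_smul]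
        rw [this, eq_neg_of_add_eq_zero_right hd]
        simp only [smul_neg, smul_add, smul_smul, neg_smul]
        ring
      have h3 : x ^ q ^ 3 = a • x ^ q ^ 2 + b • x ^ q := by
        have e1 : x ^ q ^ 3 = (x ^ q ^ 2) ^ q := by rw [← pow_mul, ← pow_succ]
        rw [e1, hab, hσ, ← hab, ← pow_mul, ← sq]
      rw [h3, hab] at ht'
      have h4 := hind (1 + b + a * b) (1 + a + a * a + b) (by
        simp only [Algebra.smul_def, map_add, map_mul, map_one] at ht' ⊢
        linear_combination -ht')
      have h5 : a * ((a + 1) * (a + 1) + 1) = 0 := by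
        linear_combination (1 + a) * h4.2 - h4.1
      rcases mul_eq_zero.mp h5 with h6 | h6
      · subst h6
        have hb : b = -1 := by linear_combination h4.1
        subst hb
        rw [zero_smul, zero_add, neg_smul, one_smul] at hab
        have hq1 : 1 < q := by rw [← hq]; exact Fintype.one_lt_card
        have hq2 : 1 ≤ q ^ 2 := Nat.one_le_pow _ _ (by omega)
        have h7 : x ^ (q ^ 2 - 1) = -1 := by
          apply mul_right_cancel₀ hx0
          rw [← pow_succ, Nat.sub_add_cancel hq2, hab]; ring
        have h8 : x ^ ((q ^ 2 - 1) * 2) = 1 := by rw [pow_mul, h7]; ring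
        have h10 : 4 ≤ q ^ 2 := by nlinarith
        have h9 := prim_pow x hx _ (by omega) h8
        rw [Module.card_eq_pow_finrank (K := F) (V := K), hn, hq] at h9
        have h11 : q ^ 4 = q ^ 2 * q ^ 2 := by ring
        have h12 : 4 * q ^ 2 ≤ q ^ 4 := by nlinarith
        omega
      · have : IsSquare (-1 : F) := ⟨a + 1, by linear_combination -h6⟩
        rw [FiniteField.isSquare_neg_one_iff, hq] at this
        exact this hq4

lemma irr5 (F : Type) [Field F] [Fintype F] (q : ℕ) (hq : Fintype.card F = q)
    (hq5 : q % 5 = 2 ∨ q % 5 = 3) : Irreducible (cyclotomic 5 F) := by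
  obtain ⟨p, hp, f, hf⟩ := FiniteField.card' F
  have : Fact p.Prime := ⟨hf.1⟩
  have hcop : p.Coprime 5 := by
    rw [Nat.coprime_primes hf.1 Nat.prime_five]
    rintro rfl
    have : 5 ∣ q := by rw [← hq, hf.2]; exact dvd_pow_self _ f.ne_zero
    omega
  apply irreducible_of_dvd_cyclotomic_of_natDegree hf.2 hcop dvd_rfl
  rw [natDegree_cyclotomic, Nat.totient_prime Nat.prime_five]
  symm
  have hv : ((p ^ (f : ℕ) : ℕ) : ZMod 5) = 2 ∨ ((p ^ (f : ℕ) : ℕ) : ZMod 5) = 3 := by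
    rw [← hf.2, hq, ← ZMod.natCast_mod q 5]
    rcases hq5 with h | h <;> rw [h]
    · left; rfl
    · right; rfl
  have := orderOf_eq_prime_pow (p := 2) (n := 1)
    (x := ZMod.unitOfCoprime _ (hcop.pow_left (f : ℕ))) ?_ ?_
  · simpa using this
  · intro h
    have := congrArg Units.val h
    rw [Units.val_pow_eq_pow_val, ZMod.coe_unitOfCoprime] at this
    rcases hv with h | h <;> rw [h] at this <;> revert this <;> decide
  · apply Units.ext
    rw [Units.val_pow_eq_pow_val, ZMod.coe_unitOfCoprime]
    rcases hv with h | h <;> rw [h] <;> decide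

lemma kn_five (F K : Type) [Field F] [Fintype F] [Field K] [Fintype K] [Algebra F K]
    (hn : Module.finrank F K = 5) (q : ℕ) (hq : Fintype.card F = q)
    (hq5 : q % 5 = 2 ∨ q % 5 = 3)
    (x : K) (hx0 : x ≠ 0) (ht : Algebra.trace F K x = 0) :
    IskNormal q 5 1 F x := by
  have ht' := FiniteField.algebraMap_trace_eq_sum_pow F K x
  rw [ht, map_zero, hn, Nat.card_eq_fintype_card, hq] at ht'
  set σ : K →ₗ[F] K := (FiniteField.frobeniusAlgHom F K).toLinearMap with hσ
  have hσx : ∀ i : ℕ, (σ ^ i) x = x ^ q ^ i := by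
    intro i
    induction i with
    | zero => simp
    | succ i ih =>
      rw [pow_succ', Module.End.mul_apply, ih, hσ, AlgHom.toLinearMap_apply,
        FiniteField.coe_frobeniusAlgHom, hq]
      simp only
      rw [← pow_mul, ← pow_succ]
  have hΦ : aeval σ (cyclotomic 5 F) x = 0 := by
    haveI : Fact (Nat.Prime 5) := ⟨Nat.prime_five⟩
    rw [cyclotomic_prime, map_sum]
    simp only [map_pow, aeval_X, LinearMap.sum_apply, hσx]
    exact ht'.symm
  apply kn_aux F K q 4 x _ (fun _ => -1)
  · simp only [Finset.sum_range_succ, Finset.sum_range_zero, zero_add, pow_zero, pow_one] at ht'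
    simp only [Fin.sum_univ_four, neg_smul, one_smul]
    have : ((3 : Fin 4) : ℕ) = 3 := rfl
    simp only [Fin.val_zero, Fin.val_one, Fin.val_two, this, pow_zero, pow_one]
    linear_combination -ht'
  · intro d hd
    set f : F[X] := ∑ i : Fin 4, C (d i) * X ^ (i : ℕ) with hf
    have hfx : aeval σ f x = 0 := by
      rw [hf, map_sum, ← hd]
      simp only [map_mul, map_pow, aeval_X, aeval_C, LinearMap.sum_apply, Module.End.mul_apply,
        hσx, Module.algebraMap_end_apply]
    have hdeg : f.degree < (4 : ℕ) := by
      rw [hf]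
      refine (degree_sum_le _ _).trans_lt ((Finset.sup_lt_iff (by decide)).mpr fun i _ => ?_)
      exact (degree_C_mul_X_pow_le _ _).trans_lt (by exact_mod_cast i.2)
    have hirr := irr5 F q hq hq5
    have hf0 : f = 0 := by
      by_contra hne
      have hnd : ¬ cyclotomic 5 F ∣ f := by
        intro h
        have h1 := degree_le_of_dvd h hne
        rw [degree_cyclotomic, Nat.totient_prime Nat.prime_five] at h1
        exact absurd (h1.trans_lt hdeg) (by norm_num)
      obtain ⟨u, v, huv⟩ := (hirr.coprime_iff_not_dvd).mpr hnd
      have h2 := congrArg (fun p => aeval σ p x) huv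
      simp only [map_add, map_mul, map_one, LinearMap.add_apply, Module.End.mul_apply, hΦ, hfx,
        map_zero, add_zero, Module.End.one_apply] at h2
      exact hx0 h2.symm
    intro i
    have h3 : f.coeff i = d i := by
      rw [hf, finset_sum_coeff]
      simp only [coeff_C_mul, coeff_X_pow, mul_ite, mul_one, mul_zero, Fin.val_inj]
      simp
    rw [← h3, hf0, coeff_zero]

lemma minprod (u : ℕ → ℕ) (hu : StrictMono u) (h0 : 0 < u 0) (T : Finset ℕ) :
    (∀ x ∈ T, ∃ i, x = u i) →
    ∏ i ∈ Finset.range T.card, u i ≤ ∏ x ∈ T, x ∧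
      ∑ x ∈ T, 1 / (x : ℝ) ≤ ∑ i ∈ Finset.range T.card, 1 / (u i : ℝ) := by
  classical
  induction T using Finset.induction_on_max with
  | empty => simp
  | insert a T hT ih =>
    intro h
    obtain ⟨ih1, ih2⟩ := ih (fun x hx => h x (Finset.mem_insert_of_mem hx))
    have ha : a ∉ T := fun ha => lt_irrefl _ (hT a ha)
    obtain ⟨j, hj⟩ := h a (Finset.mem_insert_self _ _)
    have hc : T.card ≤ j := by
      have : T ⊆ (Finset.range j).image u := by
        intro x hx
        obtain ⟨i, hi⟩ := h x (Finset.mem_insert_of_mem hx)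
        refine Finset.mem_image.mpr ⟨i, ?_, hi.symm⟩
        have := hT x hx
        rw [hi, hj] at this
        exact Finset.mem_range.mpr (hu.lt_iff_lt.mp this)
      have h1 := Finset.card_le_card this
      have h2 := Finset.card_image_le (s := Finset.range j) (f := u)
      rw [Finset.card_range] at h2
      omega
    have hle : u T.card ≤ a := by rw [hj]; exact hu.monotone hc
    have hpos : 0 < u T.card := lt_of_lt_of_le h0 (hu.monotone (Nat.zero_le _))
    rw [Finset.card_insert_of_notMem ha, Finset.prod_insert ha, Finset.sum_insert ha,
      Finset.prod_range_succ, Finset.sum_range_succ]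
    constructor
    · rw [mul_comm]; exact Nat.mul_le_mul hle ih1
    · have : 1 / (a : ℝ) ≤ 1 / (u T.card : ℝ) := by
        apply one_div_le_one_div_of_le
        · exact_mod_cast hpos
        · exact_mod_cast hle
      linarith

lemma nt3 (q : ℕ) (hq : 2 ≤ q) (T : Finset ℕ) (hT : ∀ l ∈ T, l.Prime ∧ l % 6 = 1)
    (hd : ∏ l ∈ T, l ≤ q ^ 2 + q + 1) :
    ∃ A B : Finset ℕ, A ∪ B = T ∧ Disjoint A B ∧ ∑ l ∈ B, 1 / (l : ℝ) ≤ 1 ∧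
    2 ^ A.card * √((q : ℝ) ^ 1) * ((B.card : ℝ) - ∑ l ∈ B, 1 / (l : ℝ))
      < (1 - ∑ l ∈ B, 1 / (l : ℝ)) *
        (∑ i ∈ Finset.range 2, (q : ℝ) ^ i - (2 ^ A.card - 1) * √((q : ℝ) ^ 1)) := by
  obtain ⟨h1, h2⟩ := minprod (fun i => 6 * i + 7)
    (strictMono_nat_of_lt_succ (fun i => by omega)) (by norm_num) T (by
      intro x hx
      obtain ⟨hp, h6⟩ := hT x hx
      refine ⟨x / 6 - 1, ?_⟩
      have : x ≠ 1 := hp.one_lt.ne'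
      omega)
  have h3 := h1.trans hd
  have hs := Real.sq_sqrt (Nat.cast_nonneg (α := ℝ) q)
  have hs0 := Real.sqrt_nonneg (q : ℝ)
  have hS0 : 0 ≤ ∑ x ∈ T, 1 / (x : ℝ) := Finset.sum_nonneg (fun i _ => by positivity)
  set S := ∑ x ∈ T, 1 / (x : ℝ) with hS
  have hsq : ∀ m : ℕ, m * m ≤ q → (m : ℝ) ≤ √(q : ℝ) := by
    intro m hm
    apply Real.le_sqrt_of_sq_le
    have : ((m * m : ℕ) : ℝ) ≤ q := by exact_mod_cast hm
    push_cast at this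
    nlinarith
  by_cases hr : 5 ≤ T.card
  · refine ⟨T, ∅, by simp, by simp, by simp, ?_⟩
    simp only [Finset.card_empty, Finset.sum_empty, Finset.sum_range_succ, Finset.sum_range_zero,
      pow_one, pow_zero]
    have hprod : ∀ r, 5 ≤ r → 16 ^ r < ∏ i ∈ Finset.range r, (6 * i + 7) := by
      intro r hr
      induction r, hr using Nat.le_induction with
      | base => decide
      | succ r hr ih =>
        rw [Finset.prod_range_succ, pow_succ]
        exact Nat.mul_lt_mul_of_lt_of_le ih (by omega) (by omega)
    have h4 := hprod _ hr
    have h5 : 4 ^ T.card ≤ q := by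
      by_contra hcon
      have : q + 1 ≤ 4 ^ T.card := by omega
      have h6 : (q + 1) ^ 2 ≤ (4 ^ T.card) ^ 2 := Nat.pow_le_pow_left this 2
      have h7 : (4 ^ T.card) ^ 2 = 16 ^ T.card := by
        rw [← pow_mul, mul_comm, pow_mul]; norm_num
      nlinarith
    have h6 := hsq (2 ^ T.card) (by
      rw [← mul_pow]; exact h5)
    push_cast at h6
    have e2 := mul_le_mul_of_nonneg_right h6 hs0
    rw [← sq (√(q : ℝ)), hs] at e2
    norm_num
    nlinarith
  · have hc : T.card = 0 ∨ T.card = 1 ∨ T.card = 2 ∨ T.card = 3 ∨ T.card = 4 := by omega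
    have hmono : ∀ m : ℕ, m * m + m + 1 < q ^ 2 + q + 1 → m < q := by
      intro m hm
      by_contra hcon
      have hcon : q ≤ m := by omega
      nlinarith
    have key : ∀ m : ℕ, m * m ≤ q → 1 ≤ m → ∀ s : ℝ, S ≤ s → s < 1 →
        (T.card : ℝ) - s ≤ m * (1 - s) →
        √(q : ℝ) * (T.card - S) < (1 - S) * (1 + q) := by
      intro m hm hm1 s hs1 hs2 hk
      have hx := hsq m hm
      have hm1' : (1 : ℝ) ≤ m := by exact_mod_cast hm1
      have e1 : (T.card : ℝ) - S ≤ √(q : ℝ) * (1 - S) := by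
        nlinarith [mul_nonneg (sub_nonneg.mpr hx) (sub_nonneg.mpr hs2.le),
          mul_nonneg (sub_nonneg.mpr hs1) (sub_nonneg.mpr (hm1'.trans hx))]
      have e2 := mul_le_mul_of_nonneg_left e1 hs0
      have e3 : √(q : ℝ) * (√(q : ℝ) * (1 - S)) = q * (1 - S) := by
        rw [← mul_assoc, ← sq, hs]
      nlinarith
    rcases hc with hc | hc | hc | hc | hc <;>
    (rw [hc] at h2 h3 key
     simp only [Finset.sum_range_succ, Finset.sum_range_zero, Finset.prod_range_succ,
       Finset.prod_range_zero] at h2 h3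
     norm_num at h2 h3
     refine ⟨∅, T, by simp, by simp, by linarith, ?_⟩
     simp only [Finset.card_empty, Finset.sum_range_succ, Finset.sum_range_zero,
      pow_one, pow_zero]
     rw [← hS, hc]
     simp only [one_mul, zero_add, sub_self, zero_mul, sub_zero])
    · exact key 1 (by omega) (by norm_num) _ h2 (by norm_num) (by norm_num)
    · exact key 1 (by omega) (by norm_num) _ h2 (by norm_num) (by norm_num)
    · exact key 3 (hmono 8 (by omega)) (by norm_num) _ h2 (by norm_num) (by norm_num)
    · exact key 6 (hmono 35 (by omega)) (by norm_num) _ h2 (by norm_num) (by norm_num)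
    · exact key 14 (hmono 195 (by omega)) (by norm_num) _ h2 (by norm_num) (by norm_num)

lemma nt4 (q : ℕ) (hq : q % 4 = 3) (A0 T : Finset ℕ) (hT : ∀ l ∈ T, l.Prime ∧ 5 ≤ l)
    (hdis : Disjoint A0 T)
    (hd : (A0.card = 1 ∧ 8 * ∏ l ∈ T, l ∣ (q + 1) * (q ^ 2 + 1)) ∨
      (A0.card = 2 ∧ q % 12 = 11 ∧ 24 * ∏ l ∈ T, l ∣ (q + 1) * (q ^ 2 + 1))) :
    ∃ A B : Finset ℕ, A ∪ B = A0 ∪ T ∧ Disjoint A B ∧ ∑ l ∈ B, 1 / (l : ℝ) ≤ 1 ∧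
    2 ^ A.card * √((q : ℝ) ^ 2) * ((B.card : ℝ) - ∑ l ∈ B, 1 / (l : ℝ))
      < (1 - ∑ l ∈ B, 1 / (l : ℝ)) *
        (∑ i ∈ Finset.range 3, (q : ℝ) ^ i - (2 ^ A.card - 1) * √((q : ℝ) ^ 2)) := by
  obtain ⟨h1, h2⟩ := minprod (fun i => 6 * (i / 2) + 5 + 2 * (i % 2))
    (strictMono_nat_of_lt_succ (fun i => by omega)) (by norm_num) T (by
      intro x hx
      obtain ⟨hp, h6⟩ := hT x hx
      refine ⟨x / 3 - 1, ?_⟩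
      have h2 : ¬ 2 ∣ x := by
        intro h
        have := (Nat.prime_dvd_prime_iff_eq Nat.prime_two hp).mp h
        omega
      have h3 : ¬ 3 ∣ x := by
        intro h
        have := (Nat.prime_dvd_prime_iff_eq Nat.prime_three hp).mp h
        omega
      omega)
  rw [Real.sqrt_sq (Nat.cast_nonneg (α := ℝ) q)]
  have hS0 : 0 ≤ ∑ x ∈ T, 1 / (x : ℝ) := Finset.sum_nonneg (fun i _ => by positivity)
  set S := ∑ x ∈ T, 1 / (x : ℝ) with hS
  set P := ∏ l ∈ T, l with hP
  have hQpos : 0 < (q + 1) * (q ^ 2 + 1) := by positivity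
  have hq3 : 3 ≤ q := by omega
  have hmono : ∀ m : ℕ, (m + 1) * (m ^ 2 + 1) < (q + 1) * (q ^ 2 + 1) → m < q := by
    intro m hm
    by_contra hcon
    have hcon : q ≤ m := by omega
    have := Nat.mul_le_mul (Nat.add_le_add_right hcon 1)
      (Nat.add_le_add_right (Nat.pow_le_pow_left hcon 2) 1)
    omega
  by_cases hr : 7 ≤ T.card
  · refine ⟨A0 ∪ T, ∅, by simp, by simp, by simp, ?_⟩
    simp only [Finset.card_empty, Finset.sum_empty, Finset.sum_range_succ, Finset.sum_range_zero,
      pow_one, pow_zero]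
    have hprod : ∀ r, 7 ≤ r →
        8 ^ (r + 1) ≤ ∏ i ∈ Finset.range r, (6 * (i / 2) + 5 + 2 * (i % 2)) := by
      intro r hr
      induction r, hr using Nat.le_induction with
      | base => decide
      | succ r hr ih =>
        rw [Finset.prod_range_succ, pow_succ]
        exact Nat.mul_le_mul ih (by omega)
    have h4 := hprod _ hr
    have h8 : 8 * P ≤ (q + 1) * (q ^ 2 + 1) := by
      rcases hd with ⟨_, hd⟩ | ⟨_, _, hd⟩
      · exact Nat.le_of_dvd hQpos hd
      · have := Nat.le_of_dvd hQpos hd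
        omega
    have h5 : 2 ^ (T.card + 2) ≤ q := by
      by_contra hcon
      have : q + 1 ≤ 2 ^ (T.card + 2) := by omega
      have h6 : (q + 1) ^ 3 ≤ (2 ^ (T.card + 2)) ^ 3 := Nat.pow_le_pow_left this 3
      have h7 : (2 ^ (T.card + 2)) ^ 3 = 8 * 8 ^ (T.card + 1) := by
        rw [← pow_mul, mul_comm, pow_mul]; ring
      nlinarith
    have hcard : (A0 ∪ T).card ≤ T.card + 2 := by
      have := Finset.card_union_le A0 T
      omega
    have h6 : 2 ^ (A0 ∪ T).card ≤ q := (Nat.pow_le_pow_right (by norm_num) hcard).trans h5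
    have h6' : (2 : ℝ) ^ (A0 ∪ T).card ≤ q := by exact_mod_cast h6
    have hq0 : (3 : ℝ) ≤ q := by exact_mod_cast hq3
    norm_num
    nlinarith
  · refine ⟨A0, T, rfl, hdis, ?_⟩
    rw [← hS]
    have hc : T.card = 0 ∨ T.card = 1 ∨ T.card = 2 ∨ T.card = 3 ∨ T.card = 4 ∨ T.card = 5 ∨
      T.card = 6 := by omega
    simp only [Finset.sum_range_succ (n := 2), Finset.sum_range_succ (n := 1),
      Finset.sum_range_succ (n := 0), Finset.sum_range_zero, pow_one, pow_zero]
    have key : ∀ a m : ℕ, m ≤ q → ∀ s : ℝ, S ≤ s → s < 1 → 2 ≤ a → a ≤ 4 → 2 * a ≤ m + 2 →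
        (a : ℝ) * (T.card - s) ≤ (1 - s) * (m + 1 - (a - 1)) →
        (a : ℝ) * q * (T.card - S) < (1 - S) * (0 + 1 + q + q ^ 2 - (a - 1) * q) := by
      intro a m hm s hs1 hs2 _ _ ha hk
      have hx : (m : ℝ) ≤ q := by exact_mod_cast hm
      have ha' : (2 * a : ℝ) ≤ m + 2 := by exact_mod_cast ha
      have hq0 : (3 : ℝ) ≤ q := by exact_mod_cast hq3
      have e1 : (a : ℝ) * (T.card - S) ≤ (1 - S) * (q + 1 - (a - 1)) := by
        nlinarith [mul_nonneg (sub_nonneg.mpr hx) (sub_nonneg.mpr hs2.le),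
          mul_nonneg (sub_nonneg.mpr hs1) (sub_nonneg.mpr (ha'.trans (add_le_add_left hx 2)))]
      have e2 := mul_le_mul_of_nonneg_left e1 (by linarith : (0 : ℝ) ≤ q)
      nlinarith
    rcases hd with ⟨ha, hd⟩ | ⟨ha, h12, hd⟩
    · have hle := Nat.le_of_dvd hQpos hd
      rw [ha]
      rcases hc with hc | hc | hc | hc | hc | hc | hc <;>
      (rw [hc] at h1 h2 key
       simp only [Finset.sum_range_succ, Finset.sum_range_zero, Finset.prod_range_succ,
         Finset.prod_range_zero] at h1 h2
       norm_num at h1 h2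
       refine ⟨by linarith, ?_⟩
       rw [hc])
      · have := key 2 3 (by omega) _ h2 (by norm_num) (by norm_num) (by norm_num) (by norm_num)
          (by norm_num)
        norm_num at this ⊢
        exact this
      · have := key 2 3 (by omega) _ h2 (by norm_num) (by norm_num) (by norm_num) (by norm_num)
          (by norm_num)
        norm_num at this ⊢
        exact this
      · have := key 2 6 (hmono 5 (by omega)) _ h2 (by norm_num) (by norm_num) (by norm_num)
          (by norm_num) (by norm_num)
        norm_num at this ⊢
        exact this
      · have := key 2 14 (hmono 13 (by omega)) _ h2 (by norm_num) (by norm_num) (by norm_num)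
          (by norm_num) (by norm_num)
        norm_num at this ⊢
        exact this
      · have := key 2 31 (hmono 30 (by omega)) _ h2 (by norm_num) (by norm_num) (by norm_num)
          (by norm_num) (by norm_num)
        norm_num at this ⊢
        exact this
      · have := key 2 80 (hmono 79 (by omega)) _ h2 (by norm_num) (by norm_num) (by norm_num)
          (by norm_num) (by norm_num)
        norm_num at this ⊢
        exact this
      · have := key 2 230 (hmono 229 (by omega)) _ h2 (by norm_num) (by norm_num) (by norm_num)
          (by norm_num) (by norm_num)
        norm_num at this ⊢
        exact this
    · have hle := Nat.le_of_dvd hQpos hd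
      have h23 : 2 ≤ T.card → 23 ≤ q := by
        intro h
        by_contra hcon
        have hq11 : q = 11 := by omega
        rw [hq11] at hd
        have hP61 : P ∣ 61 := by
          have : 24 * P ∣ 24 * 61 := by simpa using hd
          exact Nat.dvd_of_mul_dvd_mul_left (by norm_num) this
        have hsub : T ⊆ {61} := by
          intro l hl
          have hl1 : l ∣ 61 := (Finset.dvd_prod_of_mem _ hl).trans hP61
          have := (Nat.prime_dvd_prime_iff_eq (hT l hl).1 (by norm_num)).mp hl1
          simp [this]
        have := Finset.card_le_card hsub
        simp at this
        omega
      rw [ha]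
      rcases hc with hc | hc | hc | hc | hc | hc | hc <;>
      (rw [hc] at h1 h2 key h23
       simp only [Finset.sum_range_succ, Finset.sum_range_zero, Finset.prod_range_succ,
         Finset.prod_range_zero] at h1 h2
       norm_num at h1 h2
       refine ⟨by linarith, ?_⟩
       rw [hc])
      · have := key 4 11 (by omega) _ h2 (by norm_num) (by norm_num) (by norm_num) (by norm_num)
          (by norm_num)
        norm_num at this ⊢
        exact this
      · have := key 4 11 (by omega) _ h2 (by norm_num) (by norm_num) (by norm_num) (by norm_num)
          (by norm_num)
        norm_num at this ⊢
        exact this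
      · have := key 4 23 (h23 (by norm_num)) _ h2 (by norm_num) (by norm_num) (by norm_num)
          (by norm_num) (by norm_num)
        norm_num at this ⊢
        exact this
      · have := key 4 23 (h23 (by norm_num)) _ h2 (by norm_num) (by norm_num) (by norm_num)
          (by norm_num) (by norm_num)
        norm_num at this ⊢
        exact this
      · have := key 4 45 (hmono 44 (by omega)) _ h2 (by norm_num) (by norm_num) (by norm_num)
          (by norm_num) (by norm_num)
        norm_num at this ⊢
        exact this
      · have := key 4 100 (hmono 99 (by omega)) _ h2 (by norm_num) (by norm_num) (by norm_num)
          (by norm_num) (by norm_num)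
        norm_num at this ⊢
        exact this
      · have := key 4 230 (hmono 229 (by omega)) _ h2 (by norm_num) (by norm_num) (by norm_num)
          (by norm_num) (by norm_num)
        norm_num at this ⊢
        exact this

lemma ord_lemma (p q l : ℕ) (hp : p.Prime) (hl : l.Prime) (hne : l ≠ p)
    (hd : l ∣ ∑ i ∈ Finset.range p, q ^ i) : p ∣ l - 1 := by
  have : Fact l.Prime := ⟨hl⟩
  have : Fact p.Prime := ⟨hp⟩
  have h0 : ∑ i ∈ Finset.range p, (q : ZMod l) ^ i = 0 := by
    have := (ZMod.natCast_eq_zero_iff _ l).mpr hd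
    push_cast at this
    exact this
  have h1 : (q : ZMod l) ^ p = 1 := by
    have := geom_sum_mul (q : ZMod l) p
    rw [h0, zero_mul] at this
    exact (sub_eq_zero.mp this.symm)
  have h2 : (q : ZMod l) ≠ 1 := by
    intro h
    rw [h] at h0
    simp only [one_pow, Finset.sum_const, Finset.card_range, nsmul_eq_mul, mul_one] at h0
    have := (ZMod.natCast_eq_zero_iff _ l).mp h0
    exact hne ((Nat.prime_dvd_prime_iff_eq hl hp).mp this)
  have h3 : (q : ZMod l) ≠ 0 := by
    intro h
    rw [h, zero_pow hp.ne_zero] at h1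
    exact zero_ne_one h1
  have h4 := ZMod.orderOf_dvd_card_sub_one h3
  rwa [orderOf_eq_prime h1 h2] at h4

lemma nt5 (q : ℕ) (hq2 : 2 ≤ q) (hq : q % 5 = 2 ∨ q % 5 = 3) (Q : ℕ)
    (hQ : Q = ∑ i ∈ Finset.range 5, q ^ i) :
    (2 ^ Q.primeFactors.card - 1) * √((q : ℝ) ^ 3) < ∑ i ∈ Finset.range 4, (q : ℝ) ^ i := by
  have hQ' : Q = q ^ 4 + q ^ 3 + q ^ 2 + q + 1 := by
    rw [hQ]; simp only [Finset.sum_range_succ, Finset.sum_range_zero]; ring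
  have hQ0 : Q ≠ 0 := by omega
  have h11 : ∀ l ∈ Q.primeFactors, 8 ≤ l := by
    intro l hl
    have hlp := Nat.prime_of_mem_primeFactors hl
    have hld := Nat.dvd_of_mem_primeFactors hl
    have hne : l ≠ 5 := by
      rintro rfl
      have : Q % 5 = 0 := Nat.mod_eq_zero_of_dvd hld
      rcases hq with h | h <;> simp [hQ', Nat.add_mod, Nat.pow_mod, h] at this
    rw [hQ] at hld
    have h5 := ord_lemma 5 q l Nat.prime_five hlp hne hld
    have h2 := hlp.two_le
    have h6 : l ≠ 6 := by rintro rfl; norm_num at hlp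
    omega
  set k := Q.primeFactors.card with hk
  have h8 : 8 ^ k ≤ Q :=
    (Finset.pow_card_le_prod _ _ _ h11).trans
      (Nat.le_of_dvd (Nat.pos_of_ne_zero hQ0) (Nat.prod_primeFactors_dvd Q))
  have h64 : (2 ^ k) ^ 6 * q ^ 9 ≤ ((q + 1) * (q ^ 2 + 1)) ^ 6 := by
    have e1 : (2 ^ k) ^ 6 = (8 ^ k) ^ 2 := by
      rw [← pow_mul, ← pow_mul, mul_comm, mul_comm k 2, pow_mul, pow_mul]; norm_num
    have e2 : Q ≤ (q + 1) ^ 4 := by rw [hQ']; nlinarith [sq_nonneg q, Nat.zero_le (q ^ 3)]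
    have e3 : (8 ^ k) ^ 2 ≤ ((q + 1) ^ 4) ^ 2 := Nat.pow_le_pow_left (h8.trans e2) 2
    have e4 : q * (q + 1) ^ 2 ≤ (q ^ 2 + 1) ^ 2 := by
      have : q ^ 3 * 1 ≤ q ^ 3 * (q - 1) := Nat.mul_le_mul_left _ (by omega)
      obtain ⟨r, rfl⟩ : ∃ r, q = r + 2 := ⟨q - 2, by omega⟩
      nlinarith [Nat.zero_le (r ^ 2), Nat.zero_le (r ^ 3), Nat.zero_le (r ^ 4)]
    have e5 : q ^ 8 ≤ (q ^ 2 + 1) ^ 4 := by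
      calc q ^ 8 = (q ^ 2) ^ 4 := by ring
        _ ≤ _ := Nat.pow_le_pow_left (by omega) 4
    calc (2 ^ k) ^ 6 * q ^ 9 ≤ ((q + 1) ^ 4) ^ 2 * q ^ 9 := by
          rw [e1]; exact Nat.mul_le_mul_right _ e3
      _ = (q + 1) ^ 6 * (q ^ 8 * (q * (q + 1) ^ 2)) := by ring
      _ ≤ (q + 1) ^ 6 * ((q ^ 2 + 1) ^ 4 * (q ^ 2 + 1) ^ 2) :=
          Nat.mul_le_mul_left _ (Nat.mul_le_mul e5 e4)
      _ = _ := by ring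
  have hs := Real.sq_sqrt (by positivity : (0 : ℝ) ≤ (q : ℝ) ^ 3)
  have hs0 : 0 < √((q : ℝ) ^ 3) := Real.sqrt_pos.mpr (by
    have : (0 : ℝ) < q := by exact_mod_cast (by omega : 0 < q)
    positivity)
  set s := √((q : ℝ) ^ 3)
  have hfin : (2 : ℝ) ^ k * s ≤ (q + 1) * (q ^ 2 + 1) := by
    apply le_of_pow_le_pow_left₀ (n := 6) (by norm_num) (by positivity)
    have e : ((2 : ℝ) ^ k * s) ^ 6 = (2 ^ k) ^ 6 * q ^ 9 := by
      rw [mul_pow]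
      congr 1
      calc s ^ 6 = (s ^ 2) ^ 3 := by ring
        _ = (q : ℝ) ^ 9 := by rw [hs]; ring
    rw [e]
    exact_mod_cast h64
  simp only [Finset.sum_range_succ, Finset.sum_range_zero]
  nlinarith

lemma part5 (F K : Type) [Field F] [Fintype F] [Field K] [Fintype K] [Algebra F K]
    (hn : Module.finrank F K = 5) (q : ℕ) (hq : Fintype.card F = q)
    (hq5 : q % 5 = 2 ∨ q % 5 = 3) : ∃ α : K, IsPrimitiveElt α ∧ IskNormal q 5 1 F α := by
  obtain ⟨g, hg0, hg⟩ := exists_primElt K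
  have hq1 : 1 < q := by rw [← hq]; exact Fintype.one_lt_card
  obtain ⟨Q, hQ⟩ : ∃ Q, Q = ∑ i ∈ Finset.range 5, q ^ i := ⟨_, rfl⟩
  have hQ0 : Q ≠ 0 := by
    rw [hQ]; simp [Finset.sum_range_succ]
  have h := nt5 q hq1 hq5 Q hQ
  obtain ⟨k, hk, hk2⟩ := field_sieve F K 3 hn g hg0 hg q Q hq hQ Q.primeFactors ∅ (by simp)
    (fun l hl => ⟨Nat.prime_of_mem_primeFactors hl, Nat.dvd_of_mem_primeFactors hl⟩)
    (by simp) (by simp) (by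
      simp only [Finset.card_empty, Finset.sum_empty, Nat.cast_zero, sub_zero, mul_zero, one_mul]
      norm_num only
      linarith)
  have hcop : k.Coprime Q := by
    rw [Nat.coprime_comm]
    apply Nat.coprime_of_dvd
    intro l hl hlQ
    exact hk2 l (by simp [hl, hlQ, hQ0])
  obtain ⟨c, hc, hprim⟩ := lift_primitive F K 5 hn g hg0 hg q Q hq hQ k hcop
  refine ⟨c • g ^ k, hprim, kn_five F K hn q hq hq5 _ (smul_ne_zero hc (pow_ne_zero _ hg0)) ?_⟩
  rw [map_smul, hk, smul_zero]

lemma part4 (F K : Type) [Field F] [Fintype F] [Field K] [Fintype K] [Algebra F K]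
    (hn : Module.finrank F K = 4) (q : ℕ) (hq : Fintype.card F = q)
    (hq4 : q % 4 = 3) : ∃ α : K, IsPrimitiveElt α ∧ IskNormal q 4 1 F α := by
  obtain ⟨g, hg0, hg⟩ := exists_primElt K
  have hq1 : 1 < q := by rw [← hq]; exact Fintype.one_lt_card
  obtain ⟨Q, hQ⟩ : ∃ Q, Q = ∑ i ∈ Finset.range 4, q ^ i := ⟨_, rfl⟩
  have hQ' : Q = (q + 1) * (q ^ 2 + 1) := by
    rw [hQ]; simp only [Finset.sum_range_succ, Finset.sum_range_zero]; ring
  have hQ0 : Q ≠ 0 := by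
    rw [hQ']; positivity
  set A0 := Q.primeFactors.filter (fun l => l < 5) with hA0
  set T := Q.primeFactors.filter (fun l => ¬ l < 5) with hT
  have hAT : A0 ∪ T = Q.primeFactors := Finset.filter_union_filter_not_eq _ _
  have hTp : ∀ l ∈ T, l.Prime ∧ 5 ≤ l := by
    intro l hl
    have := Finset.mem_filter.mp hl
    exact ⟨Nat.prime_of_mem_primeFactors this.1, by omega⟩
  have hTd : ∏ l ∈ T, l ∣ Q := Finset.prod_primes_dvd Q (fun l hl => (hTp l hl).1.prime)
    (fun l hl => Nat.dvd_of_mem_primeFactors (Finset.mem_filter.mp hl).1)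
  have h8 : 8 ∣ Q := by
    rw [hQ']
    exact Nat.mul_dvd_mul (a := 4) (c := 2) (by omega)
      (by
        have : q ^ 2 % 2 = 1 := by rw [Nat.pow_mod, show q % 2 = 1 by omega]
        omega)
  have h2 : 2 ∣ Q := dvd_trans (by norm_num) h8
  have hc2 : Nat.Coprime 2 (∏ l ∈ T, l) := Nat.Coprime.prod_right (fun l hl =>
    (Nat.coprime_primes Nat.prime_two (hTp l hl).1).mpr (by have := (hTp l hl).2; omega))
  have hc3 : Nat.Coprime 3 (∏ l ∈ T, l) := Nat.Coprime.prod_right (fun l hl =>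
    (Nat.coprime_primes Nat.prime_three (hTp l hl).1).mpr (by have := (hTp l hl).2; omega))
  have hc8 : Nat.Coprime 8 (∏ l ∈ T, l) := Nat.Coprime.pow_left 3 hc2
  have hsmall : ∀ l ∈ A0, l = 2 ∨ l = 3 := by
    intro l hl
    have := Finset.mem_filter.mp hl
    have hp := Nat.prime_of_mem_primeFactors this.1
    have h4 : l ≠ 4 := by rintro rfl; norm_num at hp
    have := hp.two_le
    omega
  obtain ⟨A, B, hAB, hdis, hS, hmain⟩ := nt4 q hq4 A0 T hTp
    (Finset.disjoint_filter_filter_not _ _ _) (by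
      rw [← hQ']
      by_cases h3 : 3 ∣ Q
      · right
        refine ⟨?_, ?_, ?_⟩
        · have : A0 = {2, 3} := by
            ext l
            simp only [Finset.mem_insert, Finset.mem_singleton]
            refine ⟨hsmall l, ?_⟩
            rintro (rfl | rfl)
            · simp [hA0, h2, hQ0, Nat.prime_two]
            · simp [hA0, h3, hQ0, Nat.prime_three]
          rw [this]; rfl
        · have h0 : Q % 3 = 0 := Nat.mod_eq_zero_of_dvd h3
          rw [hQ'] at h0
          have : q % 3 = 0 ∨ q % 3 = 1 ∨ q % 3 = 2 := by omega
          rcases this with h | h | h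
          · simp [Nat.mul_mod, Nat.add_mod, Nat.pow_mod, h] at h0
          · simp [Nat.mul_mod, Nat.add_mod, Nat.pow_mod, h] at h0
          · omega
        · have : Nat.Coprime 24 (∏ l ∈ T, l) := Nat.Coprime.mul_left hc8 hc3
          exact this.mul_dvd_of_dvd_of_dvd
            (Nat.Coprime.mul_dvd_of_dvd_of_dvd (by norm_num : Nat.Coprime 8 3) h8 h3) hTd
      · left
        refine ⟨?_, hc8.mul_dvd_of_dvd_of_dvd h8 hTd⟩
        have : A0 = {2} := by
          ext l
          simp only [Finset.mem_singleton]
          constructor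
          · intro hl
            rcases hsmall l hl with h | rfl
            · exact h
            · exact absurd (Nat.dvd_of_mem_primeFactors (Finset.mem_filter.mp hl).1) h3
          · rintro rfl
            simp [hA0, h2, hQ0, Nat.prime_two]
        rw [this]; rfl)
  rw [hAT] at hAB
  obtain ⟨k, hk, hk2⟩ := field_sieve F K 2 hn g hg0 hg q Q hq hQ A B hdis
    (fun l hl => by
      have : l ∈ Q.primeFactors := hAB ▸ Finset.mem_union_left _ hl
      exact ⟨Nat.prime_of_mem_primeFactors this, Nat.dvd_of_mem_primeFactors this⟩)
    (fun l hl => by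
      have : l ∈ Q.primeFactors := hAB ▸ Finset.mem_union_right _ hl
      exact ⟨Nat.prime_of_mem_primeFactors this, Nat.dvd_of_mem_primeFactors this⟩)
    hS hmain
  rw [hAB] at hk2
  have hcop : k.Coprime Q := by
    rw [Nat.coprime_comm]
    apply Nat.coprime_of_dvd
    intro l hl hlQ
    exact hk2 l (by simp [hl, hlQ, hQ0])
  obtain ⟨c, hc, hprim⟩ := lift_primitive F K 4 hn g hg0 hg q Q hq hQ k hcop
  refine ⟨c • g ^ k, hprim,
    kn_four F K hn q hq hq4 _ (smul_ne_zero hc (pow_ne_zero _ hg0)) hprim ?_⟩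
  rw [map_smul, hk, smul_zero]

lemma part3 (F K : Type) [Field F] [Fintype F] [Field K] [Fintype K] [Algebra F K]
    (hn : Module.finrank F K = 3) (q : ℕ) (hq : Fintype.card F = q) :
    ∃ α : K, IsPrimitiveElt α ∧ IskNormal q 3 1 F α := by
  obtain ⟨g, hg0, hg⟩ := exists_primElt K
  have hq1 : 1 < q := by rw [← hq]; exact Fintype.one_lt_card
  obtain ⟨Q, hQ⟩ : ∃ Q, Q = ∑ i ∈ Finset.range 3, q ^ i := ⟨_, rfl⟩
  have hQ' : Q = q ^ 2 + q + 1 := by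
    rw [hQ]; simp only [Finset.sum_range_succ, Finset.sum_range_zero]; ring
  have hQ0 : Q ≠ 0 := by omega
  have hT : ∀ l ∈ Q.primeFactors.erase 3, l.Prime ∧ l % 6 = 1 := by
    intro l hl
    obtain ⟨h3, hl⟩ := Finset.mem_erase.mp hl
    have hp := Nat.prime_of_mem_primeFactors hl
    have hd := Nat.dvd_of_mem_primeFactors hl
    refine ⟨hp, ?_⟩
    have h1 := ord_lemma 3 q l Nat.prime_three hp h3 (hQ ▸ hd)
    have h2 : l ≠ 2 := by
      rintro rfl
      have : Q % 2 = 0 := Nat.mod_eq_zero_of_dvd hd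
      rw [hQ'] at this
      have h : q % 2 = 0 ∨ q % 2 = 1 := by omega
      rcases h with h | h <;> simp [Nat.add_mod, Nat.pow_mod, h] at this
    have h3 := hp.two_le
    have := hp.eq_two_or_odd
    omega
  have hd : ∏ l ∈ Q.primeFactors.erase 3, l ∣ Q :=
    Finset.prod_primes_dvd Q (fun l hl => (hT l hl).1.prime)
      (fun l hl => Nat.dvd_of_mem_primeFactors (Finset.mem_erase.mp hl).2)
  obtain ⟨A, B, hAB, hdis, hS, hmain⟩ := nt3 q hq1 _ hT
    (hQ' ▸ Nat.le_of_dvd (Nat.pos_of_ne_zero hQ0) hd)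
  obtain ⟨k, hk, hk2⟩ := field_sieve F K 1 hn g hg0 hg q Q hq hQ A B hdis
    (fun l hl => by
      have : l ∈ Q.primeFactors.erase 3 := hAB ▸ Finset.mem_union_left _ hl
      have := (Finset.mem_erase.mp this).2
      exact ⟨Nat.prime_of_mem_primeFactors this, Nat.dvd_of_mem_primeFactors this⟩)
    (fun l hl => by
      have : l ∈ Q.primeFactors.erase 3 := hAB ▸ Finset.mem_union_right _ hl
      have := (Finset.mem_erase.mp this).2
      exact ⟨Nat.prime_of_mem_primeFactors this, Nat.dvd_of_mem_primeFactors this⟩)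
    hS hmain
  rw [hAB] at hk2
  have hk3 : ∀ l, l.Prime → l ∣ Q → l ≠ 3 → ¬ l ∣ k := by
    intro l hl hlQ h3
    exact hk2 l (by simp [hl, hlQ, hQ0, h3])
  have ht := FiniteField.algebraMap_trace_eq_sum_pow F K (g ^ k)
  rw [hk, map_zero, hn, Nat.card_eq_fintype_card, hq] at ht
  simp only [Finset.sum_range_succ, Finset.sum_range_zero, zero_add, pow_zero, pow_one] at ht
  have hcF : ∀ c : F, c ^ q = c := fun c => by rw [← hq]; exact FiniteField.pow_card c
  have hcF2 : ∀ c : F, c ^ q ^ 2 = c := fun c => by rw [sq, pow_mul, hcF, hcF]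
  by_cases h33 : 3 ∣ Q ∧ 3 ∣ k
  · obtain ⟨h3Q, h3k⟩ := h33
    obtain ⟨m, hm⟩ : ∃ m, q = 3 * m + 1 := by
      have h0 : Q % 3 = 0 := Nat.mod_eq_zero_of_dvd h3Q
      rw [hQ'] at h0
      have : q % 3 = 0 ∨ q % 3 = 1 ∨ q % 3 = 2 := by omega
      rcases this with h | h | h
      · simp [Nat.add_mod, Nat.pow_mod, h] at h0
      · exact ⟨q / 3, by omega⟩
      · simp [Nat.add_mod, Nat.pow_mod, h] at h0
    obtain ⟨R, hR⟩ : ∃ R, R = 3 * (m ^ 2 + m) + 1 := ⟨_, rfl⟩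
    have hQR : Q = 3 * R := by rw [hQ', hR, hm]; ring
    have hcop : (k + R).Coprime Q := by
      rw [Nat.coprime_comm]
      apply Nat.coprime_of_dvd
      intro l hl hlQ hlk
      by_cases h3 : l = 3
      · subst h3
        omega
      · have hlR : l ∣ R := by
          rw [hQR] at hlQ
          rcases (Nat.Prime.dvd_mul hl).mp hlQ with h | h
          · exact absurd ((Nat.prime_dvd_prime_iff_eq hl Nat.prime_three).mp h) h3
          · exact h
        exact hk3 l hl hlQ h3 ((Nat.dvd_add_left hlR).mp hlk)
    obtain ⟨c, hc, hprim⟩ := lift_primitive F K 3 hn g hg0 hg q Q hq hQ (k + R) hcop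
    have hw := FiniteField.algebraMap_norm_eq_pow_sum F K (g ^ m)
    rw [hn, Nat.card_eq_fintype_card, hq, ← hQ, ← pow_mul] at hw
    set w := Algebra.norm F (g ^ m) with hwdef
    have hβ : (g ^ R) ^ q = algebraMap F K w * g ^ R := by
      rw [hw, ← pow_mul, ← pow_add]
      congr 1
      rw [hQR, hm]; ring
    have hβ2 : (g ^ R) ^ q ^ 2 = algebraMap F K w ^ 2 * g ^ R := by
      rw [sq q, pow_mul, hβ, mul_pow, hβ, ← map_pow, hcF]; ring
    refine ⟨c • g ^ (k + R), hprim, kn_three F K hn q hq _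
      (smul_ne_zero hc (pow_ne_zero _ hg0)) hprim (-w ^ 2) (-w) ?_⟩
    have hx2 : (g ^ k) ^ q ^ 2 = -(g ^ k) - (g ^ k) ^ q := by linear_combination -ht
    simp only [Algebra.smul_def, mul_pow, pow_add g k R, hβ, hβ2, hx2, ← map_pow, hcF, hcF2]
    simp only [map_neg, map_pow]
    ring
  · have hcop : k.Coprime Q := by
      rw [Nat.coprime_comm]
      apply Nat.coprime_of_dvd
      intro l hl hlQ hlk
      by_cases h3 : l = 3
      · subst h3; exact h33 ⟨hlQ, hlk⟩
      · exact hk3 l hl hlQ h3 hlk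
    obtain ⟨c, hc, hprim⟩ := lift_primitive F K 3 hn g hg0 hg q Q hq hQ k hcop
    refine ⟨c • g ^ k, hprim, kn_three F K hn q hq _
      (smul_ne_zero hc (pow_ne_zero _ hg0)) hprim (-1) (-1) ?_⟩
    have hx2 : (g ^ k) ^ q ^ 2 = -(g ^ k) - (g ^ k) ^ q := by linear_combination -ht
    simp only [Algebra.smul_def, mul_pow, hx2, ← map_pow, hcF, hcF2]
    simp only [map_neg, map_one]
    ring

/-- (1) There is a primitive `1`-normal element of `F_{q³}` over `F_q`;
(2) if `q ≡ 3 (mod 4)`, of `F_{q⁴}`; (3) if `q ≡ 2, 3 (mod 5)`, of `F_{q⁵}`. -/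
theorem stmt_10 (q : ℕ) (hq : IsPrimePow q)
    (F : Type) [Field F] [Fintype F] (hcF : Fintype.card F = q) :
    (∀ (K : Type) [Field K] [Fintype K] [Algebra F K], Module.finrank F K = 3 →
      ∃ α : K, IsPrimitiveElt α ∧ IskNormal q 3 1 F α) ∧
    (q % 4 = 3 → ∀ (K : Type) [Field K] [Fintype K] [Algebra F K], Module.finrank F K = 4 →
      ∃ α : K, IsPrimitiveElt α ∧ IskNormal q 4 1 F α) ∧
    (q % 5 = 2 ∨ q % 5 = 3 → ∀ (K : Type) [Field K] [Fintype K] [Algebra F K],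
      Module.finrank F K = 5 →
      ∃ α : K, IsPrimitiveElt α ∧ IskNormal q 5 1 F α) := by
  refine ⟨?_, ?_, ?_⟩
  · intro K _ _ _ hn
    exact part3 F K hn q hcF
  · intro h K _ _ _ hn
    exact part4 F K hn q hcF h
  · intro h K _ _ _ hn
    exact part5 F K hn q hcF h

end
end

section
/- Let q be a power of a prime p and let n = p²s for an integer s ≥ 1. Let ζ ∈ F_q with x − ζ dividing x^n − 1. Then α ∈ F_{q^n} has minimal polynomial m_{σ_q,α}(x) = (x^n − 1)/(x − ζ) if and only if β = Tr_{q^n/q^{ps}}(α) has minimal polynomial m_{σ_q,β}(x) = (x^{ps} − 1)/(x − ζ). -/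
open Polynomial

noncomputable section

lemma frobComp_eq_aeval {F K : Type*} [Field F] [Fintype F] [Field K] [Algebra F K]
    (f : F[X]) (α : K) :
    frobComp (Fintype.card F) f α =
      aeval (FiniteField.frobeniusAlgHom F K).toLinearMap f α := by
  rw [aeval_eq_sum_range, frobComp, LinearMap.sum_apply]
  refine Finset.sum_congr rfl fun i _ => ?_
  rw [LinearMap.smul_apply, Algebra.smul_def, Module.End.pow_apply]
  congr 1
  have : ⇑(FiniteField.frobeniusAlgHom F K).toLinearMap = (· ^ Fintype.card F) := rfl
  rw [this, pow_iterate]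

lemma frobComp_algebraMap {F E K : Type*} [Field F] [Field E] [Field K]
    [Algebra F E] [Algebra E K] [Algebra F K] [IsScalarTower F E K] (q : ℕ)
    (f : F[X]) (β : E) :
    algebraMap E K (frobComp q f β) = frobComp q f (algebraMap E K β) := by
  simp [frobComp, map_sum, ← IsScalarTower.algebraMap_apply]

lemma frob_core {F V : Type*} [Field F] [AddCommGroup V] [Module F V] (φ : V →ₗ[F] V)
    (A B T M D : F[X]) (k : ℕ) (hk : 2 ≤ k) (hT : T.Monic) (hM : M.Monic)
    (hD : D.natDegree = 1)
    (hAB : A = B ^ k) (hTA : T * A = A ^ k) (hDM : A = D * M) (a b : V)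
    (hab : aeval φ T a = b) :
    ((T * M).Monic ∧ aeval φ (T * M) a = 0 ∧
      ∀ h : F[X], h.Monic → aeval φ h a = 0 → (T * M).natDegree ≤ h.natDegree) ↔
    (M.Monic ∧ aeval φ M b = 0 ∧
      ∀ h : F[X], h.Monic → aeval φ h b = 0 → M.natDegree ≤ h.natDegree) := by
  classical
  have key : ∀ h : F[X], aeval φ (T * h) a = aeval φ h b := by
    intro h
    rw [mul_comm, map_mul, Module.End.mul_apply, hab]
  constructor
  · rintro ⟨_, h2, h3⟩
    refine ⟨hM, by rw [← key, h2], fun h hh hb => ?_⟩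
    have := h3 (T * h) (hT.mul hh) (by rw [key, hb])
    rw [hT.natDegree_mul hM, hT.natDegree_mul hh] at this
    omega
  · rintro ⟨_, h2, h3⟩
    refine ⟨hT.mul hM, by rw [key, h2], fun h hh ha => ?_⟩
    have hN0 : T * M ≠ 0 := (hT.mul hM).ne_zero
    -- the gcd annihilates `a`
    have hg : aeval φ (EuclideanDomain.gcd (T * M) h) a = 0 := by
      rw [EuclideanDomain.gcd_eq_gcd_ab, mul_comm (T * M), mul_comm h, map_add,
        map_mul _ _ (T * M), map_mul _ _ h,
        LinearMap.add_apply, Module.End.mul_apply, Module.End.mul_apply, key, h2, ha]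
      simp
    obtain ⟨u, hu⟩ := EuclideanDomain.gcd_dvd_left (T * M) h
    have hgh := EuclideanDomain.gcd_dvd_right (T * M) h
    set g := EuclideanDomain.gcd (T * M) h
    have hu1 : IsUnit u := by
      by_contra hnu
      have hu0 : u ≠ 0 := by
        rintro rfl
        exact hN0 (by rw [hu, mul_zero])
      obtain ⟨P, hP, w, hw⟩ := WfDvdMonoid.exists_irreducible_factor hnu hu0
      have hPp : Prime P := hP.prime
      have hPA : P ∣ A := by
        apply hPp.dvd_of_dvd_pow (n := k)
        rw [← hTA]
        have h1 : P ∣ T * M := by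
          rw [hu, hw]
          exact ⟨g * w, by ring⟩
        refine h1.trans ⟨D, by rw [hDM]; ring⟩
      have hPM : P ∣ M := by
        have hPB : P ∣ B := hPp.dvd_of_dvd_pow (hAB ▸ hPA)
        have hP2 : P ^ 2 ∣ D * M := by
          rw [← hDM, hAB]
          exact (pow_dvd_pow_of_dvd hPB 2).trans (pow_dvd_pow B hk)
        by_contra hnM
        have hc : IsCoprime (P ^ 2) M := ((hP.coprime_iff_not_dvd).2 hnM).pow_left
        have hd := hc.dvd_of_dvd_mul_right hP2
        have hD0 : D ≠ 0 := by
          rintro rfl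
          simp at hD
        have := natDegree_le_of_dvd hd hD0
        rw [natDegree_pow, hD] at this
        have := hP.natDegree_pos
        omega
      obtain ⟨M', hM'⟩ := hPM
      have hM'0 : M' ≠ 0 := by
        rintro rfl
        exact hM.ne_zero (by rw [hM', mul_zero])
      have e1 : T * M' = w * g := by
        apply mul_left_cancel₀ hP.ne_zero
        calc P * (T * M') = T * M := by rw [hM']; ring
          _ = P * (w * g) := by rw [hu, hw]; ring
      have e2 : aeval φ M' b = 0 := by
        rw [← key, e1, map_mul, Module.End.mul_apply, hg, map_zero]
      have e3 := h3 (M' * C (M'.leadingCoeff)⁻¹) (monic_mul_leadingCoeff_inv hM'0)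
        (by rw [mul_comm, map_mul, Module.End.mul_apply, e2, map_zero])
      rw [natDegree_mul_leadingCoeff_inv _ hM'0, hM', natDegree_mul hP.ne_zero hM'0] at e3
      have := hP.natDegree_pos
      omega
    have hg0 : g ≠ 0 := by
      intro h0
      exact hN0 (by rw [hu, h0, zero_mul])
    rw [hu, natDegree_mul hg0 hu1.ne_zero, natDegree_eq_zero_of_isUnit hu1, add_zero]
    exact natDegree_le_of_dvd hgh hh.ne_zero

/-- For `n = p²s`: `α ∈ F_{qⁿ}` has `σ_q`-minimal polynomial `(xⁿ-1)/(x-ζ)` iff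
`β = Tr_{qⁿ/q^{ps}}(α)` has `σ_q`-minimal polynomial `(x^{ps}-1)/(x-ζ)`. -/
theorem stmt_11 (p e q s : ℕ) (hp : p.Prime) (he : 0 < e) (hq : q = p ^ e) (hs : 1 ≤ s)
    (F E K : Type) [Field F] [Fintype F] [Field E] [Field K]
    [Algebra F E] [Algebra E K] [Algebra F K] [IsScalarTower F E K]
    (hcF : Fintype.card F = q) (hrE : Module.finrank F E = p * s)
    (hrK : Module.finrank F K = p ^ 2 * s)
    (ζ : F) (hζ : (X - C ζ) ∣ (X ^ (p ^ 2 * s) - 1 : F[X])) (α : K) :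
    IsFrobMinimal q ((X ^ (p ^ 2 * s) - 1 : F[X]) /ₘ (X - C ζ)) α ↔
      IsFrobMinimal q ((X ^ (p * s) - 1 : F[X]) /ₘ (X - C ζ)) (Algebra.trace E K α) := by
  have hs0 : 0 < s := hs
  have hr0 : 0 < p * s := Nat.mul_pos hp.pos hs0
  have hn0 : 0 < p ^ 2 * s := by have := hp.pos; positivity
  have : Fact p.Prime := ⟨hp⟩
  have : FiniteDimensional F E := Module.finite_of_finrank_pos (by omega)
  have : FiniteDimensional F K := Module.finite_of_finrank_pos (by omega)
  have : Finite E := Module.finite_of_finite F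
  have : Finite K := Module.finite_of_finite F
  have hchar : CharP F p := by
    obtain ⟨p', hp', m, hpm, hc⟩ := FiniteField.card' F
    have hdvd : p ∣ p' := by
      apply hp.dvd_of_dvd_pow (n := (m : ℕ))
      rw [← hc, hcF, hq]
      exact dvd_pow_self p he.ne'
    rw [(Nat.prime_dvd_prime_iff_eq hp hpm).1 hdvd]
    exact hp'
  have hEK : Module.finrank E K = p := by
    have := Module.finrank_mul_finrank F E K
    rw [hrE, hrK] at this
    apply Nat.eq_of_mul_eq_mul_left hr0
    rw [this]; ring
  have hcE : Nat.card E = q ^ (p * s) := by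
    rw [Module.natCard_eq_pow_finrank (K := F), hrE, Nat.card_eq_fintype_card, hcF]
  subst hcF
  set φ := (FiniteField.frobeniusAlgHom F K).toLinearMap with hφ
  have hE : ∀ g : F[X], IsFrobMinimal (Fintype.card F) g (Algebra.trace E K α) ↔
      (g.Monic ∧ aeval φ g (algebraMap E K (Algebra.trace E K α)) = 0 ∧
      ∀ h : F[X], h.Monic → aeval φ h (algebraMap E K (Algebra.trace E K α)) = 0 →
        g.natDegree ≤ h.natDegree) := by
    intro g
    have : ∀ f : F[X], frobComp (Fintype.card F) f (Algebra.trace E K α) = 0 ↔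
        aeval φ f (algebraMap E K (Algebra.trace E K α)) = 0 := by
      intro f
      rw [hφ, ← frobComp_eq_aeval, ← frobComp_algebraMap, map_eq_zero]
    simp only [IsFrobMinimal, this]
  have hK : ∀ g : F[X], IsFrobMinimal (Fintype.card F) g α ↔
      (g.Monic ∧ aeval φ g α = 0 ∧
      ∀ h : F[X], h.Monic → aeval φ h α = 0 → g.natDegree ≤ h.natDegree) := by
    intro g
    simp only [IsFrobMinimal, frobComp_eq_aeval, hφ]
  have hA : (X ^ (p * s) - 1 : F[X]) = (X ^ s - 1) ^ p := by
    rw [sub_pow_char, one_pow, ← pow_mul, mul_comm]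
  have hAp : (X ^ (p ^ 2 * s) - 1 : F[X]) = (X ^ (p * s) - 1) ^ p := by
    rw [sub_pow_char, one_pow, ← pow_mul]
    congr 2; ring
  have hTA : (∑ i ∈ Finset.range p, (X ^ (p * s) : F[X]) ^ i) * (X ^ (p * s) - 1)
      = (X ^ (p * s) - 1) ^ p := by
    rw [geom_sum_mul, sub_pow_char, one_pow]
  have hAm : (X ^ (p * s) - 1 : F[X]).Monic := by
    simpa using monic_X_pow_sub_C (1 : F) hr0.ne'
  have hT : (∑ i ∈ Finset.range p, (X ^ (p * s) : F[X]) ^ i).Monic := by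
    apply hAm.of_mul_monic_right
    rw [hTA]
    exact hAm.pow p
  have hDA : (X - C ζ) ∣ (X ^ (p * s) - 1 : F[X]) :=
    (prime_X_sub_C ζ).dvd_of_dvd_pow (hAp ▸ hζ)
  obtain ⟨M, hM⟩ := hDA
  have hMm : M.Monic := (monic_X_sub_C ζ).of_mul_monic_left (hM ▸ hAm)
  have hMe : (X ^ (p * s) - 1 : F[X]) /ₘ (X - C ζ) = M := by
    rw [hM, mul_divByMonic_cancel_left _ (monic_X_sub_C ζ)]
  have hNe : (X ^ (p ^ 2 * s) - 1 : F[X]) /ₘ (X - C ζ) =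
      (∑ i ∈ Finset.range p, (X ^ (p * s) : F[X]) ^ i) * M := by
    rw [hAp, ← hTA, hM, mul_left_comm, mul_divByMonic_cancel_left _ (monic_X_sub_C ζ)]
  rw [hE, hK, hMe, hNe]
  refine frob_core φ _ _ _ M (X - C ζ) p hp.two_le hT hMm (natDegree_X_sub_C ζ) hA hTA hM _ _ ?_
  rw [FiniteField.algebraMap_trace_eq_sum_pow, hEK, hcE, map_sum, LinearMap.sum_apply]
  refine Finset.sum_congr rfl fun i _ => ?_
  have h1 : ⇑φ = (· ^ Fintype.card F) := rfl
  rw [← pow_mul, aeval_X_pow, Module.End.pow_apply, h1, pow_iterate, ← pow_mul]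

end
end

section
/- Let q be a power of a prime p and let n be a positive integer divisible by p². Then there exists a primitive 1-normal element of F_{q^n} over F_q. -/
open Polynomial

noncomputable section

theorem aux_cyclic (F K : Type) [Field F] [Fintype F] [Field K] [Fintype K] [Algebra F K] :
    ∃ γ : K, ∀ f : F[X], aeval (FiniteField.frobeniusAlgHom F K).toLinearMap f γ = 0 →
      (X ^ Module.finrank F K - 1 : F[X]) ∣ f := by
  obtain ⟨x, hx⟩ := Module.exists_ker_toSpanSingleton_eq_annihilator F[X]
    (Module.AEval' (FiniteField.frobeniusAlgHom F K).toLinearMap)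
  obtain ⟨x, rfl⟩ := (Module.AEval'.of _).surjective x
  refine ⟨x, fun f hf => ?_⟩
  rw [← span_minpoly_eq_annihilator, FiniteField.minpoly_frobeniusAlgHom] at hx
  have : f ∈ Ideal.span {(X ^ Module.finrank F K - 1 : F[X])} := by
    rw [← hx, LinearMap.mem_ker, LinearMap.toSpanSingleton_apply]
    have h := congrArg (Module.AEval'.of (FiniteField.frobeniusAlgHom F K).toLinearMap) hf
    exact (Module.AEval.of_aeval_smul _ _ _).symm.trans (h.trans (map_zero _))
  exact Ideal.mem_span_singleton.mp this

theorem aux_frob (F K : Type) [Field F] [Fintype F] [Field K] [Fintype K] [Algebra F K]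
   (q : ℕ) (hq : Fintype.card F = q) (i : ℕ) (α : K) :
    ((FiniteField.frobeniusAlgHom F K).toLinearMap ^ i) α = α ^ q ^ i := by
  induction i with
  | zero => simp
  | succ i ih => 
    rw [pow_succ', Module.End.mul_apply, ih, pow_succ, pow_mul]
    simp [hq]

theorem aux_finrank (F K : Type) [Field F] [Fintype F] [Field K] [Fintype K] [Algebra F K]
   (q n : ℕ) (hq : Fintype.card F = q) (h : F[X]) (hd : h.natDegree = n - 1) (hn : 0 < n)
   (h0 : h ≠ 0) (α : K)
   (h1 : aeval (FiniteField.frobeniusAlgHom F K).toLinearMap h α = 0)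
   (h2 : ∀ f : F[X], aeval (FiniteField.frobeniusAlgHom F K).toLinearMap f α = 0 → h ∣ f) :
   Module.finrank F (Submodule.span F (Set.range fun i : Fin n => α ^ q ^ (i : ℕ))) = n - 1 := by
  have key : ∀ (k : ℕ) (c : Fin k → F), ∑ i, c i • α ^ q ^ (i : ℕ) = 
      aeval (FiniteField.frobeniusAlgHom F K).toLinearMap (∑ i : Fin k, C (c i) * X ^ (i : ℕ)) α := by
    intro k c
    simp only [map_sum, map_mul, aeval_C, map_pow, aeval_X, LinearMap.sum_apply, 
      Module.End.mul_apply, aux_frob F K q hq]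
    simp [Algebra.smul_def]
  apply le_antisymm
  · have hle := finrank_range_le_card (R := F) (fun i : Fin n => α ^ q ^ (i : ℕ))
    simp only [Fintype.card_fin] at hle
    by_contra hcon
    have heq : Module.finrank F (Submodule.span F (Set.range fun i : Fin n => α ^ q ^ (i : ℕ))) = n := by
      unfold Set.finrank at hle
      omega
    have hli : LinearIndependent F (fun i : Fin n => α ^ q ^ (i : ℕ)) := by
      rw [linearIndependent_iff_card_eq_finrank_span]
      simp [Set.finrank, heq]
    rw [Fintype.linearIndependent_iff] at hli
    have := hli (fun i => h.coeff i) (by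
      rw [key, Fin.sum_univ_eq_sum_range (fun i => C (h.coeff i) * X ^ i), ← h1]
      congr 2
      conv_rhs => rw [h.as_sum_range' n (by omega)]
      simp [C_mul_X_pow_eq_monomial]) ⟨n - 1, by omega⟩
    simp only at this
    rw [← hd] at this
    exact h0 (leadingCoeff_eq_zero.mp this)
  · have hli : LinearIndependent F (fun i : Fin (n-1) => α ^ q ^ (i : ℕ)) := by
      rw [Fintype.linearIndependent_iff]
      intro c hc i
      rw [key] at hc
      have hdv := h2 _ hc
      have hdeg : (∑ i : Fin (n-1), C (c i) * X ^ (i : ℕ)).degree < h.degree := by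
        rw [degree_eq_natDegree h0, hd]
        exact degree_sum_fin_lt c
      have hz := eq_zero_of_dvd_of_degree_lt hdv hdeg
      have : (∑ i : Fin (n-1), C (c i) * X ^ (i : ℕ)).coeff i = c i := by
        simp only [finsetSum_coeff, coeff_C_mul_X_pow]
        simp [Fin.val_inj]
      rw [← this, hz, coeff_zero]
    have := finrank_span_eq_card hli
    simp only [Fintype.card_fin] at this
    rw [← this]
    apply Submodule.finrank_mono
    apply Submodule.span_mono
    rintro _ ⟨i, rfl⟩
    exact ⟨⟨i, by omega⟩, rfl⟩

theorem aux_poly (F : Type) [Field F] (p m : ℕ) [Fact p.Prime] [CharP F p] (hm : 0 < m) (hpm : p ∣ m)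
    (V : Type) [AddCommGroup V] [Module F V] (σ : Module.End F V) (γ α : V) (g : F[X])
    (hg : (X ^ m - 1 : F[X]) = (X - 1) * g)
    (hγ : ∀ f, aeval σ f γ = 0 → (X ^ m - 1 : F[X]) ^ p ∣ f)
    (hγ0 : aeval σ ((X ^ m - 1 : F[X]) ^ p) γ = 0)
    (hα : aeval σ ((X ^ m - 1 : F[X]) ^ (p - 1)) α = aeval σ ((X ^ m - 1 : F[X]) ^ (p - 1) * (X - 1)) γ) :
    aeval σ ((X ^ m - 1 : F[X]) ^ (p - 1) * g) α = 0 ∧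
    ∀ f, aeval σ f α = 0 → (X ^ m - 1 : F[X]) ^ (p - 1) * g ∣ f := by
  have hp : p.Prime := Fact.out
  set P : F[X] := X ^ m - 1 with hP
  have hP0 : P ≠ 0 := X_pow_sub_C_ne_zero hm 1
  have hg0 : g ≠ 0 := by rintro rfl; simp at hg; exact hP0 hg
  have hX0 : (X - 1 : F[X]) ≠ 0 := by intro h; rw [h, zero_mul] at hg; exact hP0 hg
  classical
  set h := P ^ (p - 1) * g with hh
  have hh0 : h ≠ 0 := mul_ne_zero (pow_ne_zero _ hP0) hg0
  obtain ⟨m', rfl⟩ := hpm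
  have hPP : P = (X ^ m' - 1) ^ p := by
    rw [sub_pow_char, one_pow, ← pow_mul, mul_comm m' p]
  have hPpow : P ^ (p - 1) * P = P ^ p := by
    rw [← pow_succ]; congr 1; have := hp.pos; omega
  have step : ∀ u, aeval σ (P ^ (p - 1) * u) α = 0 → P ∣ u * (X - 1) := by
    intro u hu
    rw [mul_comm, map_mul, Module.End.mul_apply, hα, ← Module.End.mul_apply, ← map_mul] at hu
    have := hγ _ hu
    rw [← hPpow, show u * (P ^ (p-1) * (X - 1)) = P ^ (p-1) * (u * (X - 1)) by ring] at this
    exact (mul_dvd_mul_iff_left (pow_ne_zero _ hP0)).mp this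
  have hha : aeval σ h α = 0 := by
    rw [hh, mul_comm, map_mul, Module.End.mul_apply, hα, ← Module.End.mul_apply, ← map_mul,
      show g * (P ^ (p-1) * (X - 1)) = P ^ (p-1) * ((X - 1) * g) by ring, ← hg, hPpow, hγ0]
  refine ⟨hha, ?_⟩
  intro f hf
  set d := EuclideanDomain.gcd f h with hd
  have hdh : d ∣ h := EuclideanDomain.gcd_dvd_right _ _
  have hdf : d ∣ f := EuclideanDomain.gcd_dvd_left _ _
  have hda : aeval σ d α = 0 := by
    rw [hd, EuclideanDomain.gcd_eq_gcd_ab]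
    rw [mul_comm f, mul_comm h, map_add, map_mul, map_mul, LinearMap.add_apply, Module.End.mul_apply,
      Module.End.mul_apply, hf, hha, map_zero, map_zero, add_zero]
  obtain ⟨e, he⟩ := hdh
  by_cases hu : IsUnit e
  · refine dvd_trans ?_ hdf
    rw [he]
    exact (hu.dvd_mul_right.mp (by rw [← he]; )) 
  exfalso
  have he0 : e ≠ 0 := by rintro rfl; simp at he; exact hh0 he
  obtain ⟨r, hr, hre⟩ := WfDvdMonoid.exists_irreducible_factor hu he0
  have hrp : Prime r := hr.prime
  have hrP : r ∣ P := by
    have h1 : r ∣ P ^ (p - 1) * P := by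
      refine (hre.trans ⟨d, by rw [mul_comm]⟩).trans ((he ▸ dvd_rfl : d * e ∣ h).trans ?_)
      rw [hh]
      exact mul_dvd_mul_left _ ⟨X - 1, by rw [hg, mul_comm]⟩
    rw [hPpow] at h1
    exact hrp.dvd_of_dvd_pow h1
  have hr2 : r * r ∣ P := by
    rw [hPP] at hrP ⊢
    have := hrp.dvd_of_dvd_pow hrP
    rw [← sq]
    exact (pow_dvd_pow_of_dvd this 2).trans (pow_dvd_pow _ hp.two_le)
  have hrg : r ∣ g := by
    rw [hg] at hr2
    rcases hrp.dvd_or_dvd ((dvd_mul_right r r).trans hr2) with h1 | h1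
    · have hass : Associated r (X - 1 : F[X]) := 
        (hr.associated_of_dvd (by simpa using irreducible_X_sub_C (1 : F)) h1)
      have h2 : (X - 1) * r ∣ (X - 1) * g := ((hass.symm.mul_right r).dvd).trans hr2
      exact (mul_dvd_mul_iff_left hX0).mp h2
    · exact h1
  obtain ⟨g', rfl⟩ := hrg
  obtain ⟨e', rfl⟩ := hre
  have h3 : d * e' = P ^ (p - 1) * g' := by
    have h4 : r * (d * e') = r * (P ^ (p - 1) * g') := by
      rw [hh] at he
      linear_combination -he
    exact mul_left_cancel₀ hr.ne_zero h4
  have h5 : aeval σ (P ^ (p - 1) * g') α = 0 := by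
    rw [← h3, mul_comm, map_mul, Module.End.mul_apply, hda, map_zero]
  have h6 := step _ h5
  rw [hg] at h6
  have hne : g' * (X - 1) ≠ 0 := mul_ne_zero (right_ne_zero_of_mul hg0) hX0
  have h7 : r * (g' * (X - 1)) ∣ 1 * (g' * (X - 1)) := by
    rw [one_mul]
    convert h6 using 1
    ring
  exact hr.not_isUnit (isUnit_of_dvd_one ((mul_dvd_mul_iff_right hne).mp h7))

theorem aux_normal_s12 (p e q n m : ℕ) (hp : p.Prime) (hq : q = p ^ e)
    (hm : 0 < m) (hpm : p ∣ m) (hnm : n = m * p)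
    (F K : Type) [Field F] [Fintype F] [Field K] [Fintype K] [Algebra F K]
    (hcF : Fintype.card F = q) (hrK : Module.finrank F K = n) :
    ∃ L : IntermediateField F K, Nat.card L = q ^ m ∧ Module.finrank L K = p ∧
      ∃ β : L, β ≠ 0 ∧ ∀ α : K, Algebra.trace L K α = β → 
        Module.finrank F (Submodule.span F (Set.range fun i : Fin n => α ^ q ^ (i : ℕ))) = n - 1 := by
  haveI : Fact p.Prime := ⟨hp⟩
  haveI : CharP F p := by
    refine charP_of_card_eq_prime_pow (f := e) ?_
    rw [hcF, hq]
  have hn : 0 < n := by rw [hnm]; exact Nat.mul_pos hm hp.pos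
  let L : IntermediateField F K := IntermediateField.fixedField
    (Subgroup.zpowers (FiniteField.frobeniusAlgEquivOfAlgebraic F K ^ m))
  have hLK : Module.finrank L K = p := by
    rw [IntermediateField.finrank_fixedField_eq_card, Nat.card_zpowers, orderOf_pow,
      FiniteField.orderOf_frobeniusAlgEquivOfAlgebraic, hrK, hnm, Nat.gcd_eq_right (dvd_mul_right m p),
      Nat.mul_div_cancel_left _ hm]
  have hcK : Nat.card K = q ^ n := by
    rw [Module.natCard_eq_pow_finrank (K := F), hrK, Nat.card_eq_fintype_card, hcF]
  have hcL : Nat.card L = q ^ m := by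
    have h1 := Module.natCard_eq_pow_finrank (K := L) (V := K)
    rw [hcK, hLK, hnm, pow_mul] at h1
    exact (Nat.pow_left_injective hp.ne_zero h1).symm
  refine ⟨L, hcL, hLK, ?_⟩
  obtain ⟨γ, hγ⟩ := aux_cyclic F K
  rw [hrK] at hγ
  set σ := (FiniteField.frobeniusAlgHom F K).toLinearMap with hσ
  have hPp : (X ^ m - 1 : F[X]) ^ p = X ^ n - 1 := by
    rw [sub_pow_char, one_pow, ← pow_mul, hnm]
  have hP0 : (X ^ m - 1 : F[X]) ≠ 0 := X_pow_sub_C_ne_zero hm 1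
  have hgeom : (X ^ m - 1 : F[X]) ^ (p - 1) = ∑ i ∈ Finset.range p, (X ^ m) ^ i := by
    apply mul_right_cancel₀ hP0
    rw [geom_sum_mul, ← pow_succ, Nat.sub_add_cancel hp.one_le, hPp, ← pow_mul, hnm]
  have htr : ∀ x : K, algebraMap L K (Algebra.trace L K x) = 
      aeval σ ((X ^ m - 1 : F[X]) ^ (p - 1)) x := by
    intro x
    rw [FiniteField.algebraMap_trace_eq_sum_pow, hLK, hcL, hgeom]
    simp only [map_sum, map_pow, aeval_X, LinearMap.sum_apply, ← pow_mul]
    refine Finset.sum_congr rfl fun i _ => ?_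
    rw [hσ, aux_frob F K q hcF]
  obtain ⟨g, hg⟩ : (X - 1 : F[X]) ∣ X ^ m - 1 := by
    simpa using sub_dvd_pow_sub_pow (X : F[X]) 1 m
  have hm2 : 2 ≤ m := hp.two_le.trans (Nat.le_of_dvd hm hpm)
  have hdP : (X ^ m - 1 : F[X]).natDegree = m := by
    simpa using natDegree_X_pow_sub_C (n := m) (r := (1 : F))
  have hdX : (X - 1 : F[X]).natDegree = 1 := by
    simpa using natDegree_X_sub_C (1 : F)
  have hX0 : (X - 1 : F[X]) ≠ 0 := by intro h; rw [h, zero_mul] at hg; exact hP0 hg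
  have hg0 : g ≠ 0 := by rintro rfl; simp at hg; exact hP0 hg
  have hdg : g.natDegree = m - 1 := by
    have := natDegree_mul hX0 hg0
    rw [← hg, hdP, hdX] at this
    omega
  refine ⟨Algebra.trace L K (aeval σ (X - 1 : F[X]) γ), ?_, ?_⟩
  · intro h0
    have h1 := htr (aeval σ (X - 1 : F[X]) γ)
    rw [h0, map_zero, ← Module.End.mul_apply, ← map_mul] at h1
    have h2 := hγ _ h1.symm
    rw [← hPp, show (X ^ m - 1 : F[X]) ^ p = (X ^ m - 1) ^ (p - 1) * (X ^ m - 1) by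
      rw [← pow_succ, Nat.sub_add_cancel hp.one_le]] at h2
    have h3 := natDegree_le_of_dvd ((mul_dvd_mul_iff_left (pow_ne_zero _ hP0)).mp h2) hX0
    omega
  · intro α hα
    have hα' : aeval σ ((X ^ m - 1 : F[X]) ^ (p - 1)) α = 
        aeval σ ((X ^ m - 1 : F[X]) ^ (p - 1) * (X - 1)) γ := by
      rw [← htr, hα, htr, map_mul, Module.End.mul_apply]
    have hγ0 : aeval σ ((X ^ m - 1 : F[X]) ^ p) γ = 0 := by
      rw [hPp, map_sub, map_pow, aeval_X, map_one, LinearMap.sub_apply, hσ, aux_frob F K q hcF, ← hcK,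
        Nat.card_eq_fintype_card, FiniteField.pow_card]
      simp
    obtain ⟨h1, h2⟩ := aux_poly F p m hm hpm K σ γ α g hg (by rw [hPp]; exact hγ) hγ0 hα'
    refine aux_finrank F K q n hcF _ ?_ hn (mul_ne_zero (pow_ne_zero _ hP0) hg0) α h1 h2
    rw [natDegree_mul (pow_ne_zero _ hP0) hg0, natDegree_pow, hdP, hdg, hnm]
    obtain ⟨p', rfl⟩ : ∃ p', p = p' + 1 := ⟨p - 1, by have := hp.one_le; omega⟩
    simp only [Nat.add_sub_cancel]
    rw [mul_add, mul_comm p' m]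
    omega


theorem aux_fiber (L K : Type) [Field L] [Fintype L] [Field K] [Fintype K] [Algebra L K]
    (T : K →ₗ[L] L) (hT : T ≠ 0) (D : ℕ) (hD : Fintype.card K = Fintype.card L * D) (b : L) [DecidableEq L] :
    (Finset.univ.filter fun x => T x = b).card = D := by
  have hs : Function.Surjective T := LinearMap.surjective hT
  have h1 : ∀ b', (Finset.univ.filter fun x => T x = b').card = (Finset.univ.filter fun x => T x = b).card := by
    intro b'
    exact AddMonoidHom.card_fiber_eq_of_mem_range T.toAddMonoidHom (hs b') (hs b)
  have h2 : Fintype.card K = ∑ b', (Finset.univ.filter fun x => T x = b').card := by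
    rw [← Finset.card_univ]
    exact Finset.card_eq_sum_card_fiberwise (fun x _ => Finset.mem_univ _)
  simp only [h1] at h2
  rw [hD, Finset.sum_const, Finset.card_univ, smul_eq_mul] at h2
  exact (Nat.eq_of_mul_eq_mul_left Fintype.card_pos h2).symm

def SS (L K : Type) [Field L] [Fintype L] [Field K] [Fintype K] [Algebra L K] [DecidableEq L]
    (T : K →ₗ[L] L) (χ : MulChar K ℂ) (b : L) : ℂ := ∑ x with T x = b, χ x

section
variable (L K : Type) [Field L] [Fintype L] [Field K] [Fintype K] [Algebra L K] [DecidableEq L]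
    (T : K →ₗ[L] L) (χ : MulChar K ℂ)

theorem aux_norm1 (a : K) (ha : a ≠ 0) : ‖χ a‖ = 1 := by
  have h := MulChar.apply_mem_rootsOfUnity_orderOf χ ha
  obtain ⟨u, hu, h2⟩ := h
  rw [← h2]
  have : (u : ℂ) ^ orderOf χ = 1 := by
    have h3 : u ^ orderOf χ = 1 := hu
    have h4 := congrArg Units.val h3
    rwa [Units.val_pow_eq_pow_val, Units.val_one] at h4
  exact Complex.norm_eq_one_of_pow_eq_one this (MulChar.orderOf_pos χ).ne'

theorem SS_scale (c b : L) (hc : c ≠ 0) : SS L K T χ (c * b) = χ (algebraMap L K c) * SS L K T χ b := by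
  have hc' : algebraMap L K c ≠ 0 := by simpa using hc
  unfold SS
  rw [Finset.mul_sum]
  symm
  refine Finset.sum_bij (fun x _ => algebraMap L K c * x) ?_ ?_ ?_ ?_
  · intro x hx
    simp only [Finset.mem_filter, Finset.mem_univ, true_and] at hx ⊢
    rw [← Algebra.smul_def, map_smul, hx, smul_eq_mul]
  · intro x _ y _ h
    exact mul_left_cancel₀ hc' h
  · intro x hx
    simp only [Finset.mem_filter, Finset.mem_univ, true_and] at hx
    refine ⟨algebraMap L K c⁻¹ * x, ?_, ?_⟩
    · simp only [Finset.mem_filter, Finset.mem_univ, true_and]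
      rw [← Algebra.smul_def, map_smul, hx, smul_eq_mul, inv_mul_cancel_left₀ hc]
    · rw [← mul_assoc, ← map_mul, mul_inv_cancel₀ hc, map_one, one_mul]
  · intro x _
    rw [map_mul]

theorem SS_total (hT : T ≠ 0) (D : ℕ) (hD : Fintype.card K = Fintype.card L * D) (hχ : χ ≠ 1) :
    ∑ b, ‖SS L K T χ b‖ ^ 2 = ((Fintype.card L : ℝ) - 1) * D := by
  classical
  have hC : (∑ b, ((‖SS L K T χ b‖ ^ 2 : ℝ) : ℂ)) = ((Fintype.card L : ℂ) - 1) * D := by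
    have e1 : ∀ b, ((‖SS L K T χ b‖ ^ 2 : ℝ) : ℂ) = 
        ∑ y, ∑ x, if T y = b then (if T x = b then χ x * χ⁻¹ y else 0) else 0 := by
      intro b
      push_cast
      rw [← Complex.mul_conj']
      unfold SS
      rw [map_sum, Finset.sum_mul_sum, Finset.sum_comm]
      simp only [Finset.sum_filter]
      refine Finset.sum_congr rfl fun y _ => ?_
      split_ifs with hy
      · refine Finset.sum_congr rfl fun x _ => ?_
        split_ifs with hx
        · rw [← MulChar.star_apply']; rfl
        · rfl
      · simp
    have e2 : (∑ b, ((‖SS L K T χ b‖ ^ 2 : ℝ) : ℂ)) = ∑ y, ∑ x, if T x = T y then χ x * χ⁻¹ y else 0 := by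
      simp only [e1]
      rw [Finset.sum_comm]
      refine Finset.sum_congr rfl fun y _ => ?_
      rw [Finset.sum_comm]
      refine Finset.sum_congr rfl fun x _ => ?_
      simp
    have e3 : ∀ y, (∑ x, if T x = T y then χ x * χ⁻¹ y else 0) = 
        ∑ z, χ z * (if T (y * (z - 1)) = 0 ∧ y ≠ 0 then 1 else 0) := by
      intro y
      by_cases hy : y = 0
      · simp [hy, MulChar.map_zero]
      rw [← Equiv.sum_comp (Equiv.mulLeft₀ y hy)]
      refine Finset.sum_congr rfl fun z _ => ?_
      simp only [Equiv.mulLeft₀_apply]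
      have : (T (y * z) = T y) ↔ (T (y * (z - 1)) = 0 ∧ y ≠ 0) := by
        simp only [hy, ne_eq, not_false_eq_true, and_true]
        rw [mul_sub, mul_one, map_sub, sub_eq_zero]
      simp only [this]
      split_ifs
      · have h1 : χ y * χ⁻¹ y = 1 := by
          rw [← MulChar.mul_apply, mul_inv_cancel, MulChar.one_apply (Ne.isUnit hy)]
        rw [map_mul, mul_one]
        linear_combination χ z * h1
      · simp
    rw [e2]
    simp only [e3]
    rw [Finset.sum_comm]
    simp only [← Finset.mul_sum]
    have e4 : ∀ z, (∑ y, if T (y * (z - 1)) = 0 ∧ y ≠ 0 then (1:ℂ) else 0) = 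
        (D - 1) + (if z = 1 then ((Fintype.card L : ℂ) - 1) * D else 0) := by
      intro z
      have e5 : (∑ y, if T (y * (z - 1)) = 0 ∧ y ≠ 0 then (1:ℂ) else 0) = 
         (∑ y, if T (y * (z - 1)) = 0 then (1:ℂ) else 0) - 1 := by
        have : ∀ y, (if T (y * (z - 1)) = 0 ∧ y ≠ 0 then (1:ℂ) else 0) = 
          (if T (y * (z - 1)) = 0 then (1:ℂ) else 0) - (if y = 0 then 1 else 0) := by
          intro y
          by_cases hy : y = 0
          · simp [hy]
          · simp [hy]
        simp only [this, Finset.sum_sub_distrib]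
        simp
      rw [e5]
      by_cases hz : z = 1
      · subst hz
        simp [hD]
        ring
      · have hz' : z - 1 ≠ 0 := sub_ne_zero.mpr hz
        rw [if_neg hz, add_zero]
        congr 1
        rw [← aux_fiber L K T hT D hD 0, ← Equiv.sum_comp (Equiv.mulRight₀ (z-1) hz').symm]
        simp [hz']
    simp only [e4, mul_add, Finset.sum_add_distrib, ← Finset.sum_mul, MulChar.sum_eq_zero_of_ne_one hχ]
    simp
  exact_mod_cast hC

theorem SS_bound (hT : T ≠ 0) (D : ℕ) (hD : Fintype.card K = Fintype.card L * D) (hχ : χ ≠ 1)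
    (β : L) (hβ : β ≠ 0) : ‖SS L K T χ β‖ ^ 2 ≤ D := by
  have h := SS_total L K T χ hT D hD hχ
  have h1 : ∀ b ∈ Finset.univ.erase (0:L), ‖SS L K T χ b‖ ^ 2 = ‖SS L K T χ β‖ ^ 2 := by
    intro b hb
    have hb0 : b ≠ 0 := Finset.ne_of_mem_erase hb
    have := SS_scale L K T χ (b / β) β (div_ne_zero hb0 hβ)
    rw [div_mul_cancel₀ _ hβ] at this
    rw [this, norm_mul, aux_norm1, one_mul]
    simp [hb0, hβ]
  rw [← Finset.add_sum_erase _ _ (Finset.mem_univ (0:L)), Finset.sum_congr rfl h1] at h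
  have h2 : (2:ℝ) ≤ Fintype.card L := by exact_mod_cast Fintype.one_lt_card
  rw [Finset.sum_const, Finset.card_erase_of_mem (Finset.mem_univ _), Finset.card_univ, nsmul_eq_mul,
    Nat.cast_sub Fintype.card_pos, Nat.cast_one] at h
  have h3 : ((Fintype.card L:ℝ) - 1) * ‖SS L K T χ β‖ ^ 2 ≤ ((Fintype.card L:ℝ) - 1) * D := by
    nlinarith [sq_nonneg ‖SS L K T χ 0‖]
  exact le_of_mul_le_mul_left h3 (by linarith)

theorem SS_bound2 (hT : T ≠ 0) (D : ℕ) (hD : Fintype.card K = Fintype.card L * D) (hχ : χ ≠ 1)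
    (hL : ∀ c : L, c ≠ 0 → χ (algebraMap L K c) = 1)
    (β : L) (hβ : β ≠ 0) : Fintype.card L * ‖SS L K T χ β‖ ^ 2 = D := by
  have h := SS_total L K T χ hT D hD hχ
  have h1 : ∀ b ∈ Finset.univ.erase (0:L), SS L K T χ b = SS L K T χ β := by
    intro b hb
    have hb0 : b ≠ 0 := Finset.ne_of_mem_erase hb
    have := SS_scale L K T χ (b / β) β (div_ne_zero hb0 hβ)
    rwa [div_mul_cancel₀ _ hβ, hL _ (div_ne_zero hb0 hβ), one_mul] at this
  have h2 : (2:ℝ) ≤ Fintype.card L := by exact_mod_cast Fintype.one_lt_card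
  have hs : ∑ b, SS L K T χ b = 0 := by
    rw [← MulChar.sum_eq_zero_of_ne_one hχ]
    unfold SS
    exact Finset.sum_fiberwise _ _ _
  rw [← Finset.add_sum_erase _ _ (Finset.mem_univ (0:L)), Finset.sum_congr rfl h1] at hs
  rw [← Finset.add_sum_erase _ _ (Finset.mem_univ (0:L)), 
    Finset.sum_congr rfl (fun b hb => by rw [h1 b hb])] at h
  rw [Finset.sum_const, Finset.card_erase_of_mem (Finset.mem_univ _), Finset.card_univ, nsmul_eq_mul,
    Nat.cast_sub Fintype.card_pos, Nat.cast_one] at h hs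
  have h0 : SS L K T χ 0 = - (((Fintype.card L : ℝ) - 1 : ℝ) : ℂ) * SS L K T χ β := by
    push_cast
    linear_combination hs
  rw [h0, norm_mul, norm_neg, Complex.norm_real, Real.norm_of_nonneg (by linarith)] at h
  have h3 : ((Fintype.card L:ℝ) - 1) * (Fintype.card L * ‖SS L K T χ β‖ ^ 2) = ((Fintype.card L:ℝ) - 1) * D := by
    linarith
  exact mul_left_cancel₀ (by linarith) h3

def AA (χ : ℕ → MulChar K ℂ) (P : Finset ℕ) (x : K) : ℂ :=
  ∏ l ∈ P, (1 - (1 / (l : ℂ)) * ∑ j ∈ Finset.range l, (χ l ^ j) x)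

def EE (χ : ℕ → MulChar K ℂ) (P : Finset ℕ) (β : L) (ψ : MulChar K ℂ) : ℂ :=
  ∑ x with T x = β, ψ x * AA K χ P x

theorem EE_insert (χ : ℕ → MulChar K ℂ) (P : Finset ℕ) (β : L) (ψ : MulChar K ℂ) (l : ℕ) (hl : l ∉ P)
    (hl1 : 1 ≤ l) :
    EE L K T χ (insert l P) β ψ = (1 - 1 / (l:ℂ)) * EE L K T χ P β ψ - 
      (1 / (l : ℂ)) * ∑ j ∈ Finset.Ico 1 l, EE L K T χ P β (ψ * χ l ^ j) := by
  have h1 : EE L K T χ (insert l P) β ψ = EE L K T χ P β ψ - 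
      (1 / (l : ℂ)) * ∑ j ∈ Finset.range l, EE L K T χ P β (ψ * χ l ^ j) := by
    unfold EE
    rw [Finset.sum_comm, Finset.mul_sum, ← Finset.sum_sub_distrib]
    refine Finset.sum_congr rfl fun x _ => ?_
    unfold AA
    rw [Finset.prod_insert hl]
    simp only [MulChar.mul_apply]
    rw [← Finset.sum_mul, ← Finset.mul_sum]
    ring
  rw [h1, Finset.range_eq_Ico, Finset.sum_eq_sum_Ico_succ_bot (by omega)]
  simp only [pow_zero, mul_one, zero_add]
  ring

theorem aux_order (ψ χ : MulChar K ℂ) (l j : ℕ) (hl : l.Prime) (hχ : orderOf χ = l)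
    (hj : j ∈ Finset.Ico 1 l) (hc : l.Coprime (orderOf ψ)) :
    orderOf (ψ * χ ^ j) = orderOf ψ * l := by
  have h1 : orderOf (χ ^ j) = l := by
    rw [Finset.mem_Ico] at hj
    rw [orderOf_pow, hχ, Nat.Coprime.gcd_eq_one, Nat.div_one]
    exact Nat.coprime_of_lt_prime (by omega) hj.2 hl
  rw [(Commute.all ψ (χ ^ j)).orderOf_mul_eq_mul_orderOf_of_coprime (by rw [h1]; exact hc.symm), h1]

theorem EE_bound (χ : ℕ → MulChar K ℂ) (hT : T ≠ 0) (D : ℕ) (hD : Fintype.card K = Fintype.card L * D)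
    (β : L) (hβ : β ≠ 0) (P : Finset ℕ) (hP : ∀ l ∈ P, l.Prime ∧ orderOf (χ l) = l) :
    (∀ ψ : MulChar K ℂ, ψ ≠ 1 → (∀ l ∈ P, l.Coprime (orderOf ψ)) →
      ‖EE L K T χ P β ψ‖ ≤ (∏ l ∈ P, (1 - 1 / (l:ℝ))) * (2 ^ P.card * √D)) ∧
    ‖EE L K T χ P β 1 - (((∏ l ∈ P, (1 - 1 / (l:ℝ)) : ℝ)) : ℂ) * D‖ ≤
      (∏ l ∈ P, (1 - 1 / (l:ℝ))) * ((2 ^ P.card - 1) * √D) := by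
  induction P using Finset.induction_on with
  | empty =>
    constructor
    · intro ψ hψ _
      have h := SS_bound L K T ψ hT D hD hψ β hβ
      have h2 : EE L K T χ ∅ β ψ = SS L K T ψ β := by
        simp [EE, SS, AA]
      rw [h2]
      simp only [Finset.prod_empty, Finset.card_empty, pow_zero, one_mul]
      exact Real.le_sqrt_of_sq_le h
    · have h2 : EE L K T χ ∅ β 1 = D := by
        simp only [EE, AA, Finset.prod_empty, mul_one]
        rw [← aux_fiber L K T hT D hD β, Finset.sum_congr rfl (g := fun _ => (1:ℂ))]
        · simp
        · intro x hx
          simp only [Finset.mem_filter, Finset.mem_univ, true_and] at hx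
          apply MulChar.one_apply
          apply Ne.isUnit
          rintro rfl
          exact hβ (by rw [← hx, map_zero])
      simp [h2]
  | insert l P hl ih =>
    obtain ⟨ih1, ih2⟩ := ih (fun l' h' => hP l' (Finset.mem_insert_of_mem h'))
    obtain ⟨hlp, hlo⟩ := hP l (Finset.mem_insert_self _ _)
    have hl1 : (1:ℝ) ≤ l := by exact_mod_cast hlp.one_le
    have hl0 : (0:ℝ) < l := by linarith
    set θ : ℝ := ∏ l ∈ P, (1 - 1 / (l:ℝ)) with hθ
    set B : ℝ := 2 ^ P.card * √D with hB
    have hl2 : (0:ℝ) ≤ 1 - 1 / (l:ℝ) := by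
      rw [sub_nonneg, div_le_one hl0]; exact hl1
    have hcop : ∀ l' ∈ P, l'.Coprime l := fun l' h' =>
      (Nat.coprime_primes (hP l' (Finset.mem_insert_of_mem h')).1 hlp).mpr (by rintro rfl; exact hl h')
    have htail : ∀ ψ : MulChar K ℂ, (∀ l' ∈ insert l P, l'.Coprime (orderOf ψ)) →
        ‖(1 / (l : ℂ)) * ∑ j ∈ Finset.Ico 1 l, EE L K T χ P β (ψ * χ l ^ j)‖ ≤ 
          (1 - 1 / (l:ℝ)) * (θ * B) := by
      intro ψ hψ
      have h1 : ‖∑ j ∈ Finset.Ico 1 l, EE L K T χ P β (ψ * χ l ^ j)‖ ≤ ((l:ℝ) - 1) * (θ * B) := by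
        refine (norm_sum_le _ _).trans ?_
        refine (Finset.sum_le_card_nsmul _ _ (θ * B) ?_).trans ?_
        · intro j hj
          have ho := aux_order K ψ (χ l) l j hlp hlo hj (hψ l (Finset.mem_insert_self _ _))
          apply ih1
          · intro h
            rw [h, orderOf_one] at ho
            exact hlp.one_lt.ne' (Nat.eq_one_of_mul_eq_one_left ho.symm)
          · intro l' h'
            rw [ho]
            exact (hψ l' (Finset.mem_insert_of_mem h')).mul_right (hcop l' h')
        · rw [Nat.card_Ico, nsmul_eq_mul, Nat.cast_sub hlp.one_le, Nat.cast_one]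
      rw [norm_mul]
      have h2 : ‖(1 / (l : ℂ))‖ = 1 / (l:ℝ) := by simp
      rw [h2]
      calc 1 / (l:ℝ) * _ ≤ 1 / (l:ℝ) * (((l:ℝ) - 1) * (θ * B)) := by gcongr
        _ = _ := by field_simp
    have hnl : ‖(1 - 1 / (l:ℂ))‖ = 1 - 1 / (l:ℝ) := by
      have : (1 - 1 / (l:ℂ)) = ((1 - 1 / (l:ℝ) : ℝ) : ℂ) := by push_cast; rfl
      rw [this, Complex.norm_real, Real.norm_of_nonneg hl2]
    rw [Finset.prod_insert hl, Finset.card_insert_of_notMem hl]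
    constructor
    · intro ψ hψ hψc
      rw [EE_insert L K T χ P β ψ l hl hlp.one_le]
      refine (norm_sub_le _ _).trans ?_
      have h1 := htail ψ hψc
      have h2 := ih1 ψ hψ (fun l' h' => hψc l' (Finset.mem_insert_of_mem h'))
      rw [norm_mul, hnl]
      calc _ ≤ (1 - 1 / (l:ℝ)) * (θ * B) + (1 - 1 / (l:ℝ)) * (θ * B) := by gcongr
        _ = _ := by rw [hB]; ring
    · rw [EE_insert L K T χ P β 1 l hl hlp.one_le]
      have h1 := htail 1 (by intro l' _; simp)
      have e : (1 - 1 / (l:ℂ)) * EE L K T χ P β 1 - 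
          (1 / (l : ℂ)) * ∑ j ∈ Finset.Ico 1 l, EE L K T χ P β (1 * χ l ^ j) - 
            (((1 - 1 / (l:ℝ)) * θ : ℝ) : ℂ) * D = 
          (1 - 1 / (l:ℂ)) * (EE L K T χ P β 1 - (θ : ℂ) * D) - 
          (1 / (l : ℂ)) * ∑ j ∈ Finset.Ico 1 l, EE L K T χ P β (1 * χ l ^ j) := by
        push_cast
        ring
      rw [e]
      refine (norm_sub_le _ _).trans ?_
      rw [norm_mul, hnl]
      calc _ ≤ (1 - 1 / (l:ℝ)) * (θ * ((2 ^ P.card - 1) * √D)) + (1 - 1 / (l:ℝ)) * (θ * B) := by gcongr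
        _ = _ := by rw [hB]; ring

theorem exists_good (χ : ℕ → MulChar K ℂ) (hT : T ≠ 0) (D : ℕ) (hD : Fintype.card K = Fintype.card L * D)
    (β : L) (hβ : β ≠ 0) (P : Finset ℕ) (hP : ∀ l ∈ P, l.Prime ∧ orderOf (χ l) = l)
    (hW : (2 ^ P.card) ^ 2 ≤ D) : ∃ x : K, T x = β ∧ ∀ l ∈ P, χ l x ≠ 1 := by
  by_contra! hcon
  have hE : EE L K T χ P β 1 = 0 := by
    unfold EE
    apply Finset.sum_eq_zero
    intro x hx
    simp only [Finset.mem_filter, Finset.mem_univ, true_and] at hx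
    obtain ⟨l, hl, hlx⟩ := hcon x hx
    have hx0 : x ≠ 0 := by
      rintro rfl
      exact hβ (by rw [← hx, map_zero])
    have : AA K χ P x = 0 := by
      unfold AA
      apply Finset.prod_eq_zero hl
      have : ∀ j ∈ Finset.range l, (χ l ^ j) x = 1 := by
        intro j _
        have := MulChar.pow_apply_coe (χ l) j (Units.mk0 x hx0)
        simpa [hlx] using this
      rw [Finset.sum_congr rfl this]
      have := (hP l hl).1.ne_zero
      simp [this]
    rw [this, mul_zero]
  have h := (EE_bound L K T χ hT D hD β hβ P hP).2
  set θ : ℝ := ∏ l ∈ P, (1 - 1 / (l:ℝ)) with hθ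
  have hθ0 : 0 < θ := by
    apply Finset.prod_pos
    intro l hl
    have : (1:ℝ) < l := by exact_mod_cast (hP l hl).1.one_lt
    rw [sub_pos, div_lt_one (by linarith)]
    exact this
  rw [hE, zero_sub, norm_neg, norm_mul, Complex.norm_real, Real.norm_of_nonneg hθ0.le,
    Complex.norm_natCast] at h
  have h2 := le_of_mul_le_mul_left h hθ0
  have hD1 : (1:ℝ) ≤ D := by
    exact_mod_cast (Nat.one_le_iff_ne_zero.mpr (by positivity)).trans hW
  have h3 : (2:ℝ) ^ P.card ≤ √D := by
    apply Real.le_sqrt_of_sq_le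
    exact_mod_cast hW
  have h4 : √(D:ℝ) * √D = D := Real.mul_self_sqrt (by linarith)
  have h5 : 0 < √(D:ℝ) := Real.sqrt_pos.mpr (by linarith)
  nlinarith

theorem bad_bound (χ : MulChar K ℂ) (hT : T ≠ 0) (D : ℕ) (hD : Fintype.card K = Fintype.card L * D)
    (β : L) (hβ : β ≠ 0) (l : ℕ) (hl : l.Prime) (ho : orderOf χ = l) (s : ℝ)
    (hs : ∀ j ∈ Finset.Ico 1 l, ‖SS L K T (χ ^ j) β‖ ≤ s) [DecidableEq K] :
    (l : ℝ) * (Finset.univ.filter fun x => T x = β ∧ χ x = 1).card ≤ D + (l - 1) * s := by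
  have h1 : ∑ j ∈ Finset.range l, SS L K T (χ ^ j) β = 
      l * (Finset.univ.filter fun x => T x = β ∧ χ x = 1).card := by
    unfold SS
    rw [Finset.sum_comm, ← Finset.filter_filter, Finset.card_filter, Nat.cast_sum, Finset.mul_sum]
    refine Finset.sum_congr rfl fun x hx => ?_
    simp only [Finset.mem_filter, Finset.mem_univ, true_and] at hx
    have hx0 : x ≠ 0 := by
      rintro rfl
      exact hβ (by rw [← hx, map_zero])
    have hpow : ∀ j, (χ ^ j) x = (χ x) ^ j := fun j => 
      MulChar.pow_apply_coe χ j (Units.mk0 x hx0)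
    simp only [hpow]
    split_ifs with h
    · simp [h]
    · have h2 : (χ x) ^ l = 1 := by
        rw [← hpow, ← ho, pow_orderOf_eq_one, MulChar.one_apply (Ne.isUnit hx0)]
      have h3 := mul_geom_sum (χ x) l
      rw [h2, sub_self] at h3
      simpa [sub_eq_zero, h] using h3
  have h0 : SS L K T (χ ^ 0) β = D := by
    unfold SS
    rw [← aux_fiber L K T hT D hD β, Finset.sum_congr rfl (g := fun _ => (1:ℂ))]
    · simp
    · intro x hx
      simp only [Finset.mem_filter, Finset.mem_univ, true_and] at hx
      rw [pow_zero]
      apply MulChar.one_apply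
      apply Ne.isUnit
      rintro rfl
      exact hβ (by rw [← hx, map_zero])
  rw [Finset.range_eq_Ico, Finset.sum_eq_sum_Ico_succ_bot hl.pos, h0, zero_add] at h1
  have h2 : ‖∑ j ∈ Finset.Ico 1 l, SS L K T (χ ^ j) β‖ ≤ (l - 1) * s := by
    refine (norm_sum_le _ _).trans ((Finset.sum_le_card_nsmul _ _ s hs).trans ?_)
    rw [Nat.card_Ico, nsmul_eq_mul, Nat.cast_sub hl.one_le, Nat.cast_one]
  have h3 : (l : ℝ) * (Finset.univ.filter fun x => T x = β ∧ χ x = 1).card = 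
     ‖(D:ℂ) + ∑ j ∈ Finset.Ico 1 l, SS L K T (χ ^ j) β‖ := by
    rw [h1]
    simp
  rw [h3]
  refine (norm_add_le _ _).trans ?_
  rw [Complex.norm_natCast]
  linarith


theorem bad_nat1 (χ : MulChar K ℂ) (hT : T ≠ 0) (t : ℕ) (hQ : Fintype.card L = t * t)
    (hD : Fintype.card K = Fintype.card L * Fintype.card L)
    (β : L) (hβ : β ≠ 0) (l : ℕ) (hl : l.Prime) (ho : orderOf χ = l) [DecidableEq K] :
    l * (Finset.univ.filter fun x => T x = β ∧ χ x = 1).card ≤ t * t + (l - 1) * t := by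
  have h := bad_bound L K T χ hT (Fintype.card L) hD β hβ l hl ho t (by
    intro j hj
    have hne : χ ^ j ≠ 1 := by
      intro h
      have := aux_order K 1 χ l j hl ho hj (by simp)
      rw [one_mul, h, orderOf_one, one_mul] at this
      exact hl.one_lt.ne this
    have h1 := SS_bound L K T (χ ^ j) hT _ hD hne β hβ
    rw [hQ, Nat.cast_mul, ← sq] at h1
    exact (sq_le_sq₀ (norm_nonneg _) (Nat.cast_nonneg _)).mp h1)
  have hl1 : ((l - 1 : ℕ) : ℝ) = (l:ℝ) - 1 := by rw [Nat.cast_sub hl.one_le, Nat.cast_one]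
  rw [hQ, ← hl1] at h
  exact_mod_cast h

theorem bad_nat2 (χ : MulChar K ℂ) (hT : T ≠ 0) (t : ℕ) (hQ : Fintype.card L = t)
    (hD : Fintype.card K = Fintype.card L * Fintype.card L)
    (β : L) (hβ : β ≠ 0) (l : ℕ) (hl : l.Prime) (ho : orderOf χ = l)
    (hc : l.Coprime (t - 1)) [DecidableEq K] :
    l * (Finset.univ.filter fun x => T x = β ∧ χ x = 1).card ≤ t + (l - 1) := by
  have h := bad_bound L K T χ hT (Fintype.card L) hD β hβ l hl ho 1 (by
    intro j hj
    have hne : χ ^ j ≠ 1 := by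
      intro h
      have := aux_order K 1 χ l j hl ho hj (by simp)
      rw [one_mul, h, orderOf_one, one_mul] at this
      exact hl.one_lt.ne this
    have hpos : (0:ℝ) < Fintype.card L := by exact_mod_cast Fintype.card_pos
    have h1 := SS_bound2 L K T (χ ^ j) hT _ hD hne (by
      intro c hc0
      have hc' : algebraMap L K c ≠ 0 := by simpa using hc0
      have hj0 : j ≠ 0 := by rw [Finset.mem_Ico] at hj; omega
      rw [MulChar.pow_apply' _ hj0]
      have e1 : χ (algebraMap L K c) ^ l = 1 := by
        rw [← MulChar.pow_apply' _ hl.ne_zero, ← ho, pow_orderOf_eq_one, MulChar.one_apply (Ne.isUnit hc')]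
      have e2 : χ (algebraMap L K c) ^ (t - 1) = 1 := by
        rw [← map_pow, ← map_pow, ← hQ, FiniteField.pow_card_sub_one_eq_one c hc0, map_one, map_one]
      have e3 := pow_gcd_eq_one.mpr ⟨e1, e2⟩
      rw [hc.gcd_eq_one, pow_one] at e3
      rw [e3, one_pow]) β hβ
    have h2 : ‖SS L K T (χ ^ j) β‖ ^ 2 = 1 := by
      apply mul_left_cancel₀ hpos.ne'
      rw [h1, mul_one]
    nlinarith [norm_nonneg (SS L K T (χ ^ j) β)])
  have hl1 : ((l - 1 : ℕ) : ℝ) = (l:ℝ) - 1 := by rw [Nat.cast_sub hl.one_le, Nat.cast_one]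
  rw [hQ, ← hl1, mul_one] at h
  exact_mod_cast h

theorem exists_good_small (χ : ℕ → MulChar K ℂ) (hT : T ≠ 0)
    (hD : Fintype.card K = Fintype.card L * Fintype.card L)
    (hQ : Fintype.card L = 4 ∨ Fintype.card L = 16 ∨ Fintype.card L = 64)
    (hP : ∀ l, l.Prime → l ∣ Fintype.card K - 1 → orderOf (χ l) = l)
    (β : L) (hβ : β ≠ 0) : ∃ x : K, T x = β ∧ ∀ l, l.Prime → l ∣ Fintype.card K - 1 → χ l x ≠ 1 := by
  classical
  by_contra! hcon
  have hfib := aux_fiber L K T hT _ hD β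
  have hun : ∀ P : Finset ℕ, (∀ l, l.Prime → l ∣ Fintype.card K - 1 → l ∈ P) →
      Fintype.card L ≤ ∑ l ∈ P, (Finset.univ.filter fun x => T x = β ∧ χ l x = 1).card := by
    intro P hPP
    rw [← hfib]
    refine le_trans (Finset.card_le_card ?_) (Finset.card_biUnion_le)
    intro x hx
    simp only [Finset.mem_filter, Finset.mem_univ, true_and] at hx
    obtain ⟨l, hl, hld, hlx⟩ := hcon x hx
    simp only [Finset.mem_biUnion, Finset.mem_filter, Finset.mem_univ, true_and]
    exact ⟨l, hPP l hl hld, hx, hlx⟩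
  rcases hQ with hQ | hQ | hQ
  · have hK : Fintype.card K - 1 = 3 * 5 := by rw [hD, hQ]
    have hu := hun {3, 5} (by
      intro l hl hd
      rw [hK, hl.dvd_mul, Nat.prime_dvd_prime_iff_eq hl (by norm_num),
        Nat.prime_dvd_prime_iff_eq hl (by norm_num)] at hd
      simpa using hd)
    have h3 := bad_nat1 L K T (χ 3) hT 2 hQ hD β hβ 3 (by norm_num) (hP 3 (by norm_num) (by rw [hK]; norm_num))
    have h5 := bad_nat2 L K T (χ 5) hT 4 hQ hD β hβ 5 (by norm_num) (hP 5 (by norm_num) (by rw [hK]; norm_num)) (by norm_num)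
    rw [Finset.sum_pair (by norm_num), hQ] at hu
    omega
  · have hK : Fintype.card K - 1 = 3 * (5 * 17) := by rw [hD, hQ]
    have hu := hun {3, 5, 17} (by
      intro l hl hd
      rw [hK, hl.dvd_mul, hl.dvd_mul, Nat.prime_dvd_prime_iff_eq hl (by norm_num),
        Nat.prime_dvd_prime_iff_eq hl (by norm_num), Nat.prime_dvd_prime_iff_eq hl (by norm_num)] at hd
      simpa using hd)
    have h3 := bad_nat1 L K T (χ 3) hT 4 hQ hD β hβ 3 (by norm_num) (hP 3 (by norm_num) (by rw [hK]; norm_num))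
    have h5 := bad_nat1 L K T (χ 5) hT 4 hQ hD β hβ 5 (by norm_num) (hP 5 (by norm_num) (by rw [hK]; norm_num))
    have h17 := bad_nat2 L K T (χ 17) hT 16 hQ hD β hβ 17 (by norm_num) (hP 17 (by norm_num) (by rw [hK]; norm_num)) (by norm_num)
    rw [Finset.sum_insert (by norm_num), Finset.sum_pair (by norm_num), hQ] at hu
    omega
  · have hK : Fintype.card K - 1 = 3 * (3 * (5 * (7 * 13))) := by rw [hD, hQ]
    have hu := hun {3, 5, 7, 13} (by
      intro l hl hd
      rw [hK, hl.dvd_mul, hl.dvd_mul, hl.dvd_mul, hl.dvd_mul, Nat.prime_dvd_prime_iff_eq hl (by norm_num),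
        Nat.prime_dvd_prime_iff_eq hl (by norm_num), Nat.prime_dvd_prime_iff_eq hl (by norm_num),
        Nat.prime_dvd_prime_iff_eq hl (by norm_num)] at hd
      simp only [Finset.mem_insert, Finset.mem_singleton]
      tauto)
    have h3 := bad_nat1 L K T (χ 3) hT 8 hQ hD β hβ 3 (by norm_num) (hP 3 (by norm_num) (by rw [hK]; norm_num))
    have h7 := bad_nat1 L K T (χ 7) hT 8 hQ hD β hβ 7 (by norm_num) (hP 7 (by norm_num) (by rw [hK]; norm_num))
    have h5 := bad_nat2 L K T (χ 5) hT 64 hQ hD β hβ 5 (by norm_num) (hP 5 (by norm_num) (by rw [hK]; norm_num)) (by norm_num)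
    have h13 := bad_nat2 L K T (χ 13) hT 64 hQ hD β hβ 13 (by norm_num) (hP 13 (by norm_num) (by rw [hK]; norm_num)) (by norm_num)
    rw [Finset.sum_insert (by norm_num), Finset.sum_insert (by norm_num), Finset.sum_pair (by norm_num), hQ] at hu
    omega

theorem exists_chars : ∃ χ : ℕ → MulChar K ℂ, 
    ∀ l, l.Prime → l ∣ Fintype.card K - 1 → orderOf (χ l) = l := by
  have : ∀ l : ℕ, ∃ χ : MulChar K ℂ, l.Prime → l ∣ Fintype.card K - 1 → orderOf χ = l := by
    intro l
    by_cases h : l.Prime ∧ l ∣ Fintype.card K - 1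
    · obtain ⟨χ, hχ⟩ := MulChar.exists_mulChar_orderOf K h.2 (Complex.isPrimitiveRoot_exp l h.1.ne_zero)
      exact ⟨χ, fun _ _ => hχ⟩
    · exact ⟨1, fun h1 h2 => (h ⟨h1, h2⟩).elim⟩
  choose χ hχ using this
  exact ⟨χ, hχ⟩

theorem aux_prim (x : K) (hx : x ≠ 0) (χ : ℕ → MulChar K ℂ)
    (hP : ∀ l, l.Prime → l ∣ Fintype.card K - 1 → orderOf (χ l) = l)
    (h : ∀ l, l.Prime → l ∣ Fintype.card K - 1 → χ l x ≠ 1) :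
    ∀ b : K, b ≠ 0 → ∃ m : ℕ, x ^ m = b := by
  classical
  obtain ⟨g, hg⟩ := IsCyclic.exists_generator (α := Kˣ)
  have hgo : orderOf g = Fintype.card K - 1 := by
    rw [orderOf_eq_card_of_forall_mem_zpowers hg, Nat.card_eq_fintype_card, Fintype.card_units]
  have hpow : ∀ u : Kˣ, ∃ a : ℕ, g ^ a = u := by
    intro u
    have := hg u
    rw [← mem_powers_iff_mem_zpowers] at this
    exact this
  obtain ⟨a, ha⟩ := hpow (Units.mk0 x hx)
  have hco : (orderOf g).Coprime a := by
    rw [hgo]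
    apply Nat.coprime_of_dvd
    intro l hl h1 h2
    obtain ⟨a', rfl⟩ := h2
    apply h l hl h1
    have hx' : x = ((g ^ a' : Kˣ) : K) ^ l := by
      have := congrArg Units.val ha
      rw [Units.val_mk0] at this
      rw [← this, mul_comm, pow_mul, Units.val_pow_eq_pow_val]
    rw [hx', map_pow, ← MulChar.pow_apply_coe]
    have e := pow_orderOf_eq_one (χ l)
    rw [hP l hl h1] at e
    rw [e, MulChar.one_apply_coe]
  have hu : ∀ u : Kˣ, u ∈ Subgroup.zpowers (Units.mk0 x hx) := by
    have hord : orderOf (Units.mk0 x hx) = orderOf g := by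
      rw [← ha, orderOf_pow, hco.gcd_eq_one, Nat.div_one]
    have : Subgroup.zpowers (Units.mk0 x hx) = ⊤ := by
      apply Subgroup.eq_top_of_card_eq
      rw [Nat.card_zpowers, hord, hgo, Nat.card_eq_fintype_card, Fintype.card_units]
    intro u
    rw [this]
    trivial
  intro b hb
  have := hu (Units.mk0 b hb)
  rw [← mem_powers_iff_mem_zpowers] at this
  obtain ⟨m, hm⟩ := this
  refine ⟨m, ?_⟩
  have := congrArg Units.val hm
  simpa using this

end


theorem aux_W (c : ℕ) (A S : Finset ℕ) (hA : ∀ l ∈ A, 1 ≤ l ∧ l ≤ c) (hS : ∀ l ∈ S, l ∉ A → c ≤ l) :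
    (∏ l ∈ A, l) * c ^ S.card ≤ c ^ A.card * ∏ l ∈ S, l := by
  classical
  rw [← Finset.prod_inter_mul_prod_sdiff A S, ← Finset.prod_inter_mul_prod_sdiff S A,
    ← Finset.card_inter_add_card_sdiff S A, ← Finset.card_inter_add_card_sdiff A S, pow_add, pow_add,
    Finset.inter_comm S A]
  have h1 : ∏ l ∈ A \ S, l ≤ c ^ (A \ S).card := by
    apply Finset.prod_le_pow_card
    intro l hl
    exact (hA l (Finset.mem_sdiff.mp hl).1).2
  have h2 : c ^ (S \ A).card ≤ ∏ l ∈ S \ A, l := by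
    apply Finset.pow_card_le_prod
    intro l hl
    exact hS l (Finset.mem_sdiff.mp hl).1 (Finset.mem_sdiff.mp hl).2
  calc _ = (∏ l ∈ A ∩ S, l) * c ^ (A ∩ S).card * ((∏ l ∈ A \ S, l) * c ^ (S \ A).card) := by ring
    _ ≤ (∏ l ∈ A ∩ S, l) * c ^ (A ∩ S).card * (c ^ (A \ S).card * ∏ l ∈ S \ A, l) := by gcongr
    _ = _ := by ring

theorem aux_W4 (N : ℕ) (hN : N ≠ 0) : 16 ^ N.primeFactors.card ≤ 559 * N := by
  have h := aux_W 16 {2,3,5,7,11,13} N.primeFactors (by decide) (by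
    intro l hl hn
    by_contra hc
    have hp := Nat.prime_of_mem_primeFactors hl
    have : l < 16 := by omega
    interval_cases l <;> first | (simp at hn; done) | (revert hp; norm_num; done))
  have h1 : ∏ l ∈ ({2,3,5,7,11,13} : Finset ℕ), l = 30030 := by decide
  have h2 : ({2,3,5,7,11,13} : Finset ℕ).card = 6 := by decide
  rw [h1, h2] at h
  have h3 := Nat.le_of_dvd (Nat.pos_of_ne_zero hN) (Nat.prod_primeFactors_dvd N)
  omega

theorem aux_W5 (N : ℕ) (hN : N ≠ 0) (hodd : ¬ 2 ∣ N) : 32 ^ N.primeFactors.card ≤ 11228 * N := by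
  have h := aux_W 32 {3,5,7,11,13,17,19,23,29,31} N.primeFactors (by decide) (by
    intro l hl hn
    by_contra hc
    have hp := Nat.prime_of_mem_primeFactors hl
    have hd := Nat.dvd_of_mem_primeFactors hl
    have : l < 32 := by omega
    interval_cases l <;> first | (simp at hn; done) | (exact hodd hd) | (revert hp; norm_num; done))
  have h1 : ∏ l ∈ ({3,5,7,11,13,17,19,23,29,31} : Finset ℕ), l = 100280245065 := by decide
  have h2 : ({3,5,7,11,13,17,19,23,29,31} : Finset ℕ).card = 10 := by decide
  rw [h1, h2] at h
  have h3 := Nat.le_of_dvd (Nat.pos_of_ne_zero hN) (Nat.prod_primeFactors_dvd N)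
  norm_num at h
  omega

theorem aux_list (N k : ℕ) (ps : List ℕ) (hps : ∀ l ∈ ps, l.Prime) (hd : N ∣ ps.prod ^ k) :
    N.primeFactors.card ≤ ps.length := by
  refine (Finset.card_le_card (t := ps.toFinset) ?_).trans (List.toFinset_card_le _)
  intro l hl
  have hp := Nat.prime_of_mem_primeFactors hl
  have h1 := hp.dvd_of_dvd_pow ((Nat.dvd_of_mem_primeFactors hl).trans hd)
  rw [hp.prime.dvd_prod_iff] at h1
  obtain ⟨a, ha, hla⟩ := h1
  rw [Nat.prime_dvd_prime_iff_eq hp (hps a ha)] at hla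
  rw [List.mem_toFinset, hla]
  exact ha

theorem aux_arith2 (j : ℕ) (hj : 4 ≤ j) : 
    (2 ^ ((4 ^ j) ^ 2 - 1).primeFactors.card) ^ 2 ≤ 4 ^ j := by
  have hred : ∀ w, w ≤ j → (2 ^ w) ^ 2 ≤ 4 ^ j := by
    intro w hw
    rw [← pow_mul, mul_comm, pow_mul]
    exact Nat.pow_le_pow_right (by norm_num) hw
  by_cases hj14 : 14 ≤ j
  · set Q := 4 ^ j with hQ
    have hQ1 : 268435456 ≤ Q := by
      calc 268435456 = 4 ^ 14 := by norm_num
        _ ≤ 4 ^ j := Nat.pow_le_pow_right (by norm_num) hj14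
    have hev : 2 ∣ Q ^ 2 := by
      apply dvd_pow _ (by norm_num)
      exact dvd_pow (by norm_num) (by omega)
    have hpos : 1 ≤ Q ^ 2 := Nat.one_le_pow _ _ (by omega)
    have hQ2 : 2 ≤ Q ^ 2 := by nlinarith
    have h := aux_W5 (Q ^ 2 - 1) (by omega) (by omega)
    set w := (Q ^ 2 - 1).primeFactors.card
    have h1 : 32 ^ w ≤ 11228 * Q ^ 2 := h.trans (Nat.mul_le_mul_left _ (by omega))
    have h2 : ((2 ^ w) ^ 2) ^ 5 ≤ Q ^ 5 := by
      calc ((2 ^ w) ^ 2) ^ 5 = (32 ^ w) ^ 2 := by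
            rw [show 32 = 2 ^ 5 by norm_num]; simp only [← pow_mul]; congr 1; ring
        _ ≤ (11228 * Q ^ 2) ^ 2 := Nat.pow_le_pow_left h1 2
        _ = 126067984 * Q ^ 4 := by ring
        _ ≤ Q * Q ^ 4 := Nat.mul_le_mul_right _ (by omega)
        _ = Q ^ 5 := by ring
    exact (Nat.pow_le_pow_iff_left (by norm_num)).mp h2
  · apply hred
    interval_cases j
    · exact (aux_list _ 3 [3, 5, 17, 257] (by norm_num) (by norm_num)).trans (by simp)
    · exact (aux_list _ 3 [3, 5, 11, 31, 41] (by norm_num) (by norm_num)).trans (by simp)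
    · exact (aux_list _ 3 [3, 5, 7, 13, 17, 241] (by norm_num) (by norm_num)).trans (by simp)
    · exact (aux_list _ 3 [3, 5, 29, 43, 113, 127] (by norm_num) (by norm_num)).trans (by simp)
    · exact (aux_list _ 3 [3, 5, 17, 257, 65537] (by norm_num) (by norm_num)).trans (by simp)
    · exact (aux_list _ 3 [3, 5, 7, 13, 19, 37, 73, 109] (by norm_num) (by norm_num)).trans (by simp)
    · exact (aux_list _ 3 [3, 5, 11, 17, 31, 41, 61681] (by norm_num) (by norm_num)).trans (by simp)
    · exact (aux_list _ 3 [3, 5, 23, 89, 397, 683, 2113] (by norm_num) (by norm_num)).trans (by simp)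
    · exact (aux_list _ 3 [3, 5, 7, 13, 17, 97, 241, 257, 673] (by norm_num) (by norm_num)).trans (by simp)
    · exact (aux_list _ 3 [3, 5, 53, 157, 1613, 2731, 8191] (by norm_num) (by norm_num)).trans (by simp)

theorem aux_arith3 (p j : ℕ) (hp : p.Prime) (hp3 : 3 ≤ p) (hj : 1 ≤ j) : 
    (2 ^ (((p ^ p) ^ j) ^ p - 1).primeFactors.card) ^ 2 ≤ ((p ^ p) ^ j) ^ (p - 1) := by
  by_cases hs : p = 3 ∧ j = 1
  · obtain ⟨rfl, rfl⟩ := hs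
    have := aux_list (((3 ^ 3) ^ 1) ^ 3 - 1) 3 [2, 13, 757] (by norm_num) (by norm_num)
    calc _ ≤ (2 ^ 3) ^ 2 := by
          apply Nat.pow_le_pow_left
          exact Nat.pow_le_pow_right (by norm_num) this
      _ ≤ _ := by norm_num
  · have hQ : 559 ≤ (p ^ p) ^ j := by
      by_cases hp5 : 5 ≤ p
      · calc 559 ≤ 5 ^ 5 := by norm_num
          _ ≤ p ^ 5 := Nat.pow_le_pow_left hp5 5
          _ ≤ p ^ p := Nat.pow_le_pow_right (by omega) hp5
          _ = (p ^ p) ^ 1 := by rw [pow_one]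
          _ ≤ (p ^ p) ^ j := Nat.pow_le_pow_right (Nat.pos_of_ne_zero (by positivity)) hj
      · have : p = 3 := by
          have : p ≠ 4 := by rintro rfl; norm_num at hp
          omega
        subst this
        calc 559 ≤ (3 ^ 3) ^ 2 := by norm_num
          _ ≤ (3 ^ 3) ^ j := Nat.pow_le_pow_right (by norm_num) (by omega)
    set Q := (p ^ p) ^ j
    obtain ⟨r, rfl⟩ : ∃ r, p = r + 3 := ⟨p - 3, by omega⟩
    have hQ2 : 2 ≤ Q ^ (r + 3) := by
      calc 2 ≤ Q := by omega
        _ = Q ^ 1 := by rw [pow_one]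
        _ ≤ _ := Nat.pow_le_pow_right (by omega) (by omega)
    have h := aux_W4 (Q ^ (r + 3) - 1) (by omega)
    set w := (Q ^ (r + 3) - 1).primeFactors.card
    have h1 : 16 ^ w ≤ 559 * Q ^ (r + 3) := h.trans (Nat.mul_le_mul_left _ (by omega))
    have h2 : ((2 ^ w) ^ 2) ^ 2 ≤ (Q ^ (r + 3 - 1)) ^ 2 := by
      calc ((2 ^ w) ^ 2) ^ 2 = 16 ^ w := by
            rw [show 16 = 2 ^ 4 by norm_num]; simp only [← pow_mul]; congr 1; ring
        _ ≤ 559 * Q ^ (r + 3) := h1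
        _ ≤ Q * Q ^ (r + 3) := Nat.mul_le_mul_right _ hQ
        _ = Q ^ (r + 4) := by ring
        _ ≤ Q ^ ((r + 3 - 1) * 2) := Nat.pow_le_pow_right (by omega) (by omega)
        _ = _ := by rw [pow_mul]
    exact (Nat.pow_le_pow_iff_left (by norm_num)).mp h2

/-- If `p² ∣ n`, there is a primitive `1`-normal element of `F_{qⁿ}` over `F_q`. -/
theorem stmt_12 (p e q n : ℕ) (hp : p.Prime) (he : 0 < e) (hq : q = p ^ e)
    (hn : 0 < n) (hdvd : p ^ 2 ∣ n)
    (F K : Type) [Field F] [Fintype F] [Field K] [Fintype K] [Algebra F K]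
    (hcF : Fintype.card F = q) (hrK : Module.finrank F K = n) :
    ∃ α : K, IsPrimitiveElt α ∧ IskNormal q n 1 F α := by
  classical
  obtain ⟨m', hm'⟩ := hdvd
  have hm'0 : 0 < m' := by
    rcases Nat.eq_zero_or_pos m' with h | h
    · subst h; omega
    · exact h
  obtain ⟨M, hcM, hrM, β, hβ, hnorm⟩ := aux_normal_s12 p e q n (p * m') hp hq
    (Nat.mul_pos hp.pos hm'0) (Dvd.intro _ rfl) (by rw [hm']; ring) F K hcF hrK
  letI : Fintype M := Fintype.ofFinite M
  have hQ : Fintype.card M = (p ^ p) ^ (e * m') := by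
    rw [← Nat.card_eq_fintype_card, hcM, hq, ← pow_mul, ← pow_mul]
    congr 1; ring
  have hj : 1 ≤ e * m' := Nat.mul_pos he hm'0
  generalize e * m' = j at hQ hj
  have hK : Fintype.card K = Fintype.card M ^ p := by
    rw [← hrM]; exact Module.card_eq_pow_finrank
  have hD : Fintype.card K = Fintype.card M * Fintype.card M ^ (p - 1) := by
    rw [hK, ← pow_succ']; congr 1; have := hp.pos; omega
  have hT : Algebra.trace M K ≠ 0 := Algebra.trace_ne_zero M K
  obtain ⟨χ, hχ⟩ := exists_chars K
  have key : ∃ x : K, Algebra.trace M K x = β ∧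
      ∀ l, l.Prime → l ∣ Fintype.card K - 1 → χ l x ≠ 1 := by
    have big : (2 ^ (Fintype.card K - 1).primeFactors.card) ^ 2 ≤ Fintype.card M ^ (p - 1) →
        ∃ x : K, Algebra.trace M K x = β ∧
        ∀ l, l.Prime → l ∣ Fintype.card K - 1 → χ l x ≠ 1 := by
      intro hW
      have h1 : Fintype.card K - 1 ≠ 0 := by
        have := Fintype.one_lt_card (α := K); omega
      obtain ⟨x, hx, hx2⟩ := exists_good M K (Algebra.trace M K) χ hT _ hD β hβ
        (Fintype.card K - 1).primeFactors
        (fun l hl => ⟨Nat.prime_of_mem_primeFactors hl,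
          hχ l (Nat.prime_of_mem_primeFactors hl) (Nat.dvd_of_mem_primeFactors hl)⟩) hW
      exact ⟨x, hx, fun l hl hd => hx2 l (Nat.mem_primeFactors.mpr ⟨hl, hd, h1⟩)⟩
    rcases hp.two_le.eq_or_lt with h2 | h3
    · subst h2
      have hQ' : Fintype.card M = 4 ^ j := by rw [hQ]; norm_num
      by_cases h4 : 4 ≤ j
      · apply big
        rw [hK, hQ']
        simpa using aux_arith2 j h4
      · refine exists_good_small M K (Algebra.trace M K) χ hT (by rw [hK, sq]) ?_ hχ β hβ
        rw [hQ']
        have : j = 1 ∨ j = 2 ∨ j = 3 := by omega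
        rcases this with h | h | h <;> subst h <;> norm_num
    · apply big
      rw [hK, hQ]
      exact aux_arith3 p j hp h3 hj
  obtain ⟨x, hx, hx2⟩ := key
  have hx0 : x ≠ 0 := by
    rintro rfl
    rw [map_zero] at hx
    exact hβ hx.symm
  exact ⟨x, aux_prim K x hx0 χ hχ hx2, hnorm x hx⟩

end
end
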